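/- arXiv:2605.00995 — 2 statements merged into one kernel-verified Lean document; each statement's English description precedes it below -/
import Mathlib

section
/- For every positive integer d and every ε ∈ (0,1], there exist ε' > 0 and C > 0 such that the following holds: for all positive integers m, n and all functions P₁,…,Pₙ : 𝔽₂^m → 𝔽₂ each of degree at most d, ‖(P₁,…,Pₙ) − Ber(1/3)^⊗n‖_TV ≥ 1 − C·n^{−ε'} − C·ε. In particular, for every fixed d and every ε > 0 there exists N such that for all n ≥ N, every m, and every such tuple, ‖(P₁,…,Pₙ) − Ber(1/3)^⊗n‖_TV ≥ 1 − ε. -/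
open Finset

/-- Distribution of `f(X)` on `β` for `X` uniform on the finite type `α`. -/
noncomputable def distOf {α β : Type*} [Fintype α] [DecidableEq β] (f : α → β) (y : β) : ℝ :=
  ((Finset.univ.filter fun x => f x = y).card : ℝ) / (Fintype.card α : ℝ)

/-- Output distribution on `𝔽₂ⁿ` of the tuple `(P₁(X),…,Pₙ(X))` for uniform `X ∈ 𝔽₂^m`. -/
noncomputable def outDist {m n : ℕ} (P : Fin n → (Fin m → ZMod 2) → ZMod 2) :
    (Fin n → ZMod 2) → ℝ :=
  distOf (fun x i => P i x)

/-- Total variation distance between two distributions on a finite type. -/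
noncomputable def tvDist {β : Type*} [Fintype β] (μ ν : β → ℝ) : ℝ :=
  (1 / 2) * ∑ y, |μ y - ν y|

/-- The distribution `Ber(1/3)^{⊗n}` on `𝔽₂ⁿ`. -/
noncomputable def ber13 {n : ℕ} (y : Fin n → ZMod 2) : ℝ :=
  (1 / 3 : ℝ) ^ (Finset.univ.filter fun i => y i = 1).card *
    (2 / 3 : ℝ) ^ (n - (Finset.univ.filter fun i => y i = 1).card)

/-- `P : 𝔽₂^m → 𝔽₂` has degree at most `d`. -/
def DegLE {m : ℕ} (d : ℕ) (P : (Fin m → ZMod 2) → ZMod 2) : Prop :=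
  ∃ p : MvPolynomial (Fin m) (ZMod 2), p.totalDegree ≤ d ∧ ∀ x, MvPolynomial.eval x p = P x

/-- `rank_{d'}(P) ≤ k`. -/
def RankLE {m : ℕ} (d' k : ℕ) (P : (Fin m → ZMod 2) → ZMod 2) : Prop :=
  ∃ (Q : Fin k → (Fin m → ZMod 2) → ZMod 2) (Γ : (Fin k → ZMod 2) → ZMod 2),
    (∀ j, DegLE d' (Q j)) ∧ ∀ x, P x = Γ (fun j => Q j x)

/-- `Pr_{X uniform}[P(X) = 1]`. -/
noncomputable def prOne {m : ℕ} (P : (Fin m → ZMod 2) → ZMod 2) : ℝ :=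
  distOf P 1


noncomputable def sg (a : ZMod 2) : ℝ := if a = 0 then 1 else -1

lemma zmod2_cases (a : ZMod 2) : a = 0 ∨ a = 1 := by
  revert a; decide

lemma sg_zero : sg 0 = 1 := by simp [sg]
lemma sg_one : sg 1 = -1 := by simp [sg]

lemma sg_add (a b : ZMod 2) : sg (a + b) = sg a * sg b := by
  have h11 : (1 + 1 : ZMod 2) = 0 := by decide
  rcases zmod2_cases a with rfl | rfl <;> rcases zmod2_cases b with rfl | rfl <;>
    simp [sg_zero, sg_one, h11]

lemma sg_sq (a : ZMod 2) : sg a * sg a = 1 := by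
  rcases zmod2_cases a with rfl | rfl <;> simp [sg_zero, sg_one]

lemma abs_sg (a : ZMod 2) : |sg a| = 1 := by
  rcases zmod2_cases a with rfl | rfl <;> simp [sg_zero, sg_one]

lemma z2_add_self (a : ZMod 2) : a + a = 0 := CharTwo.add_self_eq_zero a

abbrev LF (V : Type) := ℕ × (V → ZMod 2)

def Dg {V : Type} [AddCommGroup V] : ℕ → (V → ZMod 2) → Prop
  | 0, f => ∀ x y, f x = f y
  | e + 1, f => ∀ a, Dg e (fun x => f (x + a) + f x)

def Det {V β : Type} (X : Finset (LF V)) (f : V → β) : Prop :=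
  ∀ x y, (∀ q ∈ X, q.2 x = q.2 y) → f x = f y

def csum {V : Type} (c : Finset (LF V)) (x : V) : ZMod 2 := ∑ q ∈ c, q.2 x

noncomputable def mean {V : Type} [Fintype V] (g : V → ℝ) : ℝ :=
  (∑ x, g x) / (Fintype.card V : ℝ)

section deg
variable {V : Type} [AddCommGroup V]

lemma Dg_const (e : ℕ) (b : ZMod 2) : Dg e (fun _ : V => b) := by
  induction e generalizing b with
  | zero => intro x y; rfl
  | succ e ih => intro a; exact ih _

lemma Dg_succ {e : ℕ} {f : V → ZMod 2} (h : Dg e f) : Dg (e + 1) f := by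
  induction e generalizing f with
  | zero =>
    intro a
    have : (fun x => f (x + a) + f x) = fun _ => (0 : ZMod 2) := by
      funext x; rw [h (x + a) x]; exact z2_add_self _
    rw [this]; exact Dg_const 0 0
  | succ e ih => intro a; exact ih (h a)

lemma Dg_mono {e e' : ℕ} (hee : e ≤ e') {f : V → ZMod 2} (h : Dg e f) : Dg e' f := by
  induction hee with
  | refl => exact h
  | step _ ih => exact Dg_succ ih

lemma Dg_add {e : ℕ} {f g : V → ZMod 2} (hf : Dg e f) (hg : Dg e g) :
    Dg e (fun x => f x + g x) := by
  induction e generalizing f g with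
  | zero => intro x y; simp only; rw [hf x y, hg x y]
  | succ e ih =>
    intro a
    have := ih (hf a) (hg a)
    convert this using 2
    ring

lemma Dg_csum {e : ℕ} (c : Finset (LF V)) (h : ∀ q ∈ c, q.1 ≤ e ∧ Dg q.1 q.2) :
    Dg e (csum c) := by
  classical
  induction c using Finset.induction_on with
  | empty => unfold csum; simpa using Dg_const (V := V) e 0
  | insert q c hq ih =>
    have h1 := ih (fun r hr => h r (Finset.mem_insert_of_mem hr))
    have h2 := h q (Finset.mem_insert_self _ _)
    have h3 := Dg_add (Dg_mono h2.1 h2.2) h1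
    convert h3 using 1
    funext x; simp [csum, Finset.sum_insert hq]

lemma Dg_comp {U : Type} [AddCommGroup U] (φ : U →+ V) {e : ℕ} {f : V → ZMod 2} (x : V)
    (h : Dg e f) : Dg e (fun u => f (x + φ u)) := by
  induction e generalizing f with
  | zero => intro u w; exact h _ _
  | succ e ih =>
    intro a
    have := ih (h (φ a))
    convert this using 2
    simp [add_assoc]

lemma Dg_mul (n : ℕ) : ∀ {a b : ℕ}, a + b ≤ n → ∀ {f g : V → ZMod 2}, Dg a f → Dg b g →
    Dg n (fun x => f x * g x) := by
  induction n with
  | zero =>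
    intro a b hab f g hf hg
    have ha : a = 0 := by omega
    have hb : b = 0 := by omega
    subst ha; subst hb
    intro x y; simp only; rw [hf x y, hg x y]
  | succ n ih =>
    intro a b hab f g hf hg c
    have e1 : (fun x => f (x + c) * g (x + c) + f x * g x) =
        fun x => (f (x + c) * (g (x + c) + g x)) + ((f (x + c) + f x) * g x) := by
      funext x
      have := z2_add_self (f (x + c) * g x)
      linear_combination (-1 : ZMod 2) * this
    rw [e1]
    have hsh : Dg a (fun x => f (x + c)) := by
      have := Dg_comp (AddMonoidHom.id V) c hf
      convert this using 2
      simp [add_comm]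
    apply Dg_add
    · cases b with
      | zero =>
        have : (fun x => f (x + c) * (g (x + c) + g x)) = fun _ => (0 : ZMod 2) := by
          funext x; rw [hg (x + c) x, z2_add_self, mul_zero]
        rw [this]; exact Dg_const _ _
      | succ b => exact ih (by omega) hsh (hg c)
    · cases a with
      | zero =>
        have : (fun x => (f (x + c) + f x) * g x) = fun _ => (0 : ZMod 2) := by
          funext x; rw [hf (x + c) x, z2_add_self, zero_mul]
        rw [this]; exact Dg_const _ _
      | succ a => exact ih (by omega) (hf c) hg

lemma Dg_prod {ι : Type} (s : Finset ι) (e : ℕ) (f : ι → V → ZMod 2) (h : ∀ i ∈ s, Dg e (f i)) :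
    Dg (s.card * e) (fun x => ∏ i ∈ s, f i x) := by
  classical
  induction s using Finset.induction_on with
  | empty => simpa using Dg_const (V := V) 0 1
  | insert i s hi ih =>
    have h1 := ih (fun j hj => h j (Finset.mem_insert_of_mem hj))
    have h2 := h i (Finset.mem_insert_self _ _)
    have := Dg_mul ((insert i s).card * e) (by rw [Finset.card_insert_of_notMem hi]; ring_nf; rfl) h2 h1
    convert this using 2
    rw [Finset.prod_insert hi]

/-- minimum distance -/
lemma Dg_dist [Fintype V] (D : ℕ) : ∀ {f : V → ZMod 2}, Dg D f → (∃ x, f x ≠ 0) →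
    Fintype.card V ≤ 2 ^ D * (univ.filter fun x => f x ≠ 0).card := by
  classical
  induction D with
  | zero =>
    rintro f hf ⟨x, hx⟩
    have : (univ.filter fun x => f x ≠ 0) = univ := by
      ext y; simp only [mem_filter, mem_univ, true_and, iff_true]; rw [hf y x]; exact hx
    rw [this]; simp
  | succ D ih =>
    rintro f hf ⟨x, hx⟩
    by_cases hc : ∀ a, ∀ y, f (y + a) + f y = 0
    · have h0 : Dg 0 f := by
        intro y z
        have := hc (y - z) z
        rw [add_sub_cancel] at this
        exact CharTwo.add_eq_zero.mp this
      have : (univ.filter fun x => f x ≠ 0) = univ := by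
        ext y; simp only [mem_filter, mem_univ, true_and, iff_true]; rw [h0 y x]; exact hx
      rw [this, Finset.card_univ]
      exact Nat.le_mul_of_pos_left _ (by positivity)
    · push Not at hc
      obtain ⟨a, ha⟩ := hc
      have h1 := ih (hf a) ha
      have h2 : (univ.filter fun x => f (x + a) + f x ≠ 0).card ≤
          2 * (univ.filter fun x => f x ≠ 0).card := by
        have hsub : (univ.filter fun x => f (x + a) + f x ≠ 0) ⊆
            (univ.filter fun x => f (x + a) ≠ 0) ∪ (univ.filter fun x => f x ≠ 0) := by
          intro y hy
          simp only [mem_filter, mem_univ, true_and, mem_union] at hy ⊢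
          by_contra hcon
          push Not at hcon
          rw [hcon.1, hcon.2] at hy
          simp at hy
        have h3 : (univ.filter fun x => f (x + a) ≠ 0).card = (univ.filter fun x => f x ≠ 0).card := by
          apply Finset.card_bij (fun x _ => x + a)
          · intro y hy; simpa using hy
          · intro y _ z _ h; simpa using h
          · intro y hy; exact ⟨y - a, by simpa using hy, by simp⟩
        have h4 := (Finset.card_le_card hsub).trans (Finset.card_union_le _ _)
        omega
      calc Fintype.card V ≤ 2 ^ D * _ := h1
        _ ≤ 2 ^ D * (2 * _) := Nat.mul_le_mul_left _ h2
        _ = _ := by ring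

lemma cube_zero (e : ℕ) : ∀ {ι : Type} [DecidableEq ι] (s : Finset ι) (h : ι → V) {P : V → ZMod 2}
    (x : V), s.card = e + 1 → Dg e P → ∑ w ∈ s.powerset, P (x + ∑ i ∈ w, h i) = 0 := by
  induction e with
  | zero =>
    intro ι _ s h P x hs hP
    obtain ⟨i, rfl⟩ := Finset.card_eq_one.mp hs
    rw [← insert_empty_eq, Finset.sum_powerset_insert (by simp)]
    simp only [powerset_empty, sum_singleton, sum_empty, insert_empty_eq]
    rw [hP (x + h i) (x + 0)]; exact z2_add_self _
  | succ e ih =>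
    intro ι _ s h P x hs hP
    obtain ⟨i, t, hi, rfl, ht⟩ := Finset.card_eq_succ.mp hs
    rw [Finset.sum_powerset_insert hi, ← Finset.sum_add_distrib]
    rw [← ih t h x ht (hP (h i))]
    apply Finset.sum_congr rfl
    intro w hw
    have : i ∉ w := fun hh => hi (Finset.mem_powerset.mp hw hh)
    rw [Finset.sum_insert this, add_comm]
    congr 2
    abel

end deg

section exact
variable {V : Type} [AddCommGroup V] [Fintype V]

lemma shift_sum {U : Type} [AddCommGroup U] [Fintype U] (φ : U →+ V) (hφ : Function.Surjective φ)
    (F : V → ℝ) (x : V) :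
    (Fintype.card V : ℝ) * ∑ u, F (x + φ u) = Fintype.card U * ∑ v, F v := by
  have h1 : ∀ a : V, ∑ u, F (x + φ u) = ∑ u, F (x + φ u + a) := by
    intro a
    obtain ⟨b, rfl⟩ := hφ a
    rw [← Equiv.sum_comp (Equiv.addRight b) (fun u => F (x + φ u))]
    simp [add_assoc]
  have h2 : ∑ _a : V, ∑ u, F (x + φ u) = ∑ a : V, ∑ u, F (x + φ u + a) :=
    Finset.sum_congr rfl (fun a _ => h1 a)
  have h4 : ∑ a : V, ∑ u, F (x + φ u + a) = ∑ u, ∑ a : V, F (x + φ u + a) := Finset.sum_comm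
  rw [h4] at h2
  have h3 : ∀ u : U, ∑ a : V, F (x + φ u + a) = ∑ v, F v := fun u =>
    Equiv.sum_comp (Equiv.addLeft (x + φ u)) F
  rw [Finset.sum_congr rfl (fun u _ => h3 u)] at h2
  simp only [Finset.sum_const, Finset.card_univ, nsmul_eq_mul] at h2
  rw [← h2, Finset.mul_sum]

/-- exactness: closeness to a function determined by `C` implies equality. -/
lemma exact_of_close (e c : ℕ) {P f : V → ZMod 2} (C : Finset (LF V)) (hP : Dg e P)
    (hC : ∀ q ∈ C, q.1 ≤ e ∧ Dg q.1 q.2) (hc : C.card ≤ c) (hf : Det C f)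
    (hclose : ((univ.filter fun x => P x ≠ f x).card : ℝ) * (2 ^ (e + 1) * 2 ^ (2 ^ (e + 1) * c * e))
       < Fintype.card V) : Det C P := by
  classical
  suffices h : P = f by rw [h]; exact hf
  funext x
  let φ : Finset (Fin (e + 1)) → ((Fin (e + 1) → V) →+ V) := fun w =>
    { toFun := fun h => ∑ i ∈ w, h i
      map_zero' := by simp
      map_add' := by intro a b; simp [Finset.sum_add_distrib] }
  -- the indicator polynomial
  let g : (Fin (e + 1) → V) → ZMod 2 := fun h => ∏ p ∈ (univ : Finset (Fin (e+1))).powerset ×ˢ C,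
    (1 + (p.2.2 (x + φ p.1 h) + p.2.2 x))
  have hg : Dg (2 ^ (e + 1) * c * e) g := by
    have := Dg_prod (V := (Fin (e + 1) → V)) ((univ : Finset (Fin (e+1))).powerset ×ˢ C) e
      (fun p h => 1 + (p.2.2 (x + φ p.1 h) + p.2.2 x)) (by
        rintro ⟨w, q⟩ hp
        rw [Finset.mem_product] at hp
        have hq := hC q hp.2
        exact Dg_add (Dg_const _ _) (Dg_add (Dg_comp (φ w) x (Dg_mono hq.1 hq.2)) (Dg_const _ _)))
    refine Dg_mono ?_ this
    rw [Finset.card_product, Finset.card_powerset, Finset.card_univ, Fintype.card_fin]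
    gcongr
  have hg0 : g 0 ≠ 0 := by
    simp only [g, map_zero, add_zero]
    rw [Finset.prod_eq_one]
    · exact one_ne_zero
    · intro p _; rw [z2_add_self, add_zero]
  have hdist := Dg_dist _ hg ⟨0, hg0⟩
  -- bad set
  let bad : Finset (Fin (e + 1) → V) := univ.filter fun h => ∃ w ∈ (univ : Finset (Fin (e+1))).powerset, w ≠ ∅ ∧
    P (x + φ w h) ≠ f (x + φ w h)
  have hVpos : (0:ℝ) < Fintype.card V := by exact_mod_cast Fintype.card_pos
  have hUpos : (0:ℝ) < Fintype.card (Fin (e + 1) → V) := by exact_mod_cast Fintype.card_pos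
  have hbad : (Fintype.card V : ℝ) * (bad.card : ℝ) ≤
      2 ^ (e + 1) * (Fintype.card (Fin (e + 1) → V) * ((univ.filter fun x => P x ≠ f x).card : ℝ)) := by
    have h1 : (bad.card : ℝ) ≤ ∑ w ∈ (univ : Finset (Fin (e+1))).powerset.filter (· ≠ ∅),
        ((univ.filter fun h : (Fin (e + 1) → V) => P (x + φ w h) ≠ f (x + φ w h)).card : ℝ) := by
      have : bad ⊆ ((univ : Finset (Fin (e+1))).powerset.filter (· ≠ ∅)).biUnion
          (fun w => univ.filter fun h : (Fin (e + 1) → V) => P (x + φ w h) ≠ f (x + φ w h)) := by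
        intro h hh
        simp only [bad, mem_filter, mem_univ, true_and] at hh
        obtain ⟨w, hw, hw0, hw2⟩ := hh
        simp only [Finset.mem_biUnion, mem_filter, mem_univ, true_and]
        exact ⟨w, ⟨hw, hw0⟩, hw2⟩
      exact_mod_cast (Finset.card_le_card this).trans Finset.card_biUnion_le
    have h2 : ∀ w ∈ (univ : Finset (Fin (e+1))).powerset.filter (· ≠ ∅),
        (Fintype.card V : ℝ) * ((univ.filter fun h : (Fin (e + 1) → V) => P (x + φ w h) ≠ f (x + φ w h)).card : ℝ)
        = Fintype.card (Fin (e + 1) → V) * ((univ.filter fun x => P x ≠ f x).card : ℝ) := by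
      intro w hw
      obtain ⟨i, hi⟩ := Finset.nonempty_iff_ne_empty.mpr (Finset.mem_filter.mp hw).2
      have hs : Function.Surjective (φ w) := by
        intro v
        refine ⟨Pi.single i v, ?_⟩
        simp only [φ, AddMonoidHom.coe_mk, ZeroHom.coe_mk]
        rw [Finset.sum_eq_single i]
        · simp
        · intro j _ hj; simp [hj]
        · intro h; exact absurd hi h
      have := shift_sum (φ w) hs (fun v => if P v ≠ f v then (1:ℝ) else 0) x
      simp only [Finset.sum_boole] at this; exact this
    calc (Fintype.card V : ℝ) * (bad.card : ℝ) ≤ Fintype.card V *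
        ∑ w ∈ (univ : Finset (Fin (e+1))).powerset.filter (· ≠ ∅),
        ((univ.filter fun h : Fin (e + 1) → V => P (x + φ w h) ≠ f (x + φ w h)).card : ℝ) := by gcongr
      _ = ∑ w ∈ (univ : Finset (Fin (e+1))).powerset.filter (· ≠ ∅),
          (Fintype.card (Fin (e + 1) → V) * ((univ.filter fun x => P x ≠ f x).card : ℝ)) := by
        rw [Finset.mul_sum]; exact Finset.sum_congr rfl h2
      _ ≤ _ := by
        rw [Finset.sum_const, nsmul_eq_mul]
        gcongr
        have := Finset.card_filter_le ((univ : Finset (Fin (e+1))).powerset) (· ≠ ∅)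
        rw [Finset.card_powerset, Finset.card_univ, Fintype.card_fin] at this
        exact_mod_cast this
  have hlt : bad.card < (univ.filter fun h => g h ≠ 0).card := by
    by_contra hcon
    push Not at hcon
    have h1 : (Fintype.card (Fin (e + 1) → V) : ℝ) ≤ 2 ^ (2 ^ (e + 1) * c * e) * bad.card := by
      have : Fintype.card (Fin (e + 1) → V) ≤ 2 ^ (2 ^ (e + 1) * c * e) * bad.card :=
        hdist.trans (Nat.mul_le_mul_left _ hcon)
      exact_mod_cast this
    set N := ((univ.filter fun x => P x ≠ f x).card : ℝ)
    set K : ℝ := 2 ^ (2 ^ (e + 1) * c * e)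
    have hK : 0 < K := by positivity
    have h2 : (Fintype.card V : ℝ) * Fintype.card (Fin (e + 1) → V) ≤ K * (2 ^ (e+1) * (Fintype.card (Fin (e + 1) → V) * N)) := by
      calc (Fintype.card V : ℝ) * Fintype.card (Fin (e + 1) → V) ≤ Fintype.card V * (K * bad.card) := by gcongr
        _ = K * (Fintype.card V * bad.card) := by ring
        _ ≤ _ := by gcongr
    have h3 : (Fintype.card V : ℝ) * Fintype.card (Fin (e + 1) → V) ≤ (N * (2 ^ (e+1) * K)) * Fintype.card (Fin (e + 1) → V) := by
      linarith
    have := le_of_mul_le_mul_right h3 hUpos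
    linarith
  obtain ⟨h, hh1, hh2⟩ := Finset.exists_mem_notMem_of_card_lt_card hlt
  have hgh : g h ≠ 0 := by simpa using hh1
  have hcst : ∀ w : Finset (Fin (e+1)), ∀ q ∈ C, q.2 (x + φ w h) = q.2 x := by
    intro w q hq
    have := Finset.prod_ne_zero_iff.mp hgh (w, q) (by simp [hq])
    by_contra hne
    apply this
    simp only
    rcases zmod2_cases (q.2 (x + φ w h)) with h1 | h1 <;>
      rcases zmod2_cases (q.2 x) with h2 | h2 <;> rw [h1, h2] at hne ⊢ <;> first | (exact absurd rfl hne) | decide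
  have hcube := cube_zero e (univ : Finset (Fin (e+1))) h x (by simp) hP
  have hcubef : ∑ w ∈ (univ : Finset (Fin (e+1))).powerset, f x = 0 := by
    rw [Finset.sum_const, Finset.card_powerset, Finset.card_univ, Fintype.card_fin, pow_succ]
    rw [mul_comm, mul_smul, two_smul, z2_add_self]
  rw [← Finset.add_sum_erase _ _ (Finset.empty_mem_powerset _)] at hcube hcubef
  have heq : ∑ w ∈ (univ : Finset (Fin (e+1))).powerset.erase ∅, P (x + ∑ i ∈ w, h i) =
      ∑ w ∈ (univ : Finset (Fin (e+1))).powerset.erase ∅, f x := by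
    apply Finset.sum_congr rfl
    intro w hw
    rw [Finset.mem_erase] at hw
    have h1 : P (x + φ w h) = f (x + φ w h) := by
      by_contra hne
      apply hh2
      simp only [bad, mem_filter, mem_univ, true_and]
      exact ⟨w, hw.2, hw.1, hne⟩
    have h2 : f (x + φ w h) = f x := hf _ _ (hcst w)
    exact h1.trans h2
  rw [heq] at hcube
  simp only [Finset.sum_empty, add_zero] at hcube
  have := hcube.trans hcubef.symm
  exact add_right_cancel this
end exact


lemma Det_mono {V β : Type} {X Y : Finset (LF V)} {f : V → β} (h : X ⊆ Y) (hf : Det X f) : Det Y f :=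
  fun x y hxy => hf x y (fun q hq => hxy q (h hq))

lemma lf_fourier {V : Type} [DecidableEq (LF V)] (C X : Finset (LF V)) : ∀ (f : V → ℝ),
    (∀ x, |f x| ≤ 1) → Det (X ∪ C) f →
    ∃ w : Finset (LF V) → V → ℝ, (∀ c, Det C (w c)) ∧ (∀ c x, |w c x| ≤ 1) ∧
      (∀ x, f x = ∑ c ∈ X.powerset, w c x * sg (csum c x)) ∧
      ∀ j : ℕ, (∀ x, ∃ z : ℤ, f x * 2 ^ j = z) → ∀ x, ∃ z : ℤ, w ∅ x * 2 ^ (j + X.card) = z := by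
  classical
  induction X using Finset.induction_on with
  | empty =>
    intro f hf hd
    refine ⟨fun _ => f, fun _ => ?_, fun _ => hf, ?_, ?_⟩
    · simpa using hd
    · intro x; simp [csum, sg_zero]
    · intro j h; simpa using h
  | insert q X hq ih =>
    intro f hf hd
    let p : ZMod 2 → V → V → Prop := fun b x y => (∀ r ∈ X ∪ C, r.2 y = r.2 x) ∧ q.2 y = b
    let F : ZMod 2 → V → ℝ := fun b x => if h : ∃ y, p b x y then f h.choose else 0
    have hF1 : ∀ b x, |F b x| ≤ 1 := by
      intro b x
      simp only [F]
      split_ifs with h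
      · exact hf _
      · simp
    have hFd : ∀ b, Det (X ∪ C) (F b) := by
      intro b x x' hx
      have : p b x = p b x' := by
        funext y
        simp only [p]
        apply propext
        constructor
        · rintro ⟨h1, h2⟩; exact ⟨fun r hr => (h1 r hr).trans (hx r hr), h2⟩
        · rintro ⟨h1, h2⟩; exact ⟨fun r hr => (h1 r hr).trans (hx r hr).symm, h2⟩
      simp only [F, this]
    have hFz : ∀ b j, (∀ x, ∃ z : ℤ, f x * 2 ^ j = z) → ∀ x, ∃ z : ℤ, F b x * 2 ^ j = z := by
      intro b j h x
      simp only [F]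
      split_ifs with h'
      · exact h _
      · exact ⟨0, by simp⟩
    have hFe : ∀ x, F (q.2 x) x = f x := by
      intro x
      have h : ∃ y, p (q.2 x) x y := ⟨x, fun _ _ => rfl, rfl⟩
      simp only [F, dif_pos h]
      apply hd
      intro r hr
      have := h.choose_spec
      rw [Finset.insert_union, Finset.mem_insert] at hr
      rcases hr with rfl | hr
      · exact this.2
      · exact this.1 r hr
    obtain ⟨u, u1, u2, u3, u4⟩ := ih (fun x => (F 0 x + F 1 x) / 2)
      (by intro x; have := abs_le.mp (hF1 0 x); have := abs_le.mp (hF1 1 x)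
          rw [abs_le]; constructor <;> linarith)
      (by intro x y h; simp only; rw [hFd 0 x y h, hFd 1 x y h])
    obtain ⟨v, v1, v2, v3, v4⟩ := ih (fun x => (F 0 x - F 1 x) / 2)
      (by intro x; have := abs_le.mp (hF1 0 x); have := abs_le.mp (hF1 1 x)
          rw [abs_le]; constructor <;> linarith)
      (by intro x y h; simp only; rw [hFd 0 x y h, hFd 1 x y h])
    refine ⟨fun c => if q ∈ c then v (c.erase q) else u c, ?_, ?_, ?_, ?_⟩
    · intro c; simp only; split_ifs
      · exact v1 _
      · exact u1 _
    · intro c x; simp only; split_ifs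
      · exact v2 _ _
      · exact u2 _ _
    · intro x
      rw [Finset.sum_powerset_insert hq]
      have e1 : ∑ c ∈ X.powerset, (if q ∈ c then v (c.erase q) else u c) x * sg (csum c x)
          = (F 0 x + F 1 x) / 2 := by
        rw [u3 x]
        apply Finset.sum_congr rfl
        intro c hc
        rw [if_neg (fun h => hq (Finset.mem_powerset.mp hc h))]
      have e2 : ∑ c ∈ X.powerset, (if q ∈ insert q c then v ((insert q c).erase q) else u (insert q c)) x
          * sg (csum (insert q c) x) = sg (q.2 x) * ((F 0 x - F 1 x) / 2) := by
        rw [v3 x, Finset.mul_sum]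
        apply Finset.sum_congr rfl
        intro c hc
        have hqc : q ∉ c := fun h => hq (Finset.mem_powerset.mp hc h)
        rw [if_pos (Finset.mem_insert_self _ _), Finset.erase_insert hqc]
        simp only [csum]
        rw [Finset.sum_insert hqc, sg_add]
        ring
      rw [e1, e2, ← hFe x]
      rcases zmod2_cases (q.2 x) with h | h <;> rw [h]
      · rw [sg_zero]; ring
      · rw [sg_one]; ring
    · intro j h x
      simp only [Finset.notMem_empty, if_false]
      have := u4 (j + 1) (by
        intro x
        obtain ⟨z0, h0⟩ := hFz 0 j h x
        obtain ⟨z1, h1⟩ := hFz 1 j h x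
        refine ⟨z0 + z1, ?_⟩
        push_cast
        rw [← h0, ← h1, pow_succ]; ring) x
      rw [Finset.card_insert_of_notMem hq]
      rwa [show j + (X.card + 1) = j + 1 + X.card by ring]

section mean
variable {V : Type} [Fintype V]

lemma mean_sum {ι : Type} (s : Finset ι) (f : ι → V → ℝ) :
    mean (fun x => ∑ i ∈ s, f i x) = ∑ i ∈ s, mean (f i) := by
  unfold mean
  rw [Finset.sum_comm, Finset.sum_div]

lemma mean_smul (a : ℝ) (f : V → ℝ) : mean (fun x => a * f x) = a * mean f := by
  unfold mean
  rw [← Finset.mul_sum, mul_div_assoc]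

lemma mean_mono {f g : V → ℝ} (h : ∀ x, f x ≤ g x) : mean f ≤ mean g := by
  unfold mean
  gcongr with x
  exact h x

lemma mean_const_le (a : ℝ) (ha : 0 ≤ a) : mean (fun _ : V => a) ≤ a := by
  unfold mean
  rw [Finset.sum_const, Finset.card_univ, nsmul_eq_mul]
  rcases Nat.eq_zero_or_pos (Fintype.card V) with h | h
  · rw [h]; simpa using ha
  · have : (0:ℝ) < Fintype.card V := by exact_mod_cast h
    rw [mul_div_assoc, mul_div_cancel₀]
    exact this.ne'

def GoodP (C Q Q' : Finset (LF V)) (δ : ℝ) : Prop :=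
  ∀ c1 ⊆ Q, ∀ c2 ⊆ Q', ∀ s ⊆ C, c1.Nonempty → c2.Nonempty →
    |mean (fun x => sg (csum c1 x + csum c2 x + csum s x))| < δ

lemma mean_bound (C : Finset (LF V)) (c : ℕ) (hc : C.card ≤ c) (φ F : V → ℝ)
    (hφ : ∀ x, |φ x| ≤ 1) (hd : Det C φ) (δ : ℝ) (hδ : 0 ≤ δ)
    (h : ∀ s ⊆ C, |mean (fun x => F x * sg (csum s x))| ≤ δ) :
    |mean (fun x => φ x * F x)| ≤ 2 ^ c * δ := by
  classical
  obtain ⟨w, w1, w2, w3, -⟩ := lf_fourier ∅ C φ hφ (by simpa using hd)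
  rcases isEmpty_or_nonempty V with hV | ⟨⟨x0⟩⟩
  · simp [mean]; positivity
  have e : (fun x => φ x * F x) =
      fun x => ∑ s ∈ C.powerset, w s x0 * (F x * sg (csum s x)) := by
    funext x
    rw [w3 x, Finset.sum_mul]
    apply Finset.sum_congr rfl
    intro s _
    rw [w1 s x x0 (by simp)]; ring
  rw [e, mean_sum]
  calc _ ≤ ∑ s ∈ C.powerset, |mean fun x => w s x0 * (F x * sg (csum s x))| :=
        Finset.abs_sum_le_sum_abs _ _
    _ ≤ ∑ s ∈ C.powerset, δ := by
        apply Finset.sum_le_sum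
        intro s hs
        rw [mean_smul, abs_mul]
        have h1 := w2 s x0
        have h2 := h s (Finset.mem_powerset.mp hs)
        calc _ ≤ 1 * δ := by gcongr
          _ = δ := one_mul _
    _ ≤ _ := by
        rw [Finset.sum_const, Finset.card_powerset, nsmul_eq_mul]
        push_cast
        gcongr
        norm_num

lemma second_moment {I : Type} [Fintype I] [DecidableEq (LF V)] (C : Finset (LF V)) (Q : I → Finset (LF V)) (c : ℕ)
    (hC : C.card ≤ c) (hQ : ∀ i, (Q i).card ≤ c) (A : Finset I) (δ : ℝ) (hδ : 0 < δ)
    (hbad : (({p : I × I | p.1 ∈ A ∧ p.2 ∈ A ∧ ¬ GoodP C (Q p.1) (Q p.2) δ} : Set (I × I)).ncard : ℝ)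
      ≤ 2 * δ * (Fintype.card I : ℝ) ^ 2)
    (u : I → V → ℝ) (hu : ∀ i x, |u i x| ≤ 1) (hd : ∀ i, Det (Q i ∪ C) (u i)) :
    ∃ m : I → V → ℝ, (∀ i, Det C (m i)) ∧ (∀ i x, |m i x| ≤ 1) ∧
      ((∀ i x, ∃ z : ℤ, u i x = z) → ∀ i x, ∃ z : ℤ, m i x * 2 ^ c = z) ∧
      ∀ s : I → V → ℝ, (∀ i, Det C (s i)) → (∀ i x, |s i x| ≤ 1) →
        mean (fun x => (∑ i ∈ A, s i x * (u i x - m i x)) ^ 2) ≤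
          (8 ^ c + 8) * δ * (Fintype.card I : ℝ) ^ 2 := by
  classical
  choose w w1 w2 w3 w4 using fun i => lf_fourier C (Q i) (u i) (hu i) (hd i)
  refine ⟨fun i => w i ∅, fun i => w1 i ∅, fun i x => w2 i ∅ x, ?_, ?_⟩
  · intro h i x
    obtain ⟨z, hz⟩ := w4 i 0 (by simpa using h i) x
    refine ⟨z * 2 ^ (c - (Q i).card), ?_⟩
    push_cast
    rw [← hz, zero_add, mul_assoc, ← pow_add, Nat.add_sub_cancel' (hQ i)]
  intro s hs1 hs2
  have hexp : ∀ i x, u i x - w i ∅ x = ∑ c1 ∈ (Q i).powerset.erase ∅, w i c1 x * sg (csum c1 x) := by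
    intro i x
    rw [w3 i x, ← Finset.add_sum_erase _ _ (Finset.empty_mem_powerset (Q i))]
    simp [csum, sg_zero]
  have hcov : ∀ i j, GoodP C (Q i) (Q j) δ →
      mean (fun x => (s i x * (u i x - w i ∅ x)) * (s j x * (u j x - w j ∅ x))) ≤ 8 ^ c * δ := by
    intro i j hg
    have e : (fun x => (s i x * (u i x - w i ∅ x)) * (s j x * (u j x - w j ∅ x))) =
        fun x => ∑ p ∈ ((Q i).powerset.erase ∅) ×ˢ ((Q j).powerset.erase ∅),
          (s i x * s j x * w i p.1 x * w j p.2 x) * (sg (csum p.1 x) * sg (csum p.2 x)) := by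
      funext x
      rw [hexp, hexp, Finset.sum_product]
      rw [show ∀ a b c d : ℝ, (a * b) * (c * d) = (a * c) * (b * d) by intros; ring,
        Finset.sum_mul_sum, Finset.mul_sum]
      apply Finset.sum_congr rfl
      intro a _
      rw [Finset.mul_sum]
      apply Finset.sum_congr rfl
      intro b _
      ring
    rw [e, mean_sum]
    calc _ ≤ ∑ p ∈ ((Q i).powerset.erase ∅) ×ˢ ((Q j).powerset.erase ∅), (2 ^ c * δ : ℝ) := by
          apply Finset.sum_le_sum
          rintro ⟨c1, c2⟩ hp
          rw [Finset.mem_product, Finset.mem_erase, Finset.mem_erase, Finset.mem_powerset,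
            Finset.mem_powerset] at hp
          refine (le_abs_self _).trans ?_
          apply mean_bound C c hC _ _ _ _ δ hδ.le
          · intro t ht
            have := hg c1 hp.1.2 c2 hp.2.2 t ht (Finset.nonempty_iff_ne_empty.mpr hp.1.1)
              (Finset.nonempty_iff_ne_empty.mpr hp.2.1)
            simp only [sg_add] at this
            exact this.le
          · intro x
            rw [abs_mul, abs_mul, abs_mul]
            have h1 := hs2 i x
            have h2 := hs2 j x
            have h3 := w2 i c1 x
            have h4 := w2 j c2 x
            calc _ ≤ (1:ℝ) * 1 * 1 * 1 := by gcongr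
              _ = 1 := by norm_num
          · intro x y hxy
            simp only
            rw [hs1 i x y hxy, hs1 j x y hxy, w1 i c1 x y hxy, w1 j c2 x y hxy]
      _ ≤ 2 ^ c * 2 ^ c * (2 ^ c * δ) := by
          rw [Finset.sum_const, nsmul_eq_mul, Finset.card_product]
          have h1 : ∀ i, (((Q i).powerset.erase ∅).card : ℝ) ≤ 2 ^ c := by
            intro i
            have : ((Q i).powerset.erase ∅).card ≤ 2 ^ c := by
              refine (Finset.card_erase_le).trans ?_
              rw [Finset.card_powerset]
              exact Nat.pow_le_pow_right (by norm_num) (hQ i)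
            exact_mod_cast this
          push_cast
          gcongr
          · exact h1 i
          · exact h1 j
      _ = 8 ^ c * δ := by
          rw [show (8:ℝ) = 2 * 2 * 2 by norm_num, mul_pow, mul_pow]; ring
  have htriv : ∀ i j,
      mean (fun x => (s i x * (u i x - w i ∅ x)) * (s j x * (u j x - w j ∅ x))) ≤ 4 := by
    intro i j
    refine (mean_mono (g := fun _ => 4) ?_).trans (mean_const_le 4 (by norm_num))
    intro x
    have hb : ∀ i, |s i x * (u i x - w i ∅ x)| ≤ 2 := by
      intro i
      rw [abs_mul]
      have h1 := hs2 i x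
      have h2 : |u i x - w i ∅ x| ≤ 2 := by
        have := abs_le.mp (hu i x); have := abs_le.mp (w2 i ∅ x)
        rw [abs_le]; constructor <;> linarith
      calc _ ≤ (1:ℝ) * 2 := by gcongr
        _ = 2 := by norm_num
    refine (le_abs_self _).trans ?_
    rw [abs_mul]
    calc _ ≤ (2:ℝ) * 2 := by gcongr <;> apply hb
      _ = 4 := by norm_num
  have e : (fun x => (∑ i ∈ A, s i x * (u i x - w i ∅ x)) ^ 2) =
      fun x => ∑ p ∈ A ×ˢ A, (s p.1 x * (u p.1 x - w p.1 ∅ x)) * (s p.2 x * (u p.2 x - w p.2 ∅ x)) := by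
    funext x
    rw [sq, Finset.sum_mul_sum, Finset.sum_product]
  rw [e, mean_sum]
  have hcard : ((A ×ˢ A).card : ℝ) ≤ (Fintype.card I : ℝ) ^ 2 := by
    rw [Finset.card_product, sq]
    have := Finset.card_le_univ A
    exact_mod_cast Nat.mul_le_mul this this
  calc _ ≤ ∑ p ∈ A ×ˢ A, (8 ^ c * δ + if ¬ GoodP C (Q p.1) (Q p.2) δ then 4 else 0) := by
        apply Finset.sum_le_sum
        intro p _
        split_ifs with h
        · have := hcov p.1 p.2 h
          linarith
        · have := htriv p.1 p.2
          have : 0 ≤ 8 ^ c * δ := by positivity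
          linarith
    _ = (A ×ˢ A).card * (8 ^ c * δ) + ((A ×ˢ A).filter fun p => ¬ GoodP C (Q p.1) (Q p.2) δ).card * 4 := by
        rw [Finset.sum_add_distrib, Finset.sum_const, nsmul_eq_mul, ← Finset.sum_filter,
          Finset.sum_const, nsmul_eq_mul]
    _ ≤ (Fintype.card I : ℝ) ^ 2 * (8 ^ c * δ) + (2 * δ * (Fintype.card I : ℝ) ^ 2) * 4 := by
        have : (((A ×ˢ A).filter fun p => ¬ GoodP C (Q p.1) (Q p.2) δ).card : ℝ) ≤
            2 * δ * (Fintype.card I : ℝ) ^ 2 := by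
          rw [← Set.ncard_coe_finset]
          convert hbad using 3
          ext p
          simp [and_assoc]
        gcongr
    _ = _ := by ring
end mean


def ExR (e : ℕ) (δ : ℝ) (R : ℕ) : Prop :=
  ∀ (V : Type) [AddCommGroup V] [Fintype V] (P : V → ZMod 2), Dg e P →
    δ ≤ |mean (fun x => sg (P x))| →
    ∃ N : Finset (LF V), N.card ≤ R ∧ (∀ q ∈ N, q.1 < e ∧ Dg q.1 q.2) ∧ Det N P

def ExS (e : ℕ) : Prop := ∀ δ : ℝ, 0 < δ → ∃ R : ℕ, ExR e δ R

def Det2 {V β : Type} (X Y : Finset (LF V)) (f : V → β) : Prop :=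
  ∀ x y, (∀ q ∈ X, q.2 x = q.2 y) → (∀ q ∈ Y, q.2 x = q.2 y) → f x = f y

structure St (E : ℕ) (lam : ℝ) (T : Multiset ℕ) (κ : ℕ) {V I : Type} [AddCommGroup V] [Fintype I]
    (C : Finset (LF V)) (Q : I → Finset (LF V)) : Prop where
  hC : ∀ q ∈ C, q.1 ≤ E ∧ Dg q.1 q.2
  hQ : ∀ i, ∀ q ∈ Q i, q.1 ≤ E ∧ Dg q.1 q.2
  hκ : ∀ i, (Q i).card ≤ κ
  hTC : ∀ D, (C.filter (fun q => q.1 = D)).card ≤ T.count (2 * D)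
  hTQ : ∀ D, ((∑ i, ((Q i).filter (fun q => q.1 = D)).card : ℕ) : ℝ) ≤
    lam * T.count (2 * D + 1) * Fintype.card I

def Out (E : ℕ) (lam : ℝ) (acc : ℕ → ℝ) (B : ℕ) {V I : Type} [AddCommGroup V] [Fintype V] [Fintype I]
    (C : Finset (LF V)) (Q : I → Finset (LF V)) : Prop :=
  ∃ (C' : Finset (LF V)) (Q' : I → Finset (LF V)) (c : ℕ), c ≤ B ∧ C'.card ≤ c ∧
    (∀ i, (Q' i).card ≤ c) ∧ (∀ q ∈ C', q.1 ≤ E ∧ Dg q.1 q.2) ∧ (∀ q ∈ C, Det C' q.2) ∧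
    (∀ i, ∀ q ∈ Q i, Det2 (Q' i) C' q.2) ∧
    ∃ A : Finset I, (Fintype.card I : ℝ) ≤ A.card + 2 * (E + 1) * lam * Fintype.card I ∧
      (({p : I × I | p.1 ∈ A ∧ p.2 ∈ A ∧ ¬ GoodP C' (Q' p.1) (Q' p.2) (acc c)} : Set (I × I)).ncard : ℝ)
      ≤ 2 * acc c * (Fintype.card I : ℝ) ^ 2

lemma Out_trans {E : ℕ} {lam : ℝ} {acc : ℕ → ℝ} {B B' : ℕ} (hB : B ≤ B') {V I : Type} [AddCommGroup V]
    [Fintype V] [Fintype I] {C C1 : Finset (LF V)} {Q Q1 : I → Finset (LF V)}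
    (hC : ∀ q ∈ C, Det C1 q.2) (hQ : ∀ i, ∀ q ∈ Q i, Det2 (Q1 i) C1 q.2)
    (h : Out E lam acc B C1 Q1) : Out E lam acc B' C Q := by
  obtain ⟨C', Q', c, h1, h2, h3, h4, h5, h6, h7⟩ := h
  refine ⟨C', Q', c, h1.trans hB, h2, h3, h4, ?_, ?_, h7⟩
  · intro q hq x y hxy
    exact hC q hq x y (fun r hr => h5 r hr x y hxy)
  · intro i q hq x y hx hy
    exact hQ i q hq x y (fun r hr => h6 i r hr x y hx hy) (fun r hr => h5 r hr x y hy)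

lemma greedy {I : Type} [Fintype I] (Red : I → I → Prop) (δ : ℝ) (hδ1 : δ ≤ 1)
    (H : Finset I)
    (hH : ∀ i ∈ H, δ * Fintype.card I ≤ (({i' | Red i i'} : Set I).ncard : ℝ)) (r : ℕ) :
    ∃ S U : Finset I, S.card ≤ r ∧ U ⊆ H ∧ (U.card : ℝ) ≤ (1 - δ) ^ r * H.card ∧
      ∀ i ∈ H, i ∉ U → ∃ i' ∈ S, Red i i' := by
  classical
  induction r with
  | zero =>
    refine ⟨∅, H, by simp, Finset.Subset.refl _, by simp, fun i hi h => absurd hi h⟩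
  | succ r ih =>
    obtain ⟨S, U, hS, hUH, hU, hcov⟩ := ih
    rcases U.eq_empty_or_nonempty with h0 | ⟨i0, hi0⟩
    · refine ⟨S, U, by omega, hUH, ?_, hcov⟩
      rw [h0]
      simp only [card_empty, Nat.cast_zero]
      have : 0 ≤ 1 - δ := by linarith
      positivity
    have hI : (0:ℝ) < Fintype.card I := by exact_mod_cast Fintype.card_pos_iff.mpr ⟨i0⟩
    have hex : ∃ i' ∈ (univ : Finset I), δ * U.card ≤ ((U.filter fun i => Red i i').card : ℝ) := by
      apply Finset.exists_le_of_sum_le ⟨i0, mem_univ _⟩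
      have h1 : ∑ i' : I, (U.filter fun i => Red i i').card = ∑ i ∈ U, (univ.filter fun i' => Red i i').card := by
        simp only [Finset.card_filter]
        exact Finset.sum_comm
      have h2 : ∑ i' : I, ((U.filter fun i => Red i i').card : ℝ) =
          ∑ i ∈ U, ((univ.filter fun i' => Red i i').card : ℝ) := by exact_mod_cast h1
      rw [h2, Finset.sum_const, Finset.card_univ, nsmul_eq_mul]
      calc _ = ∑ i ∈ U, (δ * Fintype.card I) := by rw [Finset.sum_const, nsmul_eq_mul]; ring
        _ ≤ _ := Finset.sum_le_sum (fun i hi => by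
          have := hH i (hUH hi)
          have e : ({i' | Red i i'} : Set I) = ((univ.filter fun i' => Red i i' : Finset I) : Set I) := by
            ext j; simp
          rw [e, Set.ncard_coe_finset] at this
          exact this)
    obtain ⟨i', -, hi'⟩ := hex
    refine ⟨insert i' S, U.filter fun i => ¬ Red i i', (Finset.card_insert_le _ _).trans (by omega),
      (Finset.filter_subset _ _).trans hUH, ?_, ?_⟩
    · have h3 := Finset.card_filter_add_card_filter_not (s := U) (fun i => Red i i')
      have h4 : ((U.filter fun i => Red i i').card : ℝ) + ((U.filter fun i => ¬ Red i i').card : ℝ) = U.card := by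
        exact_mod_cast h3
      have h5 : ((U.filter fun i => ¬ Red i i').card : ℝ) ≤ (1 - δ) * U.card := by linarith
      refine h5.trans ?_
      rw [pow_succ']
      have : 0 ≤ 1 - δ := by linarith
      calc (1 - δ) * (U.card : ℝ) ≤ (1 - δ) * ((1 - δ) ^ r * H.card) := by gcongr
        _ = _ := by ring
    · intro i hi hiU
      by_cases hh : i ∈ U
      · refine ⟨i', Finset.mem_insert_self _ _, ?_⟩
        by_contra hcon
        exact hiU (Finset.mem_filter.mpr ⟨hh, hcon⟩)
      · obtain ⟨j, hj, hj2⟩ := hcov i hi hh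
        exact ⟨j, Finset.mem_insert_of_mem hj, hj2⟩

lemma count_T' (T : Multiset ℕ) (a M x : ℕ) :
    (T.erase a + M • Multiset.range a).count x =
      (if x = a then T.count a - 1 else T.count x) + if x < a then M else 0 := by
  rw [Multiset.count_add, Multiset.count_nsmul]
  congr 1
  · split_ifs with h
    · subst h; rw [Multiset.count_erase_self]
    · rw [Multiset.count_erase_of_ne h]
  · rw [Multiset.count_eq_of_nodup (Multiset.nodup_range a)]
    simp only [Multiset.mem_range]
    split_ifs <;> simp

lemma cut_T' (T : Multiset ℕ) (a M : ℕ) (ha : a ∈ T) :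
    Relation.CutExpand (· < ·) (T.erase a + M • Multiset.range a) T := by
  refine ⟨M • Multiset.range a, a, ?_, ?_⟩
  · intro x hx
    exact Multiset.mem_range.mp (Multiset.mem_of_mem_nsmul hx)
  · have := Multiset.cons_erase ha
    rw [add_right_comm]
    congr 1
    rw [Multiset.add_comm, Multiset.singleton_add]
    exact this

lemma csum_det {V : Type} {c X : Finset (LF V)} (h : c ⊆ X) {x y : V}
    (hX : ∀ q ∈ X, q.2 x = q.2 y) : csum c x = csum c y :=
  Finset.sum_congr rfl (fun q hq => hX q (h hq))

lemma csum_erase {V : Type} [DecidableEq (LF V)] {c : Finset (LF V)} {q : LF V} (hq : q ∈ c) (x : V) :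
    csum c x = q.2 x + csum (c.erase q) x :=
  (Finset.add_sum_erase c (fun q => q.2 x) hq).symm

lemma card_le_T {E : ℕ} {lam : ℝ} {T : Multiset ℕ} {κ : ℕ} {V I : Type} [AddCommGroup V] [Fintype I]
    {C : Finset (LF V)} {Q : I → Finset (LF V)} (h : St E lam T κ C Q) : C.card ≤ Multiset.card T := by
  classical
  have h1 : C.card = ∑ D ∈ range (E + 1), (C.filter (fun q => q.1 = D)).card :=
    Finset.card_eq_sum_card_fiberwise (fun q hq => by
      have := (h.hC q hq).1
      simp; omega)
  rw [h1]
  calc _ ≤ ∑ D ∈ range (E + 1), T.count (2 * D) := Finset.sum_le_sum (fun D _ => h.hTC D)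
    _ = ∑ a ∈ (range (E + 1)).image (fun D => 2 * D), T.count a := by
        rw [Finset.sum_image]; intro a _ b _ h; simpa using h
    _ ≤ _ := by
        have hh : ∑ a ∈ (range (E + 1)).image (fun D => 2 * D), T.count a ≤
            ∑ a ∈ T.toFinset ∪ (range (E + 1)).image (fun D => 2 * D), T.count a :=
          Finset.sum_le_sum_of_subset Finset.subset_union_right
        refine hh.trans ?_
        rw [← Finset.sum_subset (Finset.subset_union_left), Multiset.toFinset_sum_count_eq]
        intro a _ ha
        simpa using ha

section steps
variable {E : ℕ} {lam : ℝ} {T : Multiset ℕ} {κ : ℕ} {V I : Type} [AddCommGroup V] [Fintype V] [Fintype I]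
  {C : Finset (LF V)} {Q : I → Finset (LF V)}

lemma step_alpha (hlam : 0 < lam) (h : St E lam T κ C Q) (δ : ℝ) (ρ M : ℕ) (hρ : ∀ e ≤ E, ExR e δ ρ)
    (hM : 2 * κ + ρ ≤ M)
    (i i' : I) (c1 c2 s : Finset (LF V)) (q0 : LF V) (h1 : c1 ⊆ Q i) (h2 : c2 ⊆ Q i') (hs : s ⊆ C)
    (hq0 : q0 ∈ s) (hl1 : ∀ q ∈ c1, q.1 < q0.1) (hl2 : ∀ q ∈ c2, q.1 < q0.1) (hls : ∀ q ∈ s, q.1 ≤ q0.1)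
    (hm : δ ≤ |mean (fun x => sg (csum c1 x + csum c2 x + csum s x))|) :
    ∃ a ∈ T, ∃ (C1 : Finset (LF V)) (Q1 : I → Finset (LF V)),
      St E lam (T.erase a + M • Multiset.range a) (κ + ρ) C1 Q1 ∧
      (∀ q ∈ C, Det C1 q.2) ∧ (∀ i, ∀ q ∈ Q i, Det2 (Q1 i) C1 q.2) := by
  classical
  have hq0C := hs hq0
  have hE0 := h.hC q0 hq0C
  have hDg : Dg q0.1 (fun x => csum c1 x + csum c2 x + csum s x) := by
    refine Dg_add (Dg_add ?_ ?_) ?_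
    · exact Dg_csum c1 (fun q hq => ⟨(hl1 q hq).le, (h.hQ i q (h1 hq)).2⟩)
    · exact Dg_csum c2 (fun q hq => ⟨(hl2 q hq).le, (h.hQ i' q (h2 hq)).2⟩)
    · exact Dg_csum s (fun q hq => ⟨hls q hq, (h.hC q (hs hq)).2⟩)
  obtain ⟨N, hN1, hN2, hN3⟩ := hρ q0.1 hE0.1 V _ hDg hm
  have hcard0 : 0 < (C.filter (fun q => q.1 = q0.1)).card :=
    Finset.card_pos.mpr ⟨q0, by simp [hq0C]⟩
  have haT : 2 * q0.1 ∈ T := by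
    rw [← Multiset.count_pos]
    exact lt_of_lt_of_le hcard0 (h.hTC _)
  have hY : ∀ q ∈ c1 ∪ c2 ∪ N, q.1 < q0.1 := by
    intro q hq
    simp only [mem_union] at hq
    rcases hq with (hq | hq) | hq
    · exact hl1 q hq
    · exact hl2 q hq
    · exact (hN2 q hq).1
  have hYc : (c1 ∪ c2 ∪ N).card ≤ 2 * κ + ρ := by
    have := Finset.card_union_le (c1 ∪ c2) N
    have := Finset.card_union_le c1 c2
    have := (Finset.card_le_card h1).trans (h.hκ i)
    have := (Finset.card_le_card h2).trans (h.hκ i')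
    omega
  refine ⟨2 * q0.1, haT, C.erase q0 ∪ (c1 ∪ c2 ∪ N), Q, ⟨?_, h.hQ, ?_, ?_, ?_⟩, ?_, ?_⟩
  · intro q hq
    simp only [mem_union] at hq
    rcases hq with hq | (hq | hq) | hq
    · exact h.hC q (Finset.mem_of_mem_erase hq)
    · exact h.hQ _ q (h1 hq)
    · exact h.hQ _ q (h2 hq)
    · exact ⟨(hN2 q hq).1.le.trans hE0.1, (hN2 q hq).2⟩
  · intro j; exact (h.hκ j).trans (by omega)
  · intro D
    rw [count_T', Finset.filter_union]
    refine (Finset.card_union_le _ _).trans ?_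
    have hA := h.hTC D
    rw [Finset.filter_erase]
    have hB : ((c1 ∪ c2 ∪ N).filter (fun q => q.1 = D)).card ≤ if 2 * D < 2 * q0.1 then M else 0 := by
      split_ifs with hD
      · exact (Finset.card_filter_le _ _).trans (hYc.trans hM)
      · rw [Finset.filter_false_of_mem]
        · simp
        · intro q hq hqD; have := hY q hq; omega
    refine Nat.add_le_add ?_ hB
    split_ifs with hD
    · have hD' : D = q0.1 := by omega
      subst hD'
      rw [Finset.card_erase_of_mem (by simp [hq0C])]
      omega
    · exact (Finset.card_erase_le).trans hA
  · intro D
    refine (h.hTQ D).trans ?_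
    have : T.count (2 * D + 1) ≤ (T.erase (2 * q0.1) + M • Multiset.range (2 * q0.1)).count (2 * D + 1) := by
      rw [count_T', if_neg (by omega)]; omega
    gcongr
  · intro q hq x y hxy
    by_cases hqq : q = q0
    · subst hqq
      have e1 := hN3 x y (fun r hr => hxy r (by simp [hr]))
      have e2 : csum c1 x = csum c1 y := csum_det (fun r hr => by simp [hr]) hxy
      have e3 : csum c2 x = csum c2 y := csum_det (fun r hr => by simp [hr]) hxy
      have e4 : csum (s.erase q) x = csum (s.erase q) y := csum_det (fun r hr => by
        have := Finset.mem_erase.mp hr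
        simp [this.1, hs this.2]) hxy
      simp only [csum_erase hq0] at e1
      rw [e2, e3, e4] at e1
      exact add_right_cancel (add_left_cancel e1)
    · exact hxy q (by simp [hq, hqq])
  · intro j q hq x y hx _
    exact hx q hq

def Red (C : Finset (LF V)) (Q : I → Finset (LF V)) (δ : ℝ) (q0 : LF V) (i i' : I) : Prop :=
  ∃ c1 c2 s : Finset (LF V), c1 ⊆ Q i ∧ c2 ⊆ Q i' ∧ s ⊆ C ∧ q0 ∈ c1 ∧
    (∀ q ∈ c1, q.1 ≤ q0.1) ∧ (∀ q ∈ c2, q.1 ≤ q0.1) ∧ (∀ q ∈ s, q.1 ≤ q0.1) ∧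
    δ ≤ |mean (fun x => sg (csum c1 x + csum c2 x + csum s x))|

lemma step_beta (hlam : 0 < lam) (h : St E lam T κ C Q) (δ : ℝ) (hδ : 0 < δ) (ρ M r : ℕ) (hρ : ∀ e ≤ E, ExR e δ ρ)
    (hM : r * κ ≤ M) (hM2 : (ρ : ℝ) ≤ lam * M) (hδ1 : δ ≤ 1) (hr : (1 - δ) ^ r ≤ 1 / 2)
    (H : Finset I)
    (hH : ∀ i ∈ H, δ * Fintype.card I ≤ (({i' | ∃ q0, Red C Q δ q0 i i'} : Set I).ncard : ℝ))
    (hHc : 2 * (E + 1) * lam * Fintype.card I < H.card) :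
    ∃ a ∈ T, ∃ (C1 : Finset (LF V)) (Q1 : I → Finset (LF V)),
      St E lam (T.erase a + M • Multiset.range a) (κ + ρ) C1 Q1 ∧
      (∀ q ∈ C, Det C1 q.2) ∧ (∀ i, ∀ q ∈ Q i, Det2 (Q1 i) C1 q.2) := by
  classical
  obtain ⟨S, U, hSr, hUH, hU, hScov⟩ := greedy (fun i i' => ∃ q0, Red C Q δ q0 i i') δ hδ1 H hH r
  set Cov := H \ U with hCov
  have hI0 : (0:ℝ) ≤ Fintype.card I := by positivity
  have hCovc : (E + 1) * lam * Fintype.card I < Cov.card := by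
    have h3 : Cov.card + U.card = H.card := Finset.card_sdiff_add_card_eq_card hUH
    have h4 : (Cov.card : ℝ) + U.card = H.card := by exact_mod_cast h3
    have h6 : (1 - δ) ^ r * (H.card : ℝ) ≤ 1 / 2 * H.card := by gcongr
    linarith
  have hch : ∀ i, ∃ i' q0, i ∈ Cov → i' ∈ S ∧ Red C Q δ q0 i i' := by
    intro i
    by_cases hi : i ∈ Cov
    · obtain ⟨i', hi', q0, hq0⟩ := hScov i (Finset.mem_sdiff.mp hi).1 (Finset.mem_sdiff.mp hi).2
      exact ⟨i', q0, fun _ => ⟨hi', hq0⟩⟩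
    · exact ⟨i, (0, fun _ => 0), fun h => absurd h hi⟩
  choose nb q0 hnb using hch
  have hq0Q : ∀ i ∈ Cov, q0 i ∈ Q i := by
    intro i hi
    obtain ⟨c1, c2, s, a1, -, -, a2, -⟩ := (hnb i hi).2
    exact a1 a2
  have hpig : ∃ D ≤ E, lam * Fintype.card I < ((Cov.filter fun i => (q0 i).1 = D).card : ℝ) := by
    by_contra hcon
    push Not at hcon
    have h1 : Cov.card = ∑ D ∈ range (E + 1), (Cov.filter fun i => (q0 i).1 = D).card :=
      Finset.card_eq_sum_card_fiberwise (fun i hi => by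
        have := (h.hQ i _ (hq0Q i hi)).1
        simp; omega)
    have h2 : (Cov.card : ℝ) ≤ ∑ D ∈ range (E + 1), (lam * Fintype.card I) := by
      rw [h1]; push_cast
      apply Finset.sum_le_sum
      intro D hD
      exact hcon D (by simp at hD; omega)
    rw [Finset.sum_const, Finset.card_range, nsmul_eq_mul] at h2
    push_cast at h2
    linarith
  obtain ⟨D, hDE, hD⟩ := hpig
  set HD := Cov.filter fun i => (q0 i).1 = D with hHD
  have hHDmem : ∀ i ∈ HD, i ∈ Cov ∧ (q0 i).1 = D := fun i hi => Finset.mem_filter.mp hi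
  have hNex : ∀ i, ∃ N : Finset (LF V), N.card ≤ ρ ∧ (∀ q ∈ N, q.1 < D ∧ Dg q.1 q.2) ∧
      (i ∈ HD → ∀ x y, (∀ q ∈ N, q.2 x = q.2 y) → (∀ q ∈ (Q i).erase (q0 i), q.2 x = q.2 y) →
        (∀ q ∈ C, q.2 x = q.2 y) → (∀ q ∈ (Q (nb i)).filter (fun q => q.1 ≤ D), q.2 x = q.2 y) →
        (q0 i).2 x = (q0 i).2 y) := by
    intro i
    by_cases hi : i ∈ HD
    swap
    · exact ⟨∅, by simp, by simp, fun h => absurd h hi⟩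
    obtain ⟨hi1, hi2⟩ := hHDmem i hi
    obtain ⟨c1, c2, s, a1, a2, a3, a4, a5, a6, a7, a8⟩ := (hnb i hi1).2
    rw [hi2] at a5 a6 a7
    have hDg : Dg D (fun x => csum c1 x + csum c2 x + csum s x) := by
      refine Dg_add (Dg_add ?_ ?_) ?_
      · exact Dg_csum c1 (fun q hq => ⟨a5 q hq, (h.hQ i q (a1 hq)).2⟩)
      · exact Dg_csum c2 (fun q hq => ⟨a6 q hq, (h.hQ _ q (a2 hq)).2⟩)
      · exact Dg_csum s (fun q hq => ⟨a7 q hq, (h.hC q (a3 hq)).2⟩)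
    obtain ⟨N, hN1, hN2, hN3⟩ := hρ D hDE V _ hDg a8
    refine ⟨N, hN1, hN2, ?_⟩
    intro _ x y hx1 hx2 hx3 hx4
    have e1 := hN3 x y hx1
    have e2 : csum (c1.erase (q0 i)) x = csum (c1.erase (q0 i)) y :=
      csum_det (Finset.erase_subset_erase _ a1) hx2
    have e3 : csum c2 x = csum c2 y :=
      csum_det (fun q hq => Finset.mem_filter.mpr ⟨a2 hq, a6 q hq⟩) hx4
    have e4 : csum s x = csum s y := csum_det a3 hx3
    simp only [csum_erase a4] at e1
    rw [e2, e3, e4] at e1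
    exact add_right_cancel (add_right_cancel (add_right_cancel e1))
  choose N hN1 hN2 hN3 using hNex
  have hdec : ∀ D', ∀ i, (((if i ∈ HD then (Q i).erase (q0 i) ∪ N i else Q i).filter (fun q => q.1 = D')).card : ℝ) ≤
      (((Q i).filter (fun q => q.1 = D')).card : ℝ) + (if D' < D then (ρ : ℝ) else 0)
        - (if D' = D ∧ i ∈ HD then 1 else 0) := by
    intro D' i
    by_cases hi : i ∈ HD
    swap
    · simp only [hi, if_false, and_false]
      split_ifs <;> simp
    obtain ⟨hi1, hi2⟩ := hHDmem i hi
    simp only [hi, if_true, and_true]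
    have hNc : ((N i).filter (fun q => q.1 = D')).card ≤ if D' < D then ρ else 0 := by
      split_ifs with hlt
      · exact (Finset.card_filter_le _ _).trans (hN1 i)
      · rw [Finset.filter_false_of_mem]
        · simp
        · intro q hq hqD; have := (hN2 i q hq).1; omega
    have hu : (((Q i).erase (q0 i) ∪ N i).filter (fun q => q.1 = D')).card ≤
        (((Q i).erase (q0 i)).filter (fun q => q.1 = D')).card + if D' < D then ρ else 0 := by
      rw [Finset.filter_union]
      exact (Finset.card_union_le _ _).trans (Nat.add_le_add_left hNc _)
    rw [Finset.filter_erase] at hu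
    have hmem := hq0Q i hi1
    by_cases hDD : D' = D
    · subst hDD
      rw [Finset.card_erase_of_mem (by simp [hmem, hi2])] at hu
      have hpos : 0 < ((Q i).filter (fun q => q.1 = D')).card :=
        Finset.card_pos.mpr ⟨q0 i, by simp [hmem, hi2]⟩
      simp only [lt_irrefl, if_false, add_zero, if_true] at hu ⊢
      have : (((Q i).erase (q0 i) ∪ N i).filter (fun q => q.1 = D')).card + 1 ≤
          ((Q i).filter (fun q => q.1 = D')).card := by omega
      have : ((((Q i).erase (q0 i) ∪ N i).filter (fun q => q.1 = D')).card : ℝ) + 1 ≤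
          (((Q i).filter (fun q => q.1 = D')).card : ℝ) := by exact_mod_cast this
      linarith
    · simp only [hDD, if_false, sub_zero]
      have h2 := hu.trans (Nat.add_le_add_right (Finset.card_erase_le) _)
      have h3 : ((((Q i).erase (q0 i) ∪ N i).filter (fun q => q.1 = D')).card : ℝ) ≤
        (((Q i).filter (fun q => q.1 = D')).card : ℝ) + ((if D' < D then ρ else 0 : ℕ) : ℝ) := by exact_mod_cast h2
      refine h3.trans ?_
      split_ifs <;> simp
  have hsum : ∀ D', ((∑ i, ((if i ∈ HD then (Q i).erase (q0 i) ∪ N i else Q i).filter (fun q => q.1 = D')).card : ℕ) : ℝ) ≤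
      ((∑ i, ((Q i).filter (fun q => q.1 = D')).card : ℕ) : ℝ) + (if D' < D then (ρ : ℝ) else 0) * Fintype.card I
        - (if D' = D then (HD.card : ℝ) else 0) := by
    intro D'
    push_cast
    refine (Finset.sum_le_sum (fun i _ => hdec D' i)).trans ?_
    rw [Finset.sum_sub_distrib, Finset.sum_add_distrib, Finset.sum_const, nsmul_eq_mul, Finset.card_univ]
    have : ∑ i : I, (if D' = D ∧ i ∈ HD then (1:ℝ) else 0) = if D' = D then (HD.card : ℝ) else 0 := by
      split_ifs with hh
      · simp [hh]
      · simp [hh]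
    rw [this]
    linarith
  have hcpos : 1 ≤ T.count (2 * D + 1) := by
    by_contra hcon
    have h0 : T.count (2 * D + 1) = 0 := by omega
    have h1 := h.hTQ D
    have h2 := hsum D
    rw [h0] at h1
    simp only [lt_irrefl, if_false, if_true, zero_mul, add_zero, Nat.cast_zero, mul_zero] at h1 h2
    have h3 : (0:ℝ) ≤ ((∑ i, ((if i ∈ HD then (Q i).erase (q0 i) ∪ N i else Q i).filter (fun q => q.1 = D)).card : ℕ) : ℝ) :=
      Nat.cast_nonneg _
    have h4 : 0 ≤ lam * Fintype.card I := by positivity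
    linarith
  have haT : 2 * D + 1 ∈ T := by
    rw [← Multiset.count_pos]; omega
  refine ⟨2 * D + 1, haT, C ∪ S.biUnion (fun i' => (Q i').filter (fun q => q.1 ≤ D)),
    fun i => if i ∈ HD then (Q i).erase (q0 i) ∪ N i else Q i, ⟨?_, ?_, ?_, ?_, ?_⟩, ?_, ?_⟩
  · intro q hq
    rw [Finset.mem_union, Finset.mem_biUnion] at hq
    rcases hq with hq | ⟨i', -, hq⟩
    · exact h.hC q hq
    · exact h.hQ i' q (Finset.mem_filter.mp hq).1
  · intro i q hq
    split_ifs at hq with hi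
    · rw [Finset.mem_union] at hq
      rcases hq with hq | hq
      · exact h.hQ i q (Finset.mem_of_mem_erase hq)
      · exact ⟨(hN2 i q hq).1.le.trans hDE, (hN2 i q hq).2⟩
    · exact h.hQ i q hq
  · intro i
    split_ifs with hi
    · refine (Finset.card_union_le _ _).trans (Nat.add_le_add ?_ (hN1 i))
      exact (Finset.card_erase_le).trans (h.hκ i)
    · exact (h.hκ i).trans (by omega)
  · intro D'
    rw [count_T', if_neg (by omega), Finset.filter_union]
    refine (Finset.card_union_le _ _).trans (Nat.add_le_add (h.hTC D') ?_)
    split_ifs with hlt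
    · refine (Finset.card_filter_le _ _).trans (Finset.card_biUnion_le.trans ?_)
      calc _ ≤ ∑ i' ∈ S, κ := Finset.sum_le_sum (fun i' _ => (Finset.card_filter_le _ _).trans (h.hκ i'))
        _ = S.card * κ := by rw [Finset.sum_const, smul_eq_mul]
        _ ≤ r * κ := Nat.mul_le_mul_right _ hSr
        _ ≤ M := hM
    · rw [Finset.filter_false_of_mem]
      · simp
      · intro q hq hqD
        obtain ⟨i', -, hq⟩ := Finset.mem_biUnion.mp hq
        have := (Finset.mem_filter.mp hq).2
        omega
  · intro D'
    refine (hsum D').trans ?_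
    have h1 := h.hTQ D'
    rw [count_T']
    generalize ((∑ i, ((Q i).filter (fun q => q.1 = D')).card : ℕ) : ℝ) = Z at h1 ⊢
    rcases lt_trichotomy D' D with hlt | heq | hgt
    · rw [if_pos hlt, if_neg (by omega), if_neg (by omega), if_pos (by omega)]
      push_cast
      have : (ρ : ℝ) * Fintype.card I ≤ lam * M * Fintype.card I := by gcongr
      nlinarith
    · subst heq
      rw [if_neg (by omega), if_pos rfl, if_pos rfl, if_neg (by omega)]
      push_cast [Nat.cast_sub hcpos]
      nlinarith
    · rw [if_neg (by omega), if_neg (by omega), if_neg (by omega), if_neg (by omega)]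
      push_cast
      nlinarith
  · intro q hq x y hxy
    exact hxy q (by simp [hq])
  · intro i q hq x y hx hy
    simp only at hx
    have hyC : ∀ q ∈ C, q.2 x = q.2 y := fun q hq => hy q (Finset.mem_union_left _ hq)
    split_ifs at hx with hi
    · by_cases hqq : q = q0 i
      · subst hqq
        refine hN3 i hi x y (fun q hq => hx q (Finset.mem_union_right _ hq))
          (fun q hq => hx q (Finset.mem_union_left _ hq)) hyC ?_
        intro q hq
        apply hy q
        refine Finset.mem_union_right _ (Finset.mem_biUnion.mpr ⟨nb i, (hnb i (hHDmem i hi).1).1, hq⟩)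
      · exact hx q (Finset.mem_union_left _ (Finset.mem_erase.mpr ⟨hqq, hq⟩))
    · exact hx q hq
end steps


lemma notgood_cases {V I : Type} [Fintype V]
    {C : Finset (LF V)} {Q : I → Finset (LF V)} {δ : ℝ} {i i' : I} (h : ¬ GoodP C (Q i) (Q i') δ) :
    (∃ (c1 c2 s : Finset (LF V)) (q0 : LF V), c1 ⊆ Q i ∧ c2 ⊆ Q i' ∧ s ⊆ C ∧ q0 ∈ s ∧
      (∀ q ∈ c1, q.1 < q0.1) ∧ (∀ q ∈ c2, q.1 < q0.1) ∧ (∀ q ∈ s, q.1 ≤ q0.1) ∧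
      δ ≤ |mean (fun x => sg (csum c1 x + csum c2 x + csum s x))|) ∨
    (∃ q0, Red C Q δ q0 i i') ∨ (∃ q0, Red C Q δ q0 i' i) := by
  classical
  unfold GoodP at h
  push Not at h
  obtain ⟨c1, h1, c2, h2, s, hs, n1, n2, hm⟩ := h
  obtain ⟨qm, hqm, hmax⟩ := Finset.exists_max_image (c1 ∪ c2) (fun q => q.1) (n1.mono Finset.subset_union_left)
  by_cases hall : ∀ q ∈ s, q.1 ≤ qm.1
  · right
    rcases Finset.mem_union.mp hqm with hq | hq
    · left
      exact ⟨qm, c1, c2, s, h1, h2, hs, hq, fun q hq => hmax q (Finset.mem_union_left _ hq),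
        fun q hq => hmax q (Finset.mem_union_right _ hq), hall, hm⟩
    · right
      refine ⟨qm, c2, c1, s, h2, h1, hs, hq, fun q hq => hmax q (Finset.mem_union_right _ hq),
        fun q hq => hmax q (Finset.mem_union_left _ hq), hall, ?_⟩
      have e : (fun x => sg (csum c2 x + csum c1 x + csum s x)) =
          fun x => sg (csum c1 x + csum c2 x + csum s x) := by
        funext x; rw [add_comm (csum c2 x)]
      rw [e]; exact hm
  · left
    push Not at hall
    obtain ⟨q1, hq1, hlt⟩ := hall
    obtain ⟨q0, hq0, hmax0⟩ := Finset.exists_max_image s (fun q => q.1) ⟨q1, hq1⟩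
    have := hmax0 q1 hq1
    refine ⟨c1, c2, s, q0, h1, h2, hs, hq0, ?_, ?_, hmax0, hm⟩
    · intro q hq; have := hmax q (Finset.mem_union_left _ hq); omega
    · intro q hq; have := hmax q (Finset.mem_union_right _ hq); omega

theorem str (E : ℕ) (hE : ∀ e ≤ E, ExS e) (lam : ℝ) (hlam : 0 < lam) (acc : ℕ → ℝ)
    (hacc : ∀ c, 0 < acc c ∧ acc c ≤ 1) (T : Multiset ℕ) :
    ∀ κ : ℕ, ∃ B : ℕ, ∀ (V I : Type) [AddCommGroup V] [Fintype V] [Fintype I]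
      (C : Finset (LF V)) (Q : I → Finset (LF V)), St E lam T κ C Q → Out E lam acc B C Q := by
  classical
  have hwf : WellFounded (Relation.CutExpand (α := ℕ) (· < ·)) :=
    WellFounded.cutExpand wellFounded_lt
  induction T using hwf.induction with
  | _ T ih =>
  intro κ
  set c := Multiset.card T + κ with hc
  obtain ⟨hδ, hδ1⟩ := hacc c
  set δ := acc c with hδdef
  have hR : ∀ e, ∃ R, e ≤ E → ExR e δ R := by
    intro e
    by_cases he : e ≤ E
    · obtain ⟨R, hR⟩ := hE e he δ hδ
      exact ⟨R, fun _ => hR⟩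
    · exact ⟨0, fun h => absurd h he⟩
  choose R hR using hR
  set ρ := ∑ e ∈ range (E + 1), R e with hρdef
  have hρ : ∀ e ≤ E, ExR e δ ρ := by
    intro e he V _ _ P hP hm
    obtain ⟨N, h1, h2⟩ := hR e he V P hP hm
    refine ⟨N, h1.trans ?_, h2⟩
    exact Finset.single_le_sum (f := R) (fun _ _ => Nat.zero_le _) (by simp; omega)
  obtain ⟨r, hr⟩ : ∃ r : ℕ, (1 - δ) ^ r ≤ 1 / 2 := by
    obtain ⟨r, hr⟩ := exists_pow_lt_of_lt_one (show (0:ℝ) < 1 / 2 by norm_num) (show 1 - δ < 1 by linarith)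
    exact ⟨r, hr.le⟩
  set M := 2 * κ + ρ + r * κ + ⌈(ρ : ℝ) / lam⌉₊ with hMdef
  have hM2 : (ρ : ℝ) ≤ lam * M := by
    have h1 : (ρ : ℝ) / lam ≤ M := (Nat.le_ceil _).trans (by exact_mod_cast Nat.le_add_left _ _)
    rw [div_le_iff₀ hlam] at h1
    linarith
  have hB : ∀ a, ∃ B : ℕ, a ∈ T → ∀ (V I : Type) [AddCommGroup V] [Fintype V] [Fintype I]
      (C : Finset (LF V)) (Q : I → Finset (LF V)),
      St E lam (T.erase a + M • Multiset.range a) (κ + ρ) C Q → Out E lam acc B C Q := by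
    intro a
    by_cases ha : a ∈ T
    · obtain ⟨B, hB⟩ := ih _ (cut_T' T a M ha) (κ + ρ)
      exact ⟨B, fun _ => hB⟩
    · exact ⟨0, fun h => absurd h ha⟩
  choose b hb using hB
  refine ⟨c + ∑ a ∈ T.toFinset, b a, ?_⟩
  intro V I _ _ _ C Q hSt
  have hfin : (∃ a ∈ T, ∃ (C1 : Finset (LF V)) (Q1 : I → Finset (LF V)),
      St E lam (T.erase a + M • Multiset.range a) (κ + ρ) C1 Q1 ∧
      (∀ q ∈ C, Det C1 q.2) ∧ (∀ i, ∀ q ∈ Q i, Det2 (Q1 i) C1 q.2)) →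
      Out E lam acc (c + ∑ a ∈ T.toFinset, b a) C Q := by
    rintro ⟨a, ha, C1, Q1, h1, h2, h3⟩
    refine Out_trans ?_ h2 h3 (hb a ha V I C1 Q1 h1)
    have : b a ≤ ∑ a ∈ T.toFinset, b a :=
      Finset.single_le_sum (f := b) (fun _ _ => Nat.zero_le _) (by simpa using ha)
    omega
  by_cases hα : ∃ (i i' : I) (c1 c2 s : Finset (LF V)) (q0 : LF V), c1 ⊆ Q i ∧ c2 ⊆ Q i' ∧ s ⊆ C ∧ q0 ∈ s ∧
      (∀ q ∈ c1, q.1 < q0.1) ∧ (∀ q ∈ c2, q.1 < q0.1) ∧ (∀ q ∈ s, q.1 ≤ q0.1) ∧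
      δ ≤ |mean (fun x => sg (csum c1 x + csum c2 x + csum s x))|
  · obtain ⟨i, i', c1, c2, s, q0, a1, a2, a3, a4, a5, a6, a7, a8⟩ := hα
    apply hfin
    exact step_alpha hlam hSt δ ρ M hρ (by omega) i i' c1 c2 s q0 a1 a2 a3 a4 a5 a6 a7 a8
  set rd : I → I → Prop := fun i i' => ∃ q0, Red C Q δ q0 i i' with hrd
  have hred : ∀ i i', ¬ GoodP C (Q i) (Q i') δ → rd i i' ∨ rd i' i := by
    intro i i' hng
    rcases notgood_cases hng with h | h
    · exact absurd ⟨i, i', h⟩ hα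
    · exact h
  set H : Finset I := univ.filter fun i => δ * Fintype.card I < (({i' | rd i i'} : Set I).ncard : ℝ) with hH
  by_cases hHc : 2 * (E + 1) * lam * Fintype.card I < (H.card : ℝ)
  · apply hfin
    exact step_beta hlam hSt δ hδ ρ M r hρ (by omega) hM2 hδ1 hr H
      (fun i hi => (Finset.mem_filter.mp hi).2.le) hHc
  · push Not at hHc
    refine ⟨C, Q, c, by omega, ?_, ?_, hSt.hC, ?_, ?_, Hᶜ, ?_, ?_⟩
    · have := card_le_T hSt; omega
    · intro i; have := hSt.hκ i; omega
    · intro q hq x y hxy; exact hxy q hq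
    · intro i q hq x y hx _; exact hx q hq
    · have h1 := Finset.card_add_card_compl H
      have h2 : (H.card : ℝ) + (Hᶜ.card : ℝ) = Fintype.card I := by exact_mod_cast h1
      linarith
    · have hI0 : (0:ℝ) ≤ Fintype.card I := by positivity
      set F : Finset (I × I) := (Hᶜ : Finset I) ×ˢ univ
      set F1 := F.filter fun p => rd p.1 p.2
      have hF1 : (F1.card : ℝ) ≤ δ * (Fintype.card I : ℝ) ^ 2 := by
        have e : F1.card = ∑ i ∈ Hᶜ, (univ.filter fun i' => rd i i').card := by
          simp only [F1, F, Finset.card_filter, Finset.sum_product]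
        rw [e]
        push_cast
        calc _ ≤ ∑ i ∈ Hᶜ, (δ * Fintype.card I) := by
              apply Finset.sum_le_sum
              intro i hi
              rw [Finset.mem_compl, hH, Finset.mem_filter] at hi
              push Not at hi
              have := hi (Finset.mem_univ _)
              have e : ({i' | rd i i'} : Set I) = ((univ.filter fun i' => rd i i' : Finset I) : Set I) := by
                ext j; simp
              rw [e, Set.ncard_coe_finset] at this
              exact this
          _ = (Hᶜ.card : ℝ) * (δ * Fintype.card I) := by rw [Finset.sum_const, nsmul_eq_mul]
          _ ≤ (Fintype.card I : ℝ) * (δ * Fintype.card I) := by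
              gcongr; exact Finset.card_le_univ _
          _ = _ := by ring
      have hsub : ({p : I × I | p.1 ∈ Hᶜ ∧ p.2 ∈ Hᶜ ∧ ¬ GoodP C (Q p.1) (Q p.2) δ} : Set (I × I)) ⊆
          ((F1 ∪ F1.image Prod.swap : Finset (I × I)) : Set (I × I)) := by
        rintro ⟨i, i'⟩ ⟨h1, h2, h3⟩
        rw [Finset.mem_coe, Finset.mem_union]
        rcases hred i i' h3 with h | h
        · left
          exact Finset.mem_filter.mpr ⟨Finset.mem_product.mpr ⟨h1, Finset.mem_univ _⟩, h⟩
        · right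
          exact Finset.mem_image.mpr ⟨(i', i),
            Finset.mem_filter.mpr ⟨Finset.mem_product.mpr ⟨h2, Finset.mem_univ _⟩, h⟩, rfl⟩
      have h1 := Set.ncard_le_ncard hsub (Finset.finite_toSet _)
      rw [Set.ncard_coe_finset] at h1
      have h2 := h1.trans (Finset.card_union_le _ _)
      have h3 : (F1.image Prod.swap).card ≤ F1.card := Finset.card_image_le
      have h4 := h2.trans (Nat.add_le_add_left h3 _)
      have h5 : (({p : I × I | p.1 ∈ Hᶜ ∧ p.2 ∈ Hᶜ ∧ ¬ GoodP C (Q p.1) (Q p.2) δ} : Set (I × I)).ncard : ℝ)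
          ≤ F1.card + F1.card := by exact_mod_cast h4
      refine h5.trans ?_
      linarith


lemma ExS_zero : ExS 0 := by
  intro δ _
  refine ⟨0, ?_⟩
  intro V _ _ P hP _
  exact ⟨∅, by simp, by simp, fun x y _ => hP x y⟩

/-- the state with one polynomial for each index -/
lemma St_init (E : ℕ) (lam : ℝ) (hlam : 0 < lam) (K : ℕ) (hK : 1 ≤ lam * K) {V I : Type} [AddCommGroup V]
    [Fintype I] (P : I → V → ZMod 2) (hP : ∀ i, Dg E (P i)) :
    St E lam (Multiset.replicate K (2 * E + 1)) 1 (∅ : Finset (LF V)) (fun i => {(E, P i)}) := by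
  refine ⟨by simp, ?_, by simp, by simp, ?_⟩
  · intro i q hq
    rw [Finset.mem_singleton] at hq
    subst hq
    exact ⟨le_refl _, hP i⟩
  · intro D
    by_cases hD : D = E
    · subst hD
      simp only [Finset.filter_singleton, if_true, card_singleton, sum_const, card_univ, smul_eq_mul, mul_one,
        Multiset.count_replicate_self]
      have : (0:ℝ) ≤ Fintype.card I := by positivity
      nlinarith
    · have : ∀ i, (({(E, P i)} : Finset (LF V)).filter (fun q => q.1 = D)).card = 0 := by
        intro i
        rw [Finset.filter_singleton, if_neg (by simpa using fun h => hD h.symm)]; simp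
      simp only [this, Finset.sum_const_zero, Nat.cast_zero]
      positivity

lemma Det2_union {V β : Type} [DecidableEq (LF V)] {X Y : Finset (LF V)} {f : V → β} (h : Det2 X Y f) :
    Det (X ∪ Y) f :=
  fun x y hxy => h x y (fun q hq => hxy q (Finset.mem_union_left _ hq))
    (fun q hq => hxy q (Finset.mem_union_right _ hq))

lemma cheb {V : Type} [Fintype V] [Nonempty V] (g : V → ℝ) (t : ℝ) (S : Finset V)
    (ht : 0 ≤ t) (h : ∀ x ∈ S, t ≤ |g x|) :
    (S.card : ℝ) * t ^ 2 ≤ Fintype.card V * mean (fun x => g x ^ 2) := by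
  have hV : (0:ℝ) < Fintype.card V := by exact_mod_cast Fintype.card_pos
  unfold mean
  rw [mul_div_cancel₀ _ hV.ne']
  calc (S.card : ℝ) * t ^ 2 = ∑ x ∈ S, t ^ 2 := by rw [Finset.sum_const, nsmul_eq_mul]
    _ ≤ ∑ x ∈ S, g x ^ 2 := Finset.sum_le_sum (fun x hx => by
        rw [← sq_abs (g x)]
        exact pow_le_pow_left₀ ht (h x hx) 2)
    _ ≤ ∑ x, g x ^ 2 := Finset.sum_le_sum_of_subset_of_nonneg (Finset.subset_univ _)
        (fun _ _ _ => sq_nonneg _)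

lemma ExS_succ (e : ℕ) (ih : ∀ e' ≤ e, ExS e') : ExS (e + 1) := by
  classical
  intro δ hδ
  set lam : ℝ := δ / (8 * (e + 1)) with hlamdef
  have hlam : 0 < lam := by positivity
  have hlam2 : 2 * ((e : ℝ) + 1) * lam = δ / 4 := by rw [hlamdef]; field_simp; norm_num
  set W : ℕ → ℝ := fun c => 2 ^ (e + 1 + 1) * 2 ^ (2 ^ (e + 1 + 1) * c * (e + 1)) with hW
  have hWpos : ∀ c, 0 < W c := fun c => by simp only [hW]; positivity
  set acc : ℕ → ℝ := fun c => min 1 (δ ^ 2 / (8 * (8 ^ c + 8) * W c)) with haccdef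
  have hacc : ∀ c, 0 < acc c ∧ acc c ≤ 1 := by
    intro c
    have := hWpos c
    exact ⟨lt_min one_pos (by positivity), min_le_left _ _⟩
  set K := ⌈1 / lam⌉₊ with hKdef
  have hK : 1 ≤ lam * K := by
    have h1 : 1 / lam ≤ K := Nat.le_ceil _
    rw [div_le_iff₀ hlam] at h1
    linarith
  obtain ⟨B, hB⟩ := str e ih lam hlam acc hacc (Multiset.replicate K (2 * e + 1)) 1
  refine ⟨B, ?_⟩
  intro V _ _ P hP hbias
  have hSt := St_init e lam hlam K hK (I := V) (fun a x => P (x + a) + P x) hP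
  obtain ⟨C', Q', c, hcB, hC'c, hQ'c, hC', -, hQdet, A, hA, hbad⟩ := hB V V _ _ hSt
  obtain ⟨m, m1, m2, -, m4⟩ := second_moment C' Q' c hC'c hQ'c A (acc c) (hacc c).1 hbad
    (fun a x => sg (P (x + a) + P x)) (fun a x => (abs_sg _).le) (by
      intro a
      have h1 := hQdet a (e, fun x => P (x + a) + P x) (by simp)
      apply Det2_union
      intro x y hx hy
      exact congrArg sg (h1 x y hx hy))
  have m5 := m4 (fun _ _ => 1) (fun _ _ _ _ => rfl) (fun _ _ => by simp)
  simp only [one_mul] at m5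
  set β := mean (fun x => sg (P x)) with hβ
  have hV : (0:ℝ) < Fintype.card V := by exact_mod_cast Fintype.card_pos
  set f : V → ZMod 2 := fun x => if 0 ≤ (∑ a ∈ A, m a x) * β then 0 else 1 with hf
  have hfd : Det C' f := by
    intro x y hxy
    simp only [hf]
    rw [Finset.sum_congr rfl (fun a _ => m1 a x y hxy)]
  have hsumall : ∀ x, ∑ a, sg (P (x + a) + P x) = Fintype.card V * β * sg (P x) := by
    intro x
    simp only [sg_add]
    have e1 : ∑ a, sg (P (x + a)) = ∑ y, sg (P y) := Equiv.sum_comp (Equiv.addLeft x) (fun y => sg (P y))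
    rw [← Finset.sum_mul, e1, hβ]
    unfold mean
    rw [mul_div_cancel₀ _ hV.ne']
  have hdiff : ∀ x, |Fintype.card V * β * sg (P x) - ∑ a ∈ A, sg (P (x + a) + P x)| ≤ δ / 4 * Fintype.card V := by
    intro x
    rw [← hsumall x, ← Finset.sum_add_sum_compl A, add_sub_cancel_left]
    refine (Finset.abs_sum_le_sum_abs _ _).trans ?_
    simp only [abs_sg, Finset.sum_const, nsmul_eq_mul, mul_one]
    have h1 := Finset.card_add_card_compl A
    have h2 : (A.card : ℝ) + (Aᶜ.card : ℝ) = Fintype.card V := by exact_mod_cast h1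
    rw [hlam2] at hA
    linarith
  have hfar : ∀ x ∈ univ.filter (fun x => P x ≠ f x),
      δ / 2 * Fintype.card V ≤ |∑ a ∈ A, (sg (P (x + a) + P x) - m a x)| := by
    intro x hx
    have hx := (Finset.mem_filter.mp hx).2
    rw [Finset.sum_sub_distrib]
    have hd := abs_le.mp (hdiff x)
    set G := ∑ a ∈ A, sg (P (x + a) + P x)
    set Mx := ∑ a ∈ A, m a x with hMx
    -- sign information
    have hsign : Mx * (β * sg (P x)) ≤ 0 := by
      by_cases hpos : 0 ≤ Mx * β
      · have : f x = 0 := by simp only [hf]; rw [if_pos hpos]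
        rw [this] at hx
        have h1 : P x = 1 := (zmod2_cases (P x)).resolve_left hx
        rw [h1, sg_one]; linarith
      · have : f x = 1 := by simp only [hf]; rw [if_neg hpos]
        rw [this] at hx
        have h1 : P x = 0 := (zmod2_cases (P x)).resolve_right hx
        rw [h1, sg_zero]; push Not at hpos; linarith
    have hb : δ ≤ |β * sg (P x)| := by rw [abs_mul, abs_sg, mul_one]; exact hbias
    set b := β * sg (P x)
    have hd1 : Fintype.card V * b - G ≤ δ / 4 * Fintype.card V := by
      have := hd.2; simp only [b]; linarith
    have hd2 : -(δ / 4 * Fintype.card V) ≤ Fintype.card V * b - G := by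
      have := hd.1; simp only [b]; linarith
    have hdV : 0 < δ * Fintype.card V := by positivity
    rcases le_abs.mp hb with hb | hb
    · have hM : Mx ≤ 0 := by
        by_contra hcon; push Not at hcon; nlinarith [mul_pos hcon (lt_of_lt_of_le hδ hb)]
      have : δ * Fintype.card V ≤ Fintype.card V * b := by nlinarith
      refine le_trans ?_ (le_abs_self _)
      linarith
    · have hM : 0 ≤ Mx := by
        by_contra hcon; push Not at hcon; nlinarith
      have : δ * Fintype.card V ≤ -(Fintype.card V * b) := by nlinarith
      refine le_trans ?_ (neg_le_abs _)
      linarith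
  have hch := cheb (fun x => ∑ a ∈ A, (sg (P (x + a) + P x) - m a x)) (δ / 2 * Fintype.card V) _ (by positivity) hfar
  refine ⟨C', hC'c.trans hcB, fun q hq => ⟨Nat.lt_succ_of_le (hC' q hq).1, (hC' q hq).2⟩, ?_⟩
  refine exact_of_close (e + 1) c C' hP (fun q hq => ⟨(hC' q hq).1.trans (Nat.le_succ _), (hC' q hq).2⟩) hC'c hfd ?_
  set Z := ((univ.filter fun x => P x ≠ f x).card : ℝ) with hZ
  change Z * W c < _
  have hWc := hWpos c
  have ha2 : acc c ≤ δ ^ 2 / (8 * (8 ^ c + 8) * W c) := min_le_right _ _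
  rw [le_div_iff₀ (by positivity)] at ha2
  have h1 : Z * (δ / 2 * Fintype.card V) ^ 2 ≤
      Fintype.card V * ((8 ^ c + 8) * acc c * (Fintype.card V : ℝ) ^ 2) :=
    hch.trans (mul_le_mul_of_nonneg_left m5 hV.le)
  set n : ℝ := (Fintype.card V : ℝ)
  have h2 : Z * δ ^ 2 * (n ^ 2) ≤ (4 * n * ((8 ^ c + 8) * acc c)) * n ^ 2 := by nlinarith
  have h3 : Z * δ ^ 2 ≤ 4 * n * ((8 ^ c + 8) * acc c) := le_of_mul_le_mul_right h2 (by positivity)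
  have h4 : (Z * W c) * δ ^ 2 ≤ (n / 2) * δ ^ 2 := by
    calc (Z * W c) * δ ^ 2 = W c * (Z * δ ^ 2) := by ring
      _ ≤ W c * (4 * n * ((8 ^ c + 8) * acc c)) := by gcongr
      _ = (n / 2) * (acc c * (8 * (8 ^ c + 8) * W c)) := by ring
      _ ≤ _ := by gcongr
  have h5 := le_of_mul_le_mul_right h4 (by positivity)
  linarith

theorem ExS_all (e : ℕ) : ExS e := by
  induction e using Nat.strong_induction_on with
  | _ e ih =>
    cases e with
    | zero => exact ExS_zero
    | succ e => exact ExS_succ e (fun e' he' => ih e' (by omega))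

section fin
lemma Dg_sum {V : Type} [AddCommGroup V] {ι : Type} (s : Finset ι) (e : ℕ) (f : ι → V → ZMod 2)
    (h : ∀ i ∈ s, Dg e (f i)) : Dg e (fun x => ∑ i ∈ s, f i x) := by
  classical
  induction s using Finset.induction_on with
  | empty => simpa using Dg_const (V := V) e 0
  | insert i s hi ih =>
    have h1 := ih (fun j hj => h j (Finset.mem_insert_of_mem hj))
    have h2 := Dg_add (h i (Finset.mem_insert_self _ _)) h1
    convert h2 using 2
    rw [Finset.sum_insert hi]

lemma Dg_coord {m : ℕ} (i : Fin m) (k : ℕ) : Dg k (fun x : Fin m → ZMod 2 => x i ^ k) := by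
  induction k with
  | zero => simpa using Dg_const (V := Fin m → ZMod 2) 0 1
  | succ k ih =>
    have h1 : Dg 1 (fun x : Fin m → ZMod 2 => x i) := by
      intro a x y
      simp only [Pi.add_apply]
      rw [add_right_comm, z2_add_self, add_right_comm, z2_add_self]
    have := Dg_mul (k + 1) (le_refl _) ih h1
    simpa [pow_succ] using this

lemma Dg_mono' {m : ℕ} (s : Finset (Fin m)) (k : Fin m → ℕ) :
    Dg (∑ i ∈ s, k i) (fun x : Fin m → ZMod 2 => ∏ i ∈ s, x i ^ k i) := by
  classical
  induction s using Finset.induction_on with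
  | empty => simpa using Dg_const (V := Fin m → ZMod 2) 0 1
  | insert i s hi ih =>
    have := Dg_mul (∑ j ∈ insert i s, k j) (by rw [Finset.sum_insert hi]) (Dg_coord i (k i)) ih
    convert this using 2
    rw [Finset.prod_insert hi]

lemma Dg_of_DegLE {m d : ℕ} {P : (Fin m → ZMod 2) → ZMod 2} (h : DegLE d P) : Dg d P := by
  obtain ⟨p, hp, hP⟩ := h
  have e : P = fun x => ∑ σ ∈ p.support, p.coeff σ * ∏ i ∈ σ.support, x i ^ σ i := by
    funext x
    rw [← hP x, MvPolynomial.eval_eq]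
  rw [e]
  apply Dg_sum
  intro σ hσ
  have h1 := (MvPolynomial.le_totalDegree hσ).trans hp
  exact Dg_mul d (by simpa [Finsupp.sum] using h1) (Dg_const 0 (p.coeff σ)) (Dg_mono' σ.support σ)

noncomputable def bw (b : ZMod 2) : ℝ := if b = 1 then 1 / 3 else 2 / 3

lemma sum_zmod2 (f : ZMod 2 → ℝ) : ∑ b, f b = f 0 + f 1 := Fin.sum_univ_two f

lemma ber13_prod {n : ℕ} (y : Fin n → ZMod 2) : ber13 y = ∏ i, bw (y i) := by
  unfold ber13 bw
  rw [Finset.prod_ite, Finset.prod_const, Finset.prod_const]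
  congr 2
  have := Finset.card_filter_add_card_filter_not (s := (univ : Finset (Fin n))) (fun i => y i = 1)
  rw [Finset.card_univ, Fintype.card_fin] at this
  omega

lemma ber13_nonneg {n : ℕ} (y : Fin n → ZMod 2) : 0 ≤ ber13 y := by
  unfold ber13; positivity

lemma sum_prod_fun {n : ℕ} (h : Fin n → ZMod 2 → ℝ) :
    ∑ y : Fin n → ZMod 2, ∏ i, h i (y i) = ∏ i, ∑ b, h i b := by
  rw [Finset.prod_univ_sum, Fintype.piFinset_univ]

lemma bw_sum : ∑ b, bw b = 1 := by
  rw [sum_zmod2]; simp [bw]; norm_num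

lemma ber13_sum {n : ℕ} : ∑ y : Fin n → ZMod 2, ber13 y = 1 := by
  simp only [ber13_prod]
  rw [sum_prod_fun (fun _ => bw)]
  simp [bw_sum]

lemma ber13_cov {n : ℕ} (j k : Fin n) (hjk : j ≠ k) :
    ∑ y : Fin n → ZMod 2, ber13 y * ((sg (y j) - 1 / 3) * (sg (y k) - 1 / 3)) = 0 := by
  have e : ∀ y : Fin n → ZMod 2, ber13 y * ((sg (y j) - 1 / 3) * (sg (y k) - 1 / 3)) =
      ∏ i, (bw (y i) * ((if i = j then sg (y i) - 1 / 3 else 1) * (if i = k then sg (y i) - 1 / 3 else 1))) := by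
    intro y
    rw [Finset.prod_mul_distrib, Finset.prod_mul_distrib, ber13_prod]
    simp
  simp only [e]
  rw [sum_prod_fun (fun i b => bw b * ((if i = j then sg b - 1 / 3 else 1) * (if i = k then sg b - 1 / 3 else 1)))]
  apply Finset.prod_eq_zero (Finset.mem_univ j)
  simp only [if_true, if_neg hjk, mul_one]
  rw [sum_zmod2, sg_zero, sg_one]
  simp [bw]; norm_num

lemma ber13_var {n : ℕ} (a : Fin n → ℝ) (ha : ∀ j, |a j| ≤ 1) :
    ∑ y : Fin n → ZMod 2, ber13 y * (∑ j, a j * (sg (y j) - 1 / 3)) ^ 2 ≤ 2 * n := by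
  have e : ∀ y : Fin n → ZMod 2, ber13 y * (∑ j, a j * (sg (y j) - 1 / 3)) ^ 2 =
      ∑ j, ∑ k, (a j * a k) * (ber13 y * ((sg (y j) - 1 / 3) * (sg (y k) - 1 / 3))) := by
    intro y
    rw [sq, Finset.sum_mul_sum, Finset.mul_sum]
    apply Finset.sum_congr rfl
    intro j _
    rw [Finset.mul_sum]
    apply Finset.sum_congr rfl
    intro k _
    ring
  simp only [e]
  rw [Finset.sum_comm]
  have h1 : ∀ j, ∑ y : Fin n → ZMod 2, ∑ k, (a j * a k) * (ber13 y * ((sg (y j) - 1 / 3) * (sg (y k) - 1 / 3))) ≤ 2 := by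
    intro j
    rw [Finset.sum_comm, Finset.sum_eq_single j]
    · have h2 : ∀ y : Fin n → ZMod 2, (a j * a j) * (ber13 y * ((sg (y j) - 1 / 3) * (sg (y j) - 1 / 3))) ≤ ber13 y * 2 := by
        intro y
        have hb := ber13_nonneg y
        have h3 : a j * a j ≤ 1 := by
          have := abs_le.mp (ha j); nlinarith
        have h4 : (sg (y j) - 1 / 3) * (sg (y j) - 1 / 3) ≤ 2 := by
          rcases zmod2_cases (y j) with h | h <;> rw [h] <;> simp only [sg_zero, sg_one] <;> norm_num
        have h5 : 0 ≤ (sg (y j) - 1 / 3) * (sg (y j) - 1 / 3) := mul_self_nonneg _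
        calc _ ≤ 1 * (ber13 y * ((sg (y j) - 1 / 3) * (sg (y j) - 1 / 3))) := by gcongr
          _ ≤ _ := by rw [one_mul]; gcongr
      refine (Finset.sum_le_sum (fun y _ => h2 y)).trans ?_
      rw [← Finset.sum_mul, ber13_sum, one_mul]
    · intro k _ hk
      rw [← Finset.mul_sum, ber13_cov j k (Ne.symm hk), mul_zero]
    · simp
  refine (Finset.sum_le_sum (fun j _ => h1 j)).trans ?_
  rw [Finset.sum_const, Finset.card_univ, Fintype.card_fin, nsmul_eq_mul, mul_comm]

lemma ber13_cheb {n : ℕ} (a : Fin n → ℝ) (ha : ∀ j, |a j| ≤ 1) (t : ℝ) (ht : 0 < t)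
    (S : Finset (Fin n → ZMod 2)) (hS : ∀ y ∈ S, t ≤ ∑ j, a j * (sg (y j) - 1 / 3)) :
    ∑ y ∈ S, ber13 y ≤ 2 * n / t ^ 2 := by
  rw [le_div_iff₀ (by positivity)]
  refine le_trans ?_ (ber13_var a ha)
  rw [Finset.sum_mul]
  calc _ ≤ ∑ y ∈ S, ber13 y * (∑ j, a j * (sg (y j) - 1 / 3)) ^ 2 := by
        apply Finset.sum_le_sum
        intro y hy
        have := ber13_nonneg y
        have := hS y hy
        gcongr
    _ ≤ _ := Finset.sum_le_sum_of_subset_of_nonneg (Finset.subset_univ _)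
        (fun y _ _ => mul_nonneg (ber13_nonneg y) (sq_nonneg _))

lemma tv_ge {β : Type} [Fintype β] (μ ν : β → ℝ) (hμ : ∑ y, μ y = 1) (hν : ∑ y, ν y = 1)
    (S : Finset β) : ∑ y ∈ S, μ y - ∑ y ∈ S, ν y ≤ tvDist μ ν := by
  classical
  unfold tvDist
  have h1 := Finset.sum_add_sum_compl S (fun y => |μ y - ν y|)
  have h2 : ∑ y ∈ S, (μ y - ν y) ≤ ∑ y ∈ S, |μ y - ν y| := Finset.sum_le_sum (fun _ _ => le_abs_self _)
  have h3 : ∑ y ∈ Sᶜ, (ν y - μ y) ≤ ∑ y ∈ Sᶜ, |μ y - ν y| := Finset.sum_le_sum (fun y _ => by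
    rw [abs_sub_comm]; exact le_abs_self _)
  have h4 := Finset.sum_add_sum_compl S μ
  have h5 := Finset.sum_add_sum_compl S ν
  rw [Finset.sum_sub_distrib] at h2 h3
  linarith

lemma outDist_sum {m n : ℕ} (P : Fin n → (Fin m → ZMod 2) → ZMod 2) (S : Finset (Fin n → ZMod 2)) :
    ∑ y ∈ S, outDist P y = ((univ.filter fun x => (fun i => P i x) ∈ S).card : ℝ) / Fintype.card (Fin m → ZMod 2) := by
  unfold outDist distOf
  rw [← Finset.sum_div]
  congr 1
  rw [← Finset.sum_card_fiberwise_eq_card_filter]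
  push_cast
  rfl

lemma image_card_of_Det {V β : Type} [Fintype V] [DecidableEq β] [Nonempty β] (C : Finset (LF V)) (g : V → β) (h : Det C g) :
    (univ.image g).card ≤ 2 ^ C.card := by
  classical
  let k : V → (C → ZMod 2) := fun x q => q.1.2 x
  have hf : Function.FactorsThrough g k := by
    intro x y hxy
    apply h
    intro q hq
    exact congrFun hxy ⟨q, hq⟩
  obtain ⟨f, hf⟩ := (Function.factorsThrough_iff g).mp hf
  rw [hf, ← Finset.image_image]
  refine Finset.card_image_le.trans ((Finset.card_le_univ _).trans ?_)
  simp [ZMod.card]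

lemma dyadic_gap (c : ℕ) (m : ℝ) (z : ℤ) (h : m * 2 ^ c = z) : 1 / (3 * 2 ^ c) ≤ |m - 1 / 3| := by
  have h2 : (0:ℝ) < 2 ^ c := by positivity
  have hm : m = z / 2 ^ c := by rw [← h]; field_simp
  have hne : 3 * z - 2 ^ c ≠ 0 := by
    intro h0
    have : (3:ℤ) ∣ 2 ^ c := ⟨z, by linarith⟩
    have h3 : (3:ℕ) ∣ 2 ^ c := by exact_mod_cast this
    have h4 := Nat.Prime.dvd_of_dvd_pow Nat.prime_three h3
    omega
  have h1 : (1:ℝ) ≤ |((3 * z - 2 ^ c : ℤ) : ℝ)| := by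
    rw [← Int.cast_abs]
    exact_mod_cast Int.one_le_abs hne
  have e : m - 1 / 3 = ((3 * z - 2 ^ c : ℤ) : ℝ) / (3 * 2 ^ c) := by
    rw [hm]; push_cast; field_simp
  rw [e, abs_div, abs_of_pos (show (0:ℝ) < 3 * 2 ^ c by positivity)]
  gcongr

lemma sum_biUnion_le_of_nonneg {α β : Type} [DecidableEq α] [DecidableEq β] (s : Finset α)
    (t : α → Finset β) (f : β → ℝ) (hf : ∀ y, 0 ≤ f y) :
    ∑ y ∈ s.biUnion t, f y ≤ ∑ a ∈ s, ∑ y ∈ t a, f y := by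
  induction s using Finset.induction_on with
  | empty => simp
  | insert i s hi ih =>
    rw [Finset.biUnion_insert, Finset.sum_insert hi]
    have h1 := Finset.sum_union_inter (s₁ := t i) (s₂ := s.biUnion t) (f := f)
    have h2 : 0 ≤ ∑ y ∈ t i ∩ s.biUnion t, f y := Finset.sum_nonneg (fun y _ => hf y)
    linarith

theorem part2 (d : ℕ) (ε : ℝ) (hε : 0 < ε) :
      ∃ N : ℕ, ∀ n : ℕ, N ≤ n → ∀ m : ℕ,
        ∀ P : Fin n → (Fin m → ZMod 2) → ZMod 2, (∀ i, DegLE d (P i)) →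
          tvDist (outDist P) ber13 ≥ 1 - ε := by
  classical
  set lam : ℝ := 1 / (4 * (d + 1)) with hlamdef
  have hlam : 0 < lam := by positivity
  have hlam2 : 2 * ((d : ℝ) + 1) * lam = 1 / 2 := by rw [hlamdef]; field_simp; norm_num
  set γ : ℕ → ℝ := fun c => 1 / (3 * 2 ^ c) with hγ
  have hγpos : ∀ c, 0 < γ c := fun c => by simp only [hγ]; positivity
  set acc : ℕ → ℝ := fun c => min 1 (ε * γ c ^ 2 / (32 * (8 ^ c + 8))) with haccdef
  have hacc : ∀ c, 0 < acc c ∧ acc c ≤ 1 := by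
    intro c
    have := hγpos c
    exact ⟨lt_min one_pos (by positivity), min_le_left _ _⟩
  set K := ⌈1 / lam⌉₊ with hKdef
  have hK : 1 ≤ lam * K := by
    have h1 : 1 / lam ≤ K := Nat.le_ceil _
    rw [div_le_iff₀ hlam] at h1
    linarith
  obtain ⟨B, hB⟩ := str d (fun e _ => ExS_all e) lam hlam acc hacc (Multiset.replicate K (2 * d + 1)) 1
  refine ⟨⌈576 * 8 ^ B / ε⌉₊ + 1, ?_⟩
  intro n hn m P hPd
  have hnpos : (0:ℝ) < n := by
    have : 0 < n := by omega
    exact_mod_cast this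
  have hnB : 576 * 8 ^ B / ε ≤ n :=
    (Nat.le_ceil _).trans (by exact_mod_cast (Nat.le_succ _).trans hn)
  have hSt := St_init d lam hlam K hK P (fun i => Dg_of_DegLE (hPd i))
  obtain ⟨C', Q', c, hcB, hC'c, hQ'c, hC', -, hQdet, A, hA, hbad⟩ := hB _ _ _ _ hSt
  rw [hlam2, Fintype.card_fin] at hA
  obtain ⟨mm, m1, m2, m3, m4⟩ := second_moment C' Q' c hC'c hQ'c A (acc c) (hacc c).1 hbad
    (fun j x => sg (P j x)) (fun a x => (abs_sg _).le) (by
      intro a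
      have h1 := hQdet a (d, P a) (by simp)
      apply Det2_union
      intro x y hx hy
      exact congrArg sg (h1 x y hx hy))
  have m3 := m3 (by
    intro j x
    rcases zmod2_cases (P j x) with h | h <;> rw [h]
    · exact ⟨1, by simp [sg_zero]⟩
    · exact ⟨-1, by simp [sg_one]⟩)
  have hgap : ∀ j x, γ c ≤ |mm j x - 1 / 3| := by
    intro j x
    obtain ⟨z, hz⟩ := m3 j x
    exact dyadic_gap c _ z hz
  set s : Fin n → (Fin m → ZMod 2) → ℝ := fun j x => if 1 / 3 ≤ mm j x then 1 else -1 with hs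
  have hs1 : ∀ j, Det C' (s j) := by
    intro j x y hxy
    simp only [hs]
    rw [m1 j x y hxy]
  have hs2 : ∀ j x, |s j x| ≤ 1 := by
    intro j x
    simp only [hs]
    split_ifs <;> simp
  have m5 := m4 s hs1 hs2
  have hsabs : ∀ j x, γ c ≤ s j x * (mm j x - 1 / 3) := by
    intro j x
    have h1 := hgap j x
    simp only [hs]
    split_ifs with h
    · rw [abs_of_nonneg (by linarith)] at h1; linarith
    · rw [abs_of_neg (by linarith)] at h1; linarith
  set Sg : Finset (Fin n → ℝ) := univ.image (fun x j => s j x) with hSg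
  have hSgc : Sg.card ≤ 2 ^ c := by
    refine (image_card_of_Det C' (fun x j => s j x) ?_).trans (Nat.pow_le_pow_right (by norm_num) hC'c)
    intro x y hxy
    funext j
    exact hs1 j x y hxy
  set t : ℝ := γ c * n / 4 with ht
  have hγc := hγpos c
  have htpos : 0 < t := by positivity
  set Ev : (Fin n → ℝ) → Finset (Fin n → ZMod 2) := fun σ =>
    univ.filter fun y => t ≤ ∑ j ∈ A, σ j * (sg (y j) - 1 / 3) with hEv
  set S := Sg.biUnion Ev with hS
  -- Bernoulli side
  have hber : ∑ y ∈ S, ber13 y ≤ ε / 2 := by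
    have h1 : ∑ y ∈ S, ber13 y ≤ ∑ σ ∈ Sg, ∑ y ∈ Ev σ, ber13 y := by
      exact sum_biUnion_le_of_nonneg Sg Ev _ ber13_nonneg
    have h2 : ∀ σ ∈ Sg, ∑ y ∈ Ev σ, ber13 y ≤ 2 * n / t ^ 2 := by
      intro σ hσ
      obtain ⟨x, -, rfl⟩ := Finset.mem_image.mp hσ
      apply ber13_cheb (fun j => if j ∈ A then s j x else 0) _ t htpos
      · intro y hy
        have := (Finset.mem_filter.mp hy).2
        refine this.trans (le_of_eq ?_)
        simp only [ite_mul, zero_mul]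
        rw [← Finset.sum_filter]
        simp
      · intro j
        split_ifs
        · exact hs2 j x
        · simp
    refine h1.trans ((Finset.sum_le_sum h2).trans ?_)
    rw [Finset.sum_const, nsmul_eq_mul]
    have h3 : (Sg.card : ℝ) ≤ 2 ^ c := by exact_mod_cast hSgc
    have h4 : 2 * n / t ^ 2 = 288 * 4 ^ c / n := by
      rw [ht]
      simp only [hγ]
      rw [show (4:ℝ) ^ c = 2 ^ c * 2 ^ c by rw [← mul_pow]; norm_num]
      field_simp
      norm_num
    rw [h4]
    have h5 : (8:ℝ) ^ c ≤ 8 ^ B := pow_le_pow_right₀ (by norm_num) hcB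
    rw [div_le_iff₀ hε] at hnB
    calc (Sg.card : ℝ) * (288 * 4 ^ c / n) ≤ 2 ^ c * (288 * 4 ^ c / n) := by gcongr
      _ = 288 * 8 ^ c / n := by
          rw [show (8:ℝ) ^ c = 2 ^ c * 4 ^ c by rw [← mul_pow]; norm_num]; ring
      _ ≤ ε / 2 := by
          rw [div_le_iff₀ hnpos]
          linarith
  -- polynomial side
  have hV : (0:ℝ) < Fintype.card (Fin m → ZMod 2) := by exact_mod_cast Fintype.card_pos
  have hpoly : 1 - ε / 2 ≤ ∑ y ∈ S, outDist P y := by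
    rw [outDist_sum, le_div_iff₀ hV]
    have hb : ∀ x ∈ univ.filter (fun x => ¬ (fun i => P i x) ∈ S),
        t ≤ |∑ j ∈ A, s j x * (sg (P j x) - mm j x)| := by
      intro x hx
      have hx := (Finset.mem_filter.mp hx).2
      by_contra hcon
      push Not at hcon
      apply hx
      rw [hS, Finset.mem_biUnion]
      refine ⟨fun j => s j x, Finset.mem_image.mpr ⟨x, Finset.mem_univ _, rfl⟩, ?_⟩
      rw [hEv, Finset.mem_filter]
      refine ⟨Finset.mem_univ _, ?_⟩
      have h1 : ∑ j ∈ A, s j x * (sg (P j x) - 1 / 3) =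
          ∑ j ∈ A, s j x * (sg (P j x) - mm j x) + ∑ j ∈ A, s j x * (mm j x - 1 / 3) := by
        rw [← Finset.sum_add_distrib]
        apply Finset.sum_congr rfl
        intro j _; ring
      have h2 : (A.card : ℝ) * γ c ≤ ∑ j ∈ A, s j x * (mm j x - 1 / 3) := by
        rw [← nsmul_eq_mul, ← Finset.sum_const]
        exact Finset.sum_le_sum (fun j _ => hsabs j x)
      have h3 : (n : ℝ) / 2 * γ c ≤ (A.card : ℝ) * γ c := by
        gcongr; linarith
      have h4 := (abs_lt.mp hcon).1
      rw [h1]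
      have : (n:ℝ) / 2 * γ c = 2 * t := by rw [ht]; ring
      linarith
    have hch := cheb (fun x => ∑ j ∈ A, s j x * (sg (P j x) - mm j x)) t _ htpos.le hb
    have h1 := Finset.card_filter_add_card_filter_not (s := (univ : Finset (Fin m → ZMod 2))) (fun x => (fun i => P i x) ∈ S)
    have h2 : ((univ.filter fun x : Fin m → ZMod 2 => (fun i => P i x) ∈ S).card : ℝ) +
        ((univ.filter fun x : Fin m → ZMod 2 => ¬ (fun i => P i x) ∈ S).card : ℝ) = Fintype.card (Fin m → ZMod 2) := by
      exact_mod_cast h1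
    set Z := ((univ.filter fun x : Fin m → ZMod 2 => ¬ (fun i => P i x) ∈ S).card : ℝ)
    rw [Fintype.card_fin] at m5
    have h3 : Z * t ^ 2 ≤ Fintype.card (Fin m → ZMod 2) * ((8 ^ c + 8) * acc c * (n : ℝ) ^ 2) :=
      hch.trans (mul_le_mul_of_nonneg_left m5 hV.le)
    have ha2 : acc c ≤ ε * γ c ^ 2 / (32 * (8 ^ c + 8)) := min_le_right _ _
    rw [le_div_iff₀ (by positivity)] at ha2
    have h4 : Z * t ^ 2 ≤ (ε / 2 * Fintype.card (Fin m → ZMod 2)) * t ^ 2 := by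
      refine h3.trans ?_
      calc (Fintype.card (Fin m → ZMod 2) : ℝ) * ((8 ^ c + 8) * acc c * (n : ℝ) ^ 2)
          = (Fintype.card (Fin m → ZMod 2) * (n : ℝ) ^ 2 / 32) * (acc c * (32 * (8 ^ c + 8))) := by ring
        _ ≤ (Fintype.card (Fin m → ZMod 2) * (n : ℝ) ^ 2 / 32) * (ε * γ c ^ 2) := by gcongr
        _ = _ := by rw [ht]; ring
    have h5 : Z ≤ ε / 2 * Fintype.card (Fin m → ZMod 2) := le_of_mul_le_mul_right h4 (by positivity)
    linarith
  have htot : ∑ y, outDist P y = 1 := by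
    rw [outDist_sum]
    simp only [Finset.mem_univ, Finset.filter_true, Finset.card_univ]
    exact div_self hV.ne'
  have := tv_ge (outDist P) ber13 htot ber13_sum S
  linarith

lemma tv_nonneg {β : Type} [Fintype β] (μ ν : β → ℝ) : 0 ≤ tvDist μ ν := by
  unfold tvDist; positivity
end fin

/-- degree-`d` distributions are `1 - o_n(1)`-far from `Ber(1/3)^{⊗n}`. -/
theorem degree_d_lower_bound :
    (∀ d : ℕ, 0 < d → ∀ ε : ℝ, 0 < ε → ε ≤ 1 →
      ∃ ε' > (0:ℝ), ∃ C > (0:ℝ), ∀ m n : ℕ, 0 < m → 0 < n →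
        ∀ P : Fin n → (Fin m → ZMod 2) → ZMod 2, (∀ i, DegLE d (P i)) →
          tvDist (outDist P) ber13 ≥ 1 - C * (n:ℝ) ^ (-ε') - C * ε) ∧
    (∀ d : ℕ, 0 < d → ∀ ε : ℝ, 0 < ε →
      ∃ N : ℕ, ∀ n : ℕ, N ≤ n → ∀ m : ℕ,
        ∀ P : Fin n → (Fin m → ZMod 2) → ZMod 2, (∀ i, DegLE d (P i)) →
          tvDist (outDist P) ber13 ≥ 1 - ε) := by
  constructor
  · intro d _ ε hε _
    refine ⟨1, one_pos, 1 / ε, by positivity, ?_⟩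
    intro m n _ _ P _
    have h1 := tv_nonneg (outDist P) ber13
    have h2 : 1 / ε * ε = 1 := by field_simp
    have h3 : 0 ≤ 1 / ε * (n:ℝ) ^ (-(1:ℝ)) := by positivity
    linarith
  · intro d _ ε hε
    exact part2 d ε hε
end

section
/- For all positive integers d and r there exists δ > 0, depending only on d and r (and not on m), such that every function P : 𝔽₂^m → 𝔽₂ with rank_d(P) ≤ r satisfies |Pr_{X ~ Unif(𝔽₂^m)}[P(X) = 1] − 1/3| ≥ δ. In particular (taking r = 1), for every positive integer d there exists δ_d > 0 such that every polynomial function P : 𝔽₂^m → 𝔽₂ of degree at most d satisfies |Pr_X[P(X) = 1] − 1/3| ≥ δ_d. -/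
open Finset

namespace SPG

noncomputable def sg (z : ZMod 2) : ℝ := if z = 0 then 1 else -1

lemma sg_zero : sg 0 = 1 := by simp [sg]

lemma zcases (z : ZMod 2) : z = 0 ∨ z = 1 := by
  revert z; decide

lemma sg_one : sg 1 = -1 := by simp [sg]

lemma sg_add (a b : ZMod 2) : sg (a + b) = sg a * sg b := by
  rcases zcases a with rfl | rfl <;> rcases zcases b with rfl | rfl
  · simp [sg]
  · simp [sg]
  · simp [sg]
  · have : (1 + 1 : ZMod 2) = 0 := by decide
    rw [this]; simp [sg]

lemma sg_sq (a : ZMod 2) : sg a * sg a = 1 := by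
  rcases zcases a with rfl | rfl <;> simp [sg]

lemma sg_abs (a : ZMod 2) : |sg a| = 1 := by
  rcases zcases a with rfl | rfl <;> simp [sg]

lemma sg_inj {a b : ZMod 2} (h : sg a = sg b) : a = b := by
  rcases zcases a with rfl | rfl <;> rcases zcases b with rfl | rfl <;> simp_all [sg] <;> norm_num at h

section four
variable {m : ℕ}

noncomputable def chi (ξ x : Fin m → ZMod 2) : ℝ := sg (ξ ⬝ᵥ x)

noncomputable def ft (f : (Fin m → ZMod 2) → ℝ) (ξ : Fin m → ZMod 2) : ℝ :=
  (∑ x, f x * chi ξ x) / 2 ^ m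

lemma chi_add_left (ξ η x : Fin m → ZMod 2) : chi (ξ + η) x = chi ξ x * chi η x := by
  simp [chi, add_dotProduct, sg_add]

lemma chi_add_right (ξ x y : Fin m → ZMod 2) : chi ξ (x + y) = chi ξ x * chi ξ y := by
  simp [chi, dotProduct_add, sg_add]

lemma chi_zero (x : Fin m → ZMod 2) : chi 0 x = 1 := by simp [chi, sg_zero]

lemma chi_comm (ξ x : Fin m → ZMod 2) : chi ξ x = chi x ξ := by simp [chi, dotProduct_comm]

lemma chi_abs (ξ x : Fin m → ZMod 2) : |chi ξ x| = 1 := sg_abs _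

lemma vadd_self {G : Type*} [AddCommGroup G] [Module (ZMod 2) G] (x : G) : x + x = 0 :=
  ZModModule.add_self x

lemma add_eq_zero_iff' {G : Type*} [AddCommGroup G] [Module (ZMod 2) G] (x y : G) :
    x + y = 0 ↔ x = y := by
  constructor
  · intro h
    have := vadd_self y
    rw [← this] at h
    exact add_right_cancel h
  · rintro rfl; exact vadd_self _

lemma add_add_cancel' {G : Type*} [AddCommGroup G] [Module (ZMod 2) G] (x y : G) :
    x + y + y = x := by rw [add_assoc, vadd_self, add_zero]

lemma sum_chi (ξ : Fin m → ZMod 2) : ∑ x, chi ξ x = if ξ = 0 then (2:ℝ) ^ m else 0 := by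
  split_ifs with h
  · subst h; simp [chi_zero]
  · obtain ⟨i, hi⟩ : ∃ i, ξ i ≠ 0 := by
      by_contra! hh; exact h (funext hh)
    have h1 : ξ i = 1 := (zcases _).resolve_left hi
    have key : ∀ t, ∑ x, chi ξ x = ∑ x, chi ξ (x + t) := fun t =>
      (Equiv.sum_comp (Equiv.addRight t) (fun x => chi ξ x)).symm
    have h2 := key (Pi.single i 1)
    have h3 : chi ξ (Pi.single i 1) = -1 := by simp [chi, h1, sg_one]
    simp only [chi_add_right, h3, mul_neg, mul_one, Finset.sum_neg_distrib] at h2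
    linarith

lemma inversion (f : (Fin m → ZMod 2) → ℝ) (x : Fin m → ZMod 2) :
    f x = ∑ ξ, ft f ξ * chi ξ x := by
  have h : ∑ ξ, ft f ξ * chi ξ x = (∑ y, f y * ∑ ξ, chi ξ (y + x)) / 2 ^ m := by
    simp only [ft, div_mul_eq_mul_div, ← Finset.sum_div, Finset.sum_mul, Finset.mul_sum]
    rw [Finset.sum_comm]
    simp only [chi_add_right, mul_assoc]
  rw [h]
  have h2 : ∀ y, ∑ ξ, chi ξ (y + x) = if y = x then (2:ℝ) ^ m else 0 := by
    intro y
    simp only [chi_comm _ (y + x), sum_chi, add_eq_zero_iff']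
  simp [h2]

lemma sum_chi_sq (c : (Fin m → ZMod 2) → ℝ) (l : Fin m → ZMod 2) :
    ∑ a, chi l a * (∑ η, c η * chi η a) ^ 2 = 2 ^ m * ∑ η, c η * c (η + l) := by
  have h1 : ∀ a, chi l a * (∑ η, c η * chi η a) ^ 2
      = ∑ η, ∑ ζ, c η * c ζ * chi (η + l + ζ) a := by
    intro a
    rw [sq, Finset.sum_mul_sum, Finset.mul_sum]
    refine Finset.sum_congr rfl fun η _ => ?_
    rw [Finset.mul_sum]
    refine Finset.sum_congr rfl fun ζ _ => ?_
    rw [chi_add_left, chi_add_left]; ring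
  simp only [h1]
  rw [Finset.sum_comm, Finset.mul_sum]
  refine Finset.sum_congr rfl fun η _ => ?_
  rw [Finset.sum_comm]
  simp only [← Finset.mul_sum, sum_chi, add_eq_zero_iff']
  simp
  ring

lemma parseval (f : (Fin m → ZMod 2) → ℝ) : ∑ ξ, ft f ξ ^ 2 = (∑ x, f x ^ 2) / 2 ^ m := by
  have h := sum_chi_sq (ft f) 0
  simp only [chi_zero, one_mul, ← inversion, add_zero] at h
  rw [h]
  field_simp

lemma parseval_le (f : (Fin m → ZMod 2) → ℝ) (hf : ∀ x, |f x| ≤ 1) : ∑ ξ, ft f ξ ^ 2 ≤ 1 := by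
  rw [parseval, div_le_one (by positivity)]
  calc ∑ x, f x ^ 2 ≤ ∑ x : Fin m → ZMod 2, (1:ℝ) :=
        Finset.sum_le_sum fun x _ => (sq_le_one_iff_abs_le_one _).2 (hf x)
    _ = 2 ^ m := by simp

lemma ft_abs_le (f : (Fin m → ZMod 2) → ℝ) (hf : ∀ x, |f x| ≤ 1) (ξ) : |ft f ξ| ≤ 1 := by
  rw [← sq_le_one_iff_abs_le_one]
  exact (Finset.single_le_sum (f := fun ξ => ft f ξ ^ 2) (fun _ _ => sq_nonneg _)
    (Finset.mem_univ ξ)).trans (parseval_le f hf)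

lemma conv (f : (Fin m → ZMod 2) → ℝ) (a ξ : Fin m → ZMod 2) :
    ft (fun x => f x * f (x + a)) ξ = ∑ η, ft f η * ft f (η + ξ) * chi η a := by
  have h1 : ∀ x, f x * f (x + a) * chi ξ x
      = ∑ η, (ft f η * chi η a) * (f x * chi (η + ξ) x) := by
    intro x
    rw [inversion f (x + a), Finset.mul_sum, Finset.sum_mul]
    refine Finset.sum_congr rfl fun η _ => ?_
    rw [chi_add_right, chi_add_left]; ring
  rw [ft]
  simp only [h1]
  rw [Finset.sum_comm, Finset.sum_div]
  refine Finset.sum_congr rfl fun η _ => ?_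
  rw [← Finset.mul_sum, ft, ft]; ring

/-- finite second moment lemma -/
lemma second_moment {W : Type*} [AddCommGroup W] [Module (ZMod 2) W] [Fintype W]
    (ι : W →+ (Fin m → ZMod 2)) (hι : Function.Injective ι) (u : W →+ ZMod 2)
    (f : (Fin m → ZMod 2) → ℝ) (hf : ∀ x, |f x| ≤ 1) (M : ℝ) (hMn : 0 ≤ M)
    (hM : ∀ η, η ∉ Set.range ι → ∑ l, ft f (η + ι l) ^ 2 ≤ M)
    (J : ℕ) (ξ : Fin J → Fin m → ZMod 2) :
    ∃ a, ∀ j, (ft (fun x => f x * f (x + a)) (ξ j)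
      - ∑ l, ft f (ι l) * ft f (ι l + ξ j) * sg (u l)) ^ 2 ≤ J * M := by
  classical
  set w : (Fin m → ZMod 2) → ℝ := fun a => ∑ l, sg (u l) * chi (ι l) a with hw
  have hshift : ∀ l a, sg (u l) * chi (ι l) a * w a = w a := by
    intro l a
    rw [hw]
    simp only
    rw [Finset.mul_sum]
    rw [← Equiv.sum_comp (Equiv.addLeft l)]
    refine Finset.sum_congr rfl fun k _ => ?_
    simp only [Equiv.coe_addLeft, map_add, sg_add, chi_add_left]
    have h1 := sg_sq (u l)
    have h2 : chi (ι l) a * chi (ι l) a = 1 := sg_sq _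
    calc _ = (sg (u l) * sg (u l)) * (chi (ι l) a * chi (ι l) a) * (sg (u k) * chi (ι k) a) := by
            ring
      _ = _ := by rw [h1, h2]; ring
  have hw2 : ∀ a, w a ^ 2 = Fintype.card W * w a := by
    intro a
    rw [sq]
    conv_lhs => rw [hw]
    simp only
    rw [Finset.sum_mul]
    rw [Finset.sum_congr rfl fun l _ => hshift l a]
    simp
  have hcard : (0:ℝ) < Fintype.card W := by
    exact_mod_cast Fintype.card_pos
  have hw0 : ∀ a, 0 ≤ w a := by
    intro a
    have := hw2 a
    nlinarith [sq_nonneg (w a)]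
  have hwsum : ∑ a, w a = 2 ^ m := by
    rw [hw]
    simp only
    rw [Finset.sum_comm]
    simp only [← Finset.mul_sum, sum_chi]
    have : ∀ l, (ι l = 0) ↔ l = 0 := fun l => map_eq_zero_iff ι hι
    simp [this, sg_zero]
  have hwchi : ∀ a, 0 < w a → ∀ l, chi (ι l) a = sg (u l) := by
    intro a ha l
    have h1 := hshift l a
    have h2 : sg (u l) * chi (ι l) a = 1 := by
      have := mul_right_cancel₀ (b := w a) ha.ne' (h1.trans (one_mul _).symm)
      exact this
    have h3 := sg_sq (u l)
    calc chi (ι l) a = (sg (u l) * sg (u l)) * chi (ι l) a := by rw [h3, one_mul]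
      _ = sg (u l) * (sg (u l) * chi (ι l) a) := by ring
      _ = _ := by rw [h2, mul_one]
  -- the error coefficients
  set c : Fin J → (Fin m → ZMod 2) → ℝ := fun j η =>
    if η ∈ Set.range ι then 0 else ft f η * ft f (η + ξ j) with hc
  have hsplit : ∀ a, 0 < w a → ∀ j, ft (fun x => f x * f (x + a)) (ξ j)
      - ∑ l, ft f (ι l) * ft f (ι l + ξ j) * sg (u l) = ∑ η, c j η * chi η a := by
    intro a ha j
    rw [conv, sub_eq_iff_eq_add]
    have h1 : ∑ l, ft f (ι l) * ft f (ι l + ξ j) * sg (u l)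
        = ∑ η, if η ∈ Set.range ι then ft f η * ft f (η + ξ j) * chi η a else 0 := by
      rw [← Finset.sum_filter]
      have : (Finset.univ.filter fun η => η ∈ Set.range ι) = Finset.univ.image ι := by
        ext η; simp
      rw [this, Finset.sum_image (fun _ _ _ _ h => hι h)]
      exact Finset.sum_congr rfl fun l _ => by rw [hwchi a ha l]
    rw [h1, ← Finset.sum_add_distrib]
    refine Finset.sum_congr rfl fun η _ => ?_
    simp only [hc]
    split_ifs <;> simp
  have hbound : ∀ j, ∑ a, w a * (∑ η, c j η * chi η a) ^ 2 ≤ 2 ^ m * M := by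
    intro j
    have h1 : ∑ a, w a * (∑ η, c j η * chi η a) ^ 2
        = ∑ l, sg (u l) * (2 ^ m * ∑ η, c j η * c j (η + ι l)) := by
      simp only [hw, Finset.sum_mul]
      rw [Finset.sum_comm]
      refine Finset.sum_congr rfl fun l _ => ?_
      rw [← sum_chi_sq, Finset.mul_sum]
      exact Finset.sum_congr rfl fun a _ => by ring
    rw [h1]
    have hmem : ∀ η l, η + ι l ∈ Set.range ι ↔ η ∈ Set.range ι := by
      intro η l
      constructor
      · rintro ⟨k, hk⟩
        refine ⟨k + l, ?_⟩
        rw [map_add, hk, add_add_cancel']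
      · rintro ⟨k, hk⟩
        exact ⟨k + l, by rw [map_add, hk]⟩
    set d : W → (Fin m → ZMod 2) → ℝ := fun l η =>
      if η ∈ Set.range ι then 0 else ft f (η + ι l) ^ 2 * ft f (η + ξ j) ^ 2 with hd
    have h2 : ∀ l, sg (u l) * (2 ^ m * ∑ η, c j η * c j (η + ι l)) ≤ 2 ^ m * ∑ η, d l η := by
      intro l
      have h3 : ∑ η, |c j η * c j (η + ι l)| ≤ ∑ η, (d l η + d l (η + ι l)) / 2 := by
        refine Finset.sum_le_sum fun η _ => ?_
        simp only [hc, hd, hmem]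
        split_ifs with hη
        · simp
        · rw [add_add_cancel']
          have e : ft f η * ft f (η + ξ j) * (ft f (η + ι l) * ft f (η + ι l + ξ j))
            = (ft f (η + ι l) * ft f (η + ξ j)) * (ft f η * ft f (η + ι l + ξ j)) := by ring
          rw [e, abs_le]
          constructor
          · nlinarith [sq_nonneg (ft f (η + ι l) * ft f (η + ξ j) + ft f η * ft f (η + ι l + ξ j))]
          · nlinarith [sq_nonneg (ft f (η + ι l) * ft f (η + ξ j) - ft f η * ft f (η + ι l + ξ j))]
      have h4 : ∑ η, d l (η + ι l) = ∑ η, d l η :=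
        Equiv.sum_comp (Equiv.addRight (ι l)) (d l)
      have h5 : ∑ η, (d l η + d l (η + ι l)) / 2 = ∑ η, d l η := by
        rw [← Finset.sum_div, Finset.sum_add_distrib, h4]; ring
      have h6 : sg (u l) * (2 ^ m * ∑ η, c j η * c j (η + ι l))
          ≤ 2 ^ m * ∑ η, |c j η * c j (η + ι l)| := by
        refine (le_abs_self _).trans ?_
        rw [abs_mul, sg_abs, one_mul, abs_mul, abs_of_pos (by positivity : (0:ℝ) < 2 ^ m)]
        gcongr
        exact Finset.abs_sum_le_sum_abs _ _
      refine h6.trans ?_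
      rw [← h5]
      exact mul_le_mul_of_nonneg_left h3 (by positivity)
    refine (Finset.sum_le_sum fun l _ => h2 l).trans ?_
    rw [← Finset.mul_sum]
    gcongr
    rw [Finset.sum_comm]
    calc ∑ η, ∑ l, d l η ≤ ∑ η, M * ft f (η + ξ j) ^ 2 := by
            refine Finset.sum_le_sum fun η _ => ?_
            simp only [hd]
            split_ifs with hη
            · simp; positivity
            · rw [← Finset.sum_mul]
              gcongr
              exact hM η hη
        _ = M * ∑ η, ft f η ^ 2 := by
            rw [← Finset.mul_sum]
            congr 1
            exact Equiv.sum_comp (Equiv.addRight (ξ j)) (fun η => ft f η ^ 2)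
        _ ≤ M * 1 := by gcongr; exact parseval_le f hf
        _ = M := mul_one M
  by_contra hcon
  push Not at hcon
  have hlt : ∀ a, w a * (J * M) ≤ w a * ∑ j, (∑ η, c j η * chi η a) ^ 2 := by
    intro a
    rcases (hw0 a).eq_or_lt with h | h
    · rw [← h]; simp
    · obtain ⟨j, hj⟩ := hcon a
      rw [hsplit a h j] at hj
      gcongr
      refine hj.le.trans ?_
      exact Finset.single_le_sum (f := fun j => (∑ η, c j η * chi η a) ^ 2)
        (fun _ _ => sq_nonneg _) (Finset.mem_univ j)
  have hpos : ∃ a, 0 < w a := by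
    by_contra! h
    have : ∑ a, w a ≤ 0 := Finset.sum_nonpos fun a _ => h a
    rw [hwsum] at this
    have : (0:ℝ) < 2 ^ m := by positivity
    linarith
  obtain ⟨a0, ha0⟩ := hpos
  have hlt0 : w a0 * (J * M) < w a0 * ∑ j, (∑ η, c j η * chi η a0) ^ 2 := by
    obtain ⟨j, hj⟩ := hcon a0
    rw [hsplit a0 ha0 j] at hj
    gcongr
    refine hj.trans_le ?_
    exact Finset.single_le_sum (f := fun j => (∑ η, c j η * chi η a0) ^ 2)
        (fun _ _ => sq_nonneg _) (Finset.mem_univ j)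
  have h1 : ∑ a, w a * (J * M) < ∑ a, w a * ∑ j, (∑ η, c j η * chi η a) ^ 2 :=
    Finset.sum_lt_sum (fun a _ => hlt a) ⟨a0, Finset.mem_univ _, hlt0⟩
  have h2 : ∑ a, w a * ∑ j, (∑ η, c j η * chi η a) ^ 2
      = ∑ j, ∑ a, w a * (∑ η, c j η * chi η a) ^ 2 := by
    simp only [Finset.mul_sum]
    rw [Finset.sum_comm]
  rw [h2, ← Finset.sum_mul, hwsum] at h1
  have h3 : ∑ j, ∑ a, w a * (∑ η, c j η * chi η a) ^ 2 ≤ ∑ j : Fin J, 2 ^ m * M :=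
    Finset.sum_le_sum fun j _ => hbound j
  simp at h3
  linarith

end four

section abstr
variable {G : Type*} [AddCommGroup G] [Module (ZMod 2) G]

/-- finite family of functionals separating `T` from `W` -/
lemma exists_sep (W : Submodule (ZMod 2) G) (T : Finset G) :
    ∃ S : Submodule (ZMod 2) (G →ₗ[ZMod 2] ZMod 2), Finite S ∧
      (∀ s ∈ S, ∀ x ∈ W, s x = 0) ∧ ∀ y ∈ T, y ∉ W → ∃ s ∈ S, s y ≠ 0 := by
  classical
  have h : ∀ y : G, ∃ s : G →ₗ[ZMod 2] ZMod 2, (∀ x ∈ W, s x = 0) ∧ (y ∉ W → s y ≠ 0) := by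
    intro y
    by_cases hy : y ∈ W
    · exact ⟨0, by simp, fun h => absurd hy h⟩
    · obtain ⟨f, hf, hk⟩ := Submodule.exists_le_ker_of_notMem hy
      exact ⟨f, fun x hx => by simpa using hk hx, fun _ => hf⟩
  choose s hs1 hs2 using h
  refine ⟨Submodule.span (ZMod 2) (T.image s : Finset _), ?_, ?_, ?_⟩
  · exact Module.finite_of_finite (ZMod 2)
  · intro t ht x hx
    induction ht using Submodule.span_induction with
    | mem t ht =>
      simp at ht
      obtain ⟨y, -, rfl⟩ := ht
      exact hs1 y x hx
    | zero => simp
    | add a b _ _ ha hb => simp [ha, hb]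
    | smul c a _ ha => simp [ha]
  · intro y hy hyW
    exact ⟨s y, Submodule.subset_span (by simpa using ⟨y, hy, rfl⟩), hs2 y hyW⟩

lemma sum_sg (S : Submodule (ZMod 2) (G →ₗ[ZMod 2] ZMod 2)) [Fintype S] (y : G)
    (h : ∃ s ∈ S, s y ≠ 0) : ∑ s : S, sg ((s : G →ₗ[ZMod 2] ZMod 2) y) = 0 := by
  obtain ⟨t, ht, hty⟩ := h
  have key := Equiv.sum_comp (Equiv.addRight (⟨t, ht⟩ : S))
    (fun s : S => sg ((s : G →ₗ[ZMod 2] ZMod 2) y))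
  have h1 : t y = 1 := (zcases _).resolve_left hty
  simp [sg_add, h1, sg_one] at key
  linarith

lemma sum_sg_zero (S : Submodule (ZMod 2) (G →ₗ[ZMod 2] ZMod 2)) [Fintype S] (y : G)
    (h : ∀ s ∈ S, s y = 0) : ∑ s : S, sg ((s : G →ₗ[ZMod 2] ZMod 2) y) = Fintype.card S := by
  have : ∀ s : S, sg ((s : G →ₗ[ZMod 2] ZMod 2) y) = 1 := fun s => by rw [h s s.2, sg_zero]
  simp [this]

lemma uniq (c : G → ℝ) (hc : Summable c) (W : Submodule (ZMod 2) G) [Fintype W]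
    (h : ∀ s : G →ₗ[ZMod 2] ZMod 2, (∀ x ∈ W, s x = 0) → ∑' η, c η * sg (s η) = 0) (η0 : G) :
    ∑ l : W, c (η0 + l) = 0 := by
  classical
  have hsep : ∀ T : Finset G, ∃ K : G → ℝ, (∀ η, |K η| ≤ 1) ∧ (∀ η, η + η0 ∈ W → K η = 1) ∧
      (∀ η ∈ T, η + η0 ∉ W → K η = 0) ∧ ∑' η, c η * K η = 0 := by
    intro T
    obtain ⟨S, hS, hS1, hS2⟩ := exists_sep W (T.image (· + η0))
    haveI := Fintype.ofFinite S
    have hcard : (0:ℝ) < Fintype.card S := by exact_mod_cast Fintype.card_pos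
    refine ⟨fun η => (∑ s : S, sg ((s : G →ₗ[ZMod 2] ZMod 2) (η + η0))) / Fintype.card S,
      ?_, ?_, ?_, ?_⟩
    · intro η
      rw [abs_div, abs_of_pos hcard, div_le_one hcard]
      refine (Finset.abs_sum_le_sum_abs _ _).trans ?_
      simp [sg_abs]
    · intro η hη
      simp only
      rw [sum_sg_zero _ _ (fun s hs => hS1 s hs _ hη), div_self hcard.ne']
    · intro η hηT hη
      simp only
      rw [sum_sg _ _ (hS2 _ (Finset.mem_image_of_mem _ hηT) hη), zero_div]
    · have h1 : ∀ η, c η * ((∑ s : S, sg ((s : G →ₗ[ZMod 2] ZMod 2) (η + η0))) / Fintype.card S)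
          = ∑ s : S, (c η * sg ((s : G →ₗ[ZMod 2] ZMod 2) η)) *
              (sg ((s : G →ₗ[ZMod 2] ZMod 2) η0) / Fintype.card S) := by
        intro η
        rw [Finset.sum_div, Finset.mul_sum]
        refine Finset.sum_congr rfl fun s _ => ?_
        rw [map_add, sg_add]; ring
      simp only [h1]
      have hsm : ∀ s : S, Summable fun η => c η * sg ((s : G →ₗ[ZMod 2] ZMod 2) η) := by
        intro s
        refine Summable.of_norm_bounded hc.abs fun η => ?_
        rw [Real.norm_eq_abs, abs_mul, sg_abs, mul_one]
      rw [Summable.tsum_finsetSum (fun s _ => (hsm s).mul_right _)]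
      refine Finset.sum_eq_zero fun s _ => ?_
      rw [tsum_mul_right, h s (hS1 s s.2), zero_mul]
  choose K hK1 hK2 hK3 hK4 using hsep
  have hlim : Filter.Tendsto (fun T : Finset G => ∑' η, c η * K T η) Filter.atTop
      (nhds (∑' η, if η + η0 ∈ W then c η else 0)) := by
    refine tendsto_tsum_of_dominated_convergence (bound := fun η => |c η|) hc.abs ?_ ?_
    · intro η
      refine tendsto_const_nhds.congr' ?_
      filter_upwards [Filter.eventually_ge_atTop ({η} : Finset G)] with T hT
      split_ifs with hη
      · rw [hK2 T η hη, mul_one]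
      · rw [hK3 T η (hT (by simp)) hη, mul_zero]
    · refine Filter.Eventually.of_forall fun T η => ?_
      rw [Real.norm_eq_abs, abs_mul]
      exact mul_le_of_le_one_right (abs_nonneg _) (hK1 T η)
  simp only [hK4] at hlim
  have h0 := tendsto_nhds_unique hlim tendsto_const_nhds
  rw [← h0]
  have hinj : Function.Injective (fun l : W => η0 + (l : G)) := fun a b hab =>
    Subtype.ext (add_left_cancel hab)
  rw [tsum_eq_sum (s := Finset.univ.image (fun l : W => η0 + (l : G)))]
  · rw [Finset.sum_image (fun _ _ _ _ h => hinj h)]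
    refine Finset.sum_congr rfl fun l _ => ?_
    rw [if_pos]
    rw [add_comm η0, add_add_cancel']
    exact l.2
  · intro η hη
    rw [if_neg]
    intro hmem
    apply hη
    simp only [Finset.mem_image, Finset.mem_univ, true_and]
    exact ⟨⟨η + η0, hmem⟩, by simp only; rw [add_comm, add_add_cancel']⟩

noncomputable def gam (β : G → ℝ) (u : G → ZMod 2) (ξ : G) : ℝ :=
  ∑' η, β η * β (η + ξ) * sg (u η)

lemma summable_shift (β : G → ℝ) (hβ : Summable fun η => β η ^ 2) (ξ : G) :
    Summable fun η => β (η + ξ) ^ 2 :=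
  (Equiv.summable_iff (Equiv.addRight ξ) (f := fun η => β η ^ 2)).2 hβ

lemma summable_mul (β β' : G → ℝ) (hβ : Summable fun η => β η ^ 2)
    (hβ' : Summable fun η => β' η ^ 2) :
    Summable fun η => |β η * β' η| := by
  refine Summable.of_nonneg_of_le (fun _ => abs_nonneg _) (fun η => ?_) (hβ.add hβ')
  rw [abs_le]
  constructor <;> nlinarith [sq_nonneg (β η + β' η), sq_nonneg (β η - β' η), sq_nonneg (β η),
    sq_nonneg (β' η)]

lemma summable_gam (β : G → ℝ) (hβ : Summable fun η => β η ^ 2) (u : G → ZMod 2) (ξ : G) :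
    Summable fun η => β η * β (η + ξ) * sg (u η) := by
  refine Summable.of_norm_bounded (summable_mul β _ hβ (summable_shift β hβ ξ)) fun η => ?_
  rw [Real.norm_eq_abs, abs_mul _ (sg _), sg_abs, mul_one]

lemma continuous_sg : Continuous sg := continuous_of_discreteTopology

lemma continuous_gam (β : G → ℝ) (hβ : Summable fun η => β η ^ 2) (ξ : G) :
    Continuous fun u : G → ZMod 2 => gam β u ξ := by
  refine continuous_tsum (u := fun η => |β η * β (η + ξ)|) (fun η => ?_)
    (summable_mul β _ hβ (summable_shift β hβ ξ)) (fun η u => ?_)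
  · exact continuous_const.mul (continuous_sg.comp (continuous_apply η))
  · rw [Real.norm_eq_abs, abs_mul _ (sg _), sg_abs, mul_one]

lemma gam_support (β : G → ℝ) (u : G → ZMod 2) (ξ : G) (h : gam β u ξ ≠ 0) :
    ∃ p : Function.support β × Function.support β, (p.1 : G) + p.2 = ξ := by
  by_contra! hcon
  apply h
  rw [gam]
  convert tsum_zero with η
  by_cases h1 : β η = 0
  · simp [h1]
  by_cases h2 : β (η + ξ) = 0
  · simp [h2]
  exfalso
  refine hcon (⟨η, h1⟩, ⟨η + ξ, h2⟩) ?_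
  simp only
  rw [← add_assoc, vadd_self, zero_add]

lemma finite_span (T : Finset G) : Finite (Submodule.span (ZMod 2) (T : Set G)) :=
  Module.finite_of_finite (ZMod 2)

/-- Baire step -/
lemma baire_step (β : G → ℝ) (hβ : Summable fun η => β η ^ 2)
    (hfin : ∀ u : G →ₗ[ZMod 2] ZMod 2, {ξ | gam β u ξ ≠ 0}.Finite)
    (T0 : Finset G) :
    ∃ (T : Finset G) (u0 : G →ₗ[ZMod 2] ZMod 2), T0 ⊆ T ∧ (∀ x ∈ T0, u0 x = 0) ∧
      ∀ u : G →ₗ[ZMod 2] ZMod 2, (∀ x ∈ T, u x = u0 x) → ∀ ξ ∉ T, gam β u ξ = 0 := by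
  classical
  set Z : Set (G → ZMod 2) := {u | (∀ x y, u (x + y) = u x + u y) ∧ ∀ x ∈ T0, u x = 0} with hZ
  have hZc : IsClosed Z := by
    have : Z = (⋂ x, ⋂ y, {u | u (x + y) = u x + u y}) ∩ ⋂ x ∈ T0, {u | u x = 0} := by
      ext u; simp [hZ]
    rw [this]
    refine IsClosed.inter (isClosed_iInter fun x => isClosed_iInter fun y => ?_)
      (isClosed_biInter fun x _ => ?_)
    · have hadd : Continuous (fun p : ZMod 2 × ZMod 2 => p.1 + p.2) :=
        continuous_of_discreteTopology
      have hc : Continuous (fun u : G → ZMod 2 => u x + u y) :=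
        Continuous.comp (f := fun u : G → ZMod 2 => (u x, u y)) hadd
          ((continuous_apply x).prodMk (continuous_apply y))
      exact isClosed_eq (continuous_apply _) hc
    · exact isClosed_eq (continuous_apply _) continuous_const
  haveI : CompactSpace Z := isCompact_iff_compactSpace.1 hZc.isCompact
  haveI : Nonempty Z := ⟨⟨fun _ => 0, by simp [hZ]⟩⟩
  have hlin : ∀ u : Z, ∃ v : G →ₗ[ZMod 2] ZMod 2, ⇑v = u.1 := by
    intro u
    exact ⟨(AddMonoidHom.mk' u.1 u.2.1).toZModLinearMap 2, rfl⟩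
  have hcount : (Function.support β).Countable := by
    have := hβ.countable_support
    refine this.mono fun x hx => ?_
    simpa using hx
  haveI := hcount.to_subtype
  set f : Finset (Function.support β × Function.support β) → Set Z := fun D =>
    {u | ∀ ξ ∉ D.image (fun p => (p.1 : G) + p.2), gam β u.1 ξ = 0} with hf
  obtain ⟨D, hD⟩ : ∃ D, (interior (f D)).Nonempty := by
    refine nonempty_interior_of_iUnion_of_closed (fun D => ?_) ?_
    · have : f D = ⋂ ξ ∈ {ξ | ξ ∉ D.image (fun p => (p.1 : G) + p.2)},
          {u : Z | gam β u.1 ξ = 0} := by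
        ext u; simp [hf]
      rw [this]
      refine isClosed_biInter fun ξ _ => ?_
      exact isClosed_eq ((continuous_gam β hβ ξ).comp continuous_subtype_val) continuous_const
    · rw [Set.eq_univ_iff_forall]
      intro u
      obtain ⟨v, hv⟩ := hlin u
      have hF := hfin v
      rw [hv] at hF
      rw [Set.mem_iUnion]
      have hch : ∀ ξ : G, ∃ p : Option (Function.support β × Function.support β),
          gam β u.1 ξ ≠ 0 → ∃ q, p = some q ∧ (q.1 : G) + q.2 = ξ := by
        intro ξ
        by_cases h : gam β u.1 ξ = 0
        · exact ⟨none, fun h' => absurd h h'⟩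
        · obtain ⟨q, hq⟩ := gam_support β u.1 ξ h
          exact ⟨some q, fun _ => ⟨q, rfl, hq⟩⟩
      choose p hp using hch
      refine ⟨hF.toFinset.biUnion (fun ξ => (p ξ).toFinset), fun ξ hξ => ?_⟩
      by_contra hne
      apply hξ
      obtain ⟨q, hq1, hq2⟩ := hp ξ hne
      rw [Finset.mem_image]
      refine ⟨q, ?_, hq2⟩
      rw [Finset.mem_biUnion]
      exact ⟨ξ, by simpa using hne, by simp [hq1]⟩
  obtain ⟨u0, hu0⟩ := hD
  rw [mem_interior_iff_mem_nhds, nhds_subtype, Filter.mem_comap] at hu0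
  obtain ⟨N, hN, hNsub⟩ := hu0
  rw [nhds_pi, Filter.mem_pi'] at hN
  obtain ⟨I, t, ht, htN⟩ := hN
  obtain ⟨v0, hv0⟩ := hlin u0
  refine ⟨T0 ∪ I ∪ D.image (fun p => (p.1 : G) + p.2), v0, ?_, ?_, ?_⟩
  · intro x hx; simp [hx]
  · intro x hx; rw [hv0]; exact u0.2.2 x hx
  · intro u hu ξ hξ
    have huZ : (u : G → ZMod 2) ∈ Z := by
      refine ⟨fun x y => map_add u x y, fun x hx => ?_⟩
      rw [hu x (by simp [hx]), hv0]
      exact u0.2.2 x hx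
    have : (⟨u, huZ⟩ : Z) ∈ f D := by
      apply hNsub
      apply htN
      intro i hi
      have : u i = u0.1 i := by
        rw [hu i (by simp [Finset.mem_coe.1 hi]), hv0]
      show u i ∈ t i
      rw [this]
      exact mem_of_mem_nhds (ht i)
    exact this ξ (fun h => hξ (Finset.mem_union_right _ h))

/-- The abstract finiteness lemma. -/
lemma abstract_finite (β : G → ℝ) (hβ : Summable fun η => β η ^ 2)
    (hfin : ∀ u : G →ₗ[ZMod 2] ZMod 2, {ξ | gam β u ξ ≠ 0}.Finite) :
    (Function.support β).Finite := by
  classical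
  have hF0 := hfin 0
  obtain ⟨T, u0, hT0, hu00, hT⟩ := baire_step β hβ hfin hF0.toFinset
  set W := Submodule.span (ZMod 2) (T : Set G) with hW
  haveI : Finite W := finite_span T
  haveI := Fintype.ofFinite W
  have hTW : ∀ x ∈ T, x ∈ W := fun x hx => Submodule.subset_span hx
  have hA3 : ∀ ξ ∉ W, ∀ η, ∑ l : W, β (η + l) * β (η + l + ξ) * sg (u0 l) = 0 := by
    intro ξ hξ η
    have := uniq (fun η => β η * β (η + ξ) * sg (u0 η)) (summable_gam β hβ u0 ξ) W ?_ η
    · simp only [map_add, sg_add] at this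
      have h2 : ∑ l : W, β (η + l) * β (η + l + ξ) * sg (u0 l)
          = sg (u0 η) * ∑ l : W, β (η + l) * β (η + l + ξ) * (sg (u0 η) * sg (u0 l)) := by
        rw [Finset.mul_sum]
        refine Finset.sum_congr rfl fun l _ => ?_
        have := sg_sq (u0 η)
        linear_combination (-(β (η + l) * β (η + l + ξ) * sg (u0 l))) * this
      rw [h2, this, mul_zero]
    · intro s hs
      have := hT (u0 + s) (fun x hx => by simp [hs x (hTW x hx)]) ξ (fun h => hξ (hTW ξ h))
      rw [gam] at this
      rw [← this]
      refine tsum_congr fun η => ?_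
      rw [LinearMap.add_apply, sg_add]; ring
  set f : (G →ₗ[ZMod 2] ZMod 2) → G → ℝ := fun σ η => ∑ l : W, sg (σ l) * β (η + l) with hf
  have hA4 : ∀ σ η η', η + η' ∉ W → f σ η * f (σ + u0) η' = 0 := by
    intro σ η η' hηη'
    simp only [hf]
    rw [Finset.sum_mul_sum, Finset.sum_comm]
    have h1 : ∀ k : W, ∑ l : W, sg (σ l) * β (η + l) * (sg ((σ + u0) k) * β (η' + k))
        = ∑ ν : W, sg (σ ν) * (β (η' + k) * β (η' + k + (η' + η + ν)) * sg (u0 k)) := by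
      intro k
      rw [← Equiv.sum_comp (Equiv.addRight k)]
      refine Finset.sum_congr rfl fun ν _ => ?_
      have e : η' + (k:G) + (η' + η + ν) = η + ((ν + k : W) : G) := by
        push_cast
        calc η' + (k:G) + (η' + η + ν) = (η' + η') + (η + (ν + k)) := by abel
          _ = _ := by rw [vadd_self, zero_add]
      rw [e]
      simp only [Equiv.coe_addRight, LinearMap.add_apply, Submodule.coe_add, map_add, sg_add]
      have := sg_sq (σ k)
      linear_combination (sg (σ ν) * β (η + (ν + k)) * sg (u0 k) * β (η' + k)) * this
    simp only [h1]
    rw [Finset.sum_comm]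
    refine Finset.sum_eq_zero fun ν _ => ?_
    rw [← Finset.mul_sum, hA3, mul_zero]
    intro hmem
    apply hηη'
    have := W.add_mem hmem ν.2
    rwa [add_add_cancel', add_comm] at this
  have hA5 : ∀ σ, ∑' η, f σ η ^ 2 = ∑' η, f (σ + u0) η ^ 2 := by
    have h1 : ∀ σ, ∑' η, f σ η ^ 2 = ∑ l : W, ∑ k : W, sg (σ (l + k)) * gam β (0 : G →ₗ[ZMod 2] ZMod 2) (l + k) := by
      intro σ
      have e1 : ∀ η, f σ η ^ 2 = ∑ l : W, ∑ k : W, sg (σ (l + k)) * (β (η + l) * β (η + k)) := by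
        intro η
        rw [sq]
        simp only [hf]
        rw [Finset.sum_mul_sum]
        refine Finset.sum_congr rfl fun l _ => Finset.sum_congr rfl fun k _ => ?_
        rw [map_add, sg_add]; ring
      have hs : ∀ l k : W, Summable fun η => sg (σ (l + k)) * (β (η + l) * β (η + k)) := by
        intro l k
        refine Summable.mul_left _ ?_
        exact (summable_mul _ _ (summable_shift β hβ l) (summable_shift β hβ k)).of_abs
      simp only [e1]
      rw [Summable.tsum_finsetSum (fun l _ => summable_sum fun k _ => hs l k)]
      refine Finset.sum_congr rfl fun l _ => ?_
      rw [Summable.tsum_finsetSum (fun k _ => hs l k)]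
      refine Finset.sum_congr rfl fun k _ => ?_
      rw [tsum_mul_left]
      congr 1
      rw [gam, ← Equiv.tsum_eq (Equiv.addRight (l : G))]
      refine tsum_congr fun η => ?_
      simp only [Equiv.coe_addRight, LinearMap.zero_apply, sg_zero, mul_one]
      rw [add_add_cancel', add_assoc]
    intro σ
    rw [h1, h1]
    refine Finset.sum_congr rfl fun l _ => Finset.sum_congr rfl fun k _ => ?_
    by_cases hg : gam β (0 : G →ₗ[ZMod 2] ZMod 2) ((l:G) + k) = 0
    · rw [hg]; simp
    · rw [LinearMap.add_apply, hu00 _ (by simpa using hg), add_zero]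
  have hsumf : ∀ σ, Summable fun η => f σ η ^ 2 := by
    intro σ
    have e1 : ∀ η, f σ η ^ 2 = ∑ l : W, ∑ k : W, sg (σ (l + k)) * (β (η + l) * β (η + k)) := by
      intro η
      rw [sq]
      simp only [hf]
      rw [Finset.sum_mul_sum]
      refine Finset.sum_congr rfl fun l _ => Finset.sum_congr rfl fun k _ => ?_
      rw [map_add, sg_add]; ring
    simp only [e1]
    refine summable_sum fun l _ => summable_sum fun k _ => Summable.mul_left _ ?_
    exact (summable_mul _ _ (summable_shift β hβ l) (summable_shift β hβ k)).of_abs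
  have hfsupp : ∀ σ, (Function.support (f σ)).Finite := by
    intro σ
    by_cases h0 : ∃ η', f (σ + u0) η' ≠ 0
    · obtain ⟨η', hη'⟩ := h0
      refine (Set.finite_range (fun l : W => η' + (l : G))).subset fun η hη => ?_
      have hmem : η + η' ∈ W := by
        by_contra hn
        rcases mul_eq_zero.1 (hA4 σ η η' hn) with h | h
        · exact hη h
        · exact hη' h
      refine ⟨⟨η + η', hmem⟩, ?_⟩
      simp only
      rw [add_comm, add_add_cancel']
    · push Not at h0
      have h1 := hA5 σ
      simp only [h0] at h1
      have h2 : ∀ η, f σ η = 0 := by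
        intro η
        have h3 : f σ η ^ 2 ≤ ∑' η, f σ η ^ 2 := (hsumf σ).le_tsum η (fun _ _ => sq_nonneg _)
        rw [h1] at h3
        simp at h3
        nlinarith [sq_nonneg (f σ η), pow_eq_zero_iff (n := 2) two_ne_zero (a := f σ η)]
      convert Set.finite_empty
      ext η; simp [h2]
  obtain ⟨S, hS, -, hS2⟩ := exists_sep (⊥ : Submodule (ZMod 2) G) (Finset.univ.image (fun l : W => (l : G)))
  haveI := Fintype.ofFinite S
  have hcard : (0:ℝ) < Fintype.card S := by exact_mod_cast Fintype.card_pos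
  refine (Set.finite_iUnion (fun s : S => hfsupp s)).subset fun η hη => ?_
  by_contra hn
  simp only [Set.mem_iUnion, not_exists, Function.mem_support, not_not] at hn
  have h1 : ∑ s : S, f s η = Fintype.card S * β η := by
    simp only [hf]
    rw [Finset.sum_comm]
    simp only [← Finset.sum_mul]
    rw [Finset.sum_eq_single (0 : W)]
    · simp [sg_zero]
    · intro l _ hl
      rw [sum_sg _ _ (hS2 l (by simp) (by simpa using hl)), zero_mul]
    · simp
  simp only [hn, Finset.sum_const_zero] at h1
  rcases mul_eq_zero.1 h1.symm with h | h
  · exact hcard.ne' h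
  · exact hη h

end abstr

section limits

noncomputable def UF : Ultrafilter ℕ := Filter.hyperfilter ℕ

lemma UF_ge (J : ℕ) : ∀ᶠ n in (UF : Filter ℕ), J ≤ n := by
  have h : (UF : Filter ℕ) ≤ Filter.atTop := by
    rw [← Nat.cofinite_eq_atTop]; exact Filter.hyperfilter_le_cofinite
  exact h (Filter.eventually_ge_atTop J)

lemma lim_exists (r : ℕ → ℝ) (hr : ∀ n, |r n| ≤ 1) :
    ∃ l, Filter.Tendsto r (UF : Filter ℕ) (nhds l) := by
  have hc : IsCompact (Set.Icc (-1:ℝ) 1) := isCompact_Icc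
  obtain ⟨l, -, hl⟩ := hc.ultrafilter_le_nhds (UF.map r) (by
    rw [Filter.le_principal_iff]
    exact Filter.mem_map.2 (Filter.Eventually.of_forall fun n => abs_le.1 (hr n)))
  exact ⟨l, hl⟩

variable (m : ℕ → ℕ)

def Nul : Submodule (ZMod 2) (∀ n, Fin (m n) → ZMod 2) where
  carrier := {ξ | ∀ᶠ n in (UF : Filter ℕ), ξ n = 0}
  zero_mem' := Filter.Eventually.of_forall fun n => rfl
  add_mem' := by
    intro a b ha hb
    filter_upwards [ha, hb] with n h1 h2
    simp [h1, h2]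
  smul_mem' := by
    intro c a ha
    filter_upwards [ha] with n h1
    simp [h1]

noncomputable def YY : Submodule (ZMod 2) (∀ n, Fin (m n) → ZMod 2) :=
  Classical.choose (Submodule.exists_isCompl (Nul m))

lemma YY_spec : IsCompl (Nul m) (YY m) :=
  Classical.choose_spec (Submodule.exists_isCompl (Nul m))

variable {m}

noncomputable def ev (n : ℕ) : YY m →ₗ[ZMod 2] (Fin (m n) → ZMod 2) :=
  (LinearMap.proj n).comp (YY m).subtype

lemma ev_dec (ξ : ∀ n, Fin (m n) → ZMod 2) :
    ∃ y : YY m, ∀ᶠ n in (UF : Filter ℕ), ξ n = ev n y := by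
  have h : ξ ∈ Nul m ⊔ YY m := by rw [(YY_spec m).sup_eq_top]; trivial
  obtain ⟨a, ha, b, hb, rfl⟩ := Submodule.mem_sup.1 h
  refine ⟨⟨b, hb⟩, ?_⟩
  have ha' : ∀ᶠ n in (UF : Filter ℕ), a n = 0 := ha
  filter_upwards [ha'] with n hn
  simp [hn, ev]

lemma ev_ne (y : YY m) (hy : y ≠ 0) : ∀ᶠ n in (UF : Filter ℕ), ev n y ≠ 0 := by
  rw [Ultrafilter.eventually_not]
  intro h
  apply hy
  have h1 : (y : ∀ n, Fin (m n) → ZMod 2) ∈ Nul m := h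
  have h2 := (Submodule.disjoint_def.1 (YY_spec m).disjoint) _ h1 y.2
  exact Subtype.ext h2

lemma ev_inj (T : Finset (YY m)) : ∀ᶠ n in (UF : Filter ℕ), Set.InjOn (ev (m := m) n) T := by
  have h : ∀ᶠ n in (UF : Filter ℕ), ∀ x ∈ T, ∀ y ∈ T, x + y ≠ 0 → ev n (x + y) ≠ 0 := by
    rw [Filter.eventually_all_finset]
    intro x _
    rw [Filter.eventually_all_finset]
    intro y _
    by_cases hxy : x + y = 0
    · simp [hxy]
    · filter_upwards [ev_ne _ hxy] with n hn _
      exact hn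
  filter_upwards [h] with n hn x hx y hy hxy
  by_contra hne
  refine hn x hx y hy (fun h0 => hne ((add_eq_zero_iff' x y).1 h0)) ?_
  rw [map_add, hxy, vadd_self]

noncomputable def bt (F : ∀ n, (Fin (m n) → ZMod 2) → ℝ) (y : YY m) : ℝ :=
  Filter.limUnder (UF : Filter ℕ) (fun n => ft (F n) (ev n y))

lemma bt_eq (F : ∀ n, (Fin (m n) → ZMod 2) → ℝ) (y : YY m) (l : ℝ)
    (h : Filter.Tendsto (fun n => ft (F n) (ev n y)) (UF : Filter ℕ) (nhds l)) : bt F y = l :=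
  h.limUnder_eq

variable (F : ∀ n, (Fin (m n) → ZMod 2) → ℝ)

lemma bt_tendsto (hF : ∀ n x, |F n x| ≤ 1) (y : YY m) :
    Filter.Tendsto (fun n => ft (F n) (ev n y)) (UF : Filter ℕ) (nhds (bt F y)) := by
  obtain ⟨l, hl⟩ := lim_exists (fun n => ft (F n) (ev n y)) (fun n => ft_abs_le _ (hF n) _)
  rwa [bt_eq F y l hl]

lemma bt_bessel (hF : ∀ n x, |F n x| ≤ 1) (T : Finset (YY m)) : ∑ y ∈ T, bt F y ^ 2 ≤ 1 := by
  have h : Filter.Tendsto (fun n => ∑ y ∈ T, ft (F n) (ev n y) ^ 2) (UF : Filter ℕ)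
      (nhds (∑ y ∈ T, bt F y ^ 2)) :=
    tendsto_finsetSum _ fun y _ => (bt_tendsto F hF y).pow 2
  refine le_of_tendsto h ?_
  filter_upwards [ev_inj T] with n hn
  classical
  rw [← Finset.sum_image (f := fun ξ => ft (F n) ξ ^ 2) hn]
  exact (Finset.sum_le_sum_of_subset_of_nonneg (Finset.subset_univ _)
    (fun _ _ _ => sq_nonneg _)).trans (parseval_le _ (hF n))

lemma bt_summable (hF : ∀ n x, |F n x| ≤ 1) : Summable fun y => bt F y ^ 2 :=
  summable_of_sum_le (fun _ => sq_nonneg _) (bt_bessel F hF)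

lemma bunif (hF : ∀ n x, |F n x| ≤ 1) (W : Submodule (ZMod 2) (YY m)) [Fintype W] (M : ℝ)
    (h : ∀ T : Finset (YY m), (∀ t ∈ T, t ∉ W) → ∑ t ∈ T, bt F t ^ 2 < M) :
    ∀ᶠ n in (UF : Filter ℕ), ∀ η : Fin (m n) → ZMod 2, (∀ l : W, η ≠ ev n l) →
      ∑ l : W, ft (F n) (η + ev n l) ^ 2 ≤ M := by
  classical
  by_contra hcon
  rw [← Ultrafilter.eventually_not] at hcon
  have hch : ∀ n, ∃ η : Fin (m n) → ZMod 2, (¬ ∀ η : Fin (m n) → ZMod 2, (∀ l : W, η ≠ ev n l) →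
      ∑ l : W, ft (F n) (η + ev n l) ^ 2 ≤ M) →
      (∀ l : W, η ≠ ev n l) ∧ M < ∑ l : W, ft (F n) (η + ev n l) ^ 2 := by
    intro n
    by_cases hh : ∀ η : Fin (m n) → ZMod 2, (∀ l : W, η ≠ ev n l) →
      ∑ l : W, ft (F n) (η + ev n l) ^ 2 ≤ M
    · exact ⟨0, fun h' => absurd hh h'⟩
    · push Not at hh
      obtain ⟨η, h1, h2⟩ := hh
      exact ⟨η, fun _ => ⟨h1, h2⟩⟩
  choose η hη using hch
  obtain ⟨y, hy⟩ := ev_dec η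
  have hyW : y ∉ W := by
    intro hyW
    obtain ⟨n, h1, h2⟩ := (hcon.and hy).exists
    exact (hη n h1).1 ⟨y, hyW⟩ h2
  have hlim : Filter.Tendsto (fun n => ∑ l : W, ft (F n) (ev n (y + l)) ^ 2) (UF : Filter ℕ)
      (nhds (∑ l : W, bt F (y + l) ^ 2)) :=
    tendsto_finsetSum _ fun l _ => (bt_tendsto F hF _).pow 2
  have hge : M ≤ ∑ l : W, bt F (y + l) ^ 2 := by
    refine ge_of_tendsto hlim ?_
    filter_upwards [hcon, hy] with n h1 h2
    have := (hη n h1).2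
    simp only [map_add]
    rw [h2] at this
    exact this.le
  have hinj : Function.Injective (fun l : W => y + (l : YY m)) := fun a b hab =>
    Subtype.ext (add_left_cancel hab)
  have h3 := h (Finset.univ.image (fun l : W => y + (l : YY m))) (by
    intro t ht
    simp only [Finset.mem_image, Finset.mem_univ, true_and] at ht
    obtain ⟨l, rfl⟩ := ht
    intro hmem
    exact hyW ((W.add_mem_iff_left l.2).1 hmem))
  rw [Finset.sum_image (fun _ _ _ _ h => hinj h)] at h3
  linarith

lemma B1 (hF : ∀ n x, |F n x| ≤ 1) (u : YY m →ₗ[ZMod 2] ZMod 2) (ξ : ℕ → YY m) (J : ℕ) (δ : ℝ) (hδ : 0 < δ) :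
    ∀ᶠ n in (UF : Filter ℕ), ∃ a : Fin (m n) → ZMod 2, ∀ j < J,
      |ft (fun x => F n x * F n (x + a)) (ev n (ξ j)) - gam (bt F) u (ξ j)| < δ := by
  classical
  have hsum := bt_summable F hF
  set M : ℝ := (δ / 3) ^ 2 / (J + 1) with hM
  have hMpos : 0 < M := by positivity
  obtain ⟨s0, hs0⟩ := summable_iff_vanishing_norm.1 hsum M hMpos
  have hQ : ∀ᶠ t : Finset (YY m) in Filter.atTop, ∀ j ∈ Finset.range J,
      |∑ η ∈ t, bt F η * bt F (η + ξ j) * sg (u η) - gam (bt F) u (ξ j)| < δ / 3 := by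
    rw [Filter.eventually_all_finset]
    intro j _
    have := (summable_gam (bt F) hsum u (ξ j)).hasSum
    have h2 := Metric.tendsto_nhds.1 this (δ / 3) (by positivity)
    filter_upwards [h2] with t ht
    rw [Real.dist_eq] at ht
    exact ht
  obtain ⟨s1, hs1⟩ := Filter.eventually_atTop.1 hQ
  set W := Submodule.span (ZMod 2) ((s0 ∪ s1 : Finset (YY m)) : Set (YY m)) with hW
  haveI : Finite W := finite_span _
  haveI := Fintype.ofFinite W
  set WF : Finset (YY m) := Finset.univ.image (fun l : W => (l : YY m)) with hWF
  have hWF_mem : ∀ x, x ∈ WF ↔ x ∈ W := by intro x; simp [hWF]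
  have hsub : ∀ x ∈ s0 ∪ s1, x ∈ WF := fun x hx =>
    (hWF_mem x).2 (Submodule.subset_span (Finset.mem_coe.2 hx))
  have hbu := bunif F hF W M (by
    intro T hT
    have := hs0 T (Finset.disjoint_left.2 fun x hx hx0 =>
      hT x hx ((hWF_mem x).1 (hsub x (Finset.mem_union_left _ hx0))))
    rw [Real.norm_eq_abs] at this
    exact (le_abs_self _).trans_lt this)
  have hmain : ∀ᶠ n in (UF : Filter ℕ), ∀ j ∈ Finset.range J,
      |∑ l : W, ft (F n) (ev n l) * ft (F n) (ev n l + ev n (ξ j)) * sg (u l)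
        - ∑ l : W, bt F l * bt F (l + ξ j) * sg (u l)| < δ / 3 := by
    rw [Filter.eventually_all_finset]
    intro j _
    have hl : Filter.Tendsto (fun n => ∑ l : W, ft (F n) (ev n l) * ft (F n) (ev n l + ev n (ξ j))
        * sg (u l)) (UF : Filter ℕ) (nhds (∑ l : W, bt F l * bt F (l + ξ j) * sg (u l))) := by
      refine tendsto_finsetSum _ fun l _ => ?_
      refine Filter.Tendsto.mul_const _ ((bt_tendsto F hF _).mul ?_)
      have := bt_tendsto F hF ((l : YY m) + ξ j)
      simpa only [map_add] using this
    have h2 := Metric.tendsto_nhds.1 hl (δ / 3) (by positivity)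
    filter_upwards [h2] with n hn
    rw [Real.dist_eq] at hn
    exact hn
  filter_upwards [hbu, hmain, ev_inj WF] with n h1 h2 h3
  set ι : W →+ (Fin (m n) → ZMod 2) := ((ev n).comp W.subtype).toAddMonoidHom with hι
  have hιv : ∀ l : W, ι l = ev n (l : YY m) := fun l => rfl
  obtain ⟨a, ha⟩ := second_moment ι (by
      intro x y hxy
      exact Subtype.ext (h3 ((hWF_mem _).2 x.2) ((hWF_mem _).2 y.2) hxy))
    (u.comp W.subtype).toAddMonoidHom (F n) (hF n) M hMpos.le (by
      intro η hη
      exact h1 η (fun l hl => hη ⟨l, hl.symm⟩)) J (fun j => ev n (ξ j))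
  refine ⟨a, fun j hj => ?_⟩
  have e1 := ha ⟨j, hj⟩
  have e2 := h2 j (Finset.mem_range.2 hj)
  have e3 := hs1 WF (fun x hx => hsub x (Finset.mem_union_right _ hx)) j (Finset.mem_range.2 hj)
  rw [hWF, Finset.sum_image (fun _ _ _ _ h => Subtype.ext h)] at e3
  have e4 : (J:ℝ) * M ≤ (δ / 3) ^ 2 := by
    rw [hM, mul_div_assoc', div_le_iff₀ (by positivity)]
    nlinarith [sq_nonneg (δ / 3)]
  have e5 := abs_le_of_sq_le_sq (e1.trans e4) (by positivity)
  have e6 : |ft (fun x => F n x * F n (x + a)) (ev n (ξ j)) -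
      ∑ l : W, ft (F n) (ev n l) * ft (F n) (ev n l + ev n (ξ j)) * sg (u l)| ≤ δ / 3 := e5
  rw [abs_lt] at e2 e3 ⊢
  rw [abs_le] at e6
  constructor <;> linarith [e2.1, e2.2, e3.1, e3.2, e6.1, e6.2]

lemma B2 (hF : ∀ n x, |F n x| ≤ 1) (u : YY m →ₗ[ZMod 2] ZMod 2) (ξ : ℕ → YY m) :
    ∃ a : ∀ n, Fin (m n) → ZMod 2, ∀ j, Filter.Tendsto
      (fun n => ft (fun x => F n x * F n (x + a n)) (ev n (ξ j))) (UF : Filter ℕ)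
      (nhds (gam (bt F) u (ξ j))) := by
  classical
  set p : ℕ → ℕ → Prop := fun n J => ∃ a : Fin (m n) → ZMod 2, ∀ j < J,
      |ft (fun x => F n x * F n (x + a)) (ev n (ξ j)) - gam (bt F) u (ξ j)| < 1 / ((J:ℝ) + 1) with hp
  have hK : ∀ n, p n (Nat.findGreatest (p n) n) := fun n =>
    Nat.findGreatest_spec (P := p n) (Nat.zero_le n) ⟨0, fun j hj => absurd hj (Nat.not_lt_zero j)⟩
  choose a ha using hK
  refine ⟨a, fun j => ?_⟩
  rw [Metric.tendsto_nhds]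
  intro ε hε
  obtain ⟨J0, hJ0⟩ := exists_nat_one_div_lt hε
  set J := max J0 (j + 1) with hJ
  filter_upwards [B1 F hF u ξ J (1 / ((J:ℝ) + 1)) (by positivity), UF_ge J] with n h1 h2
  have h3 : J ≤ Nat.findGreatest (p n) n := Nat.le_findGreatest h2 h1
  have h4 := ha n j (by omega)
  rw [Real.dist_eq]
  refine h4.trans_le (le_trans ?_ hJ0.le)
  have h5 : J0 ≤ Nat.findGreatest (p n) n := by omega
  have h6 : (J0:ℝ) ≤ (Nat.findGreatest (p n) n : ℕ) := by exact_mod_cast h5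
  exact one_div_le_one_div_of_le (by positivity) (by linarith)

def DT (a : ∀ n, Fin (m n) → ZMod 2) : ∀ n, (Fin (m n) → ZMod 2) → ℝ :=
  fun n x => F n x * F n (x + a n)

lemma key2 (hF : ∀ n x, |F n x| ≤ 1) (u : YY m →ₗ[ZMod 2] ZMod 2) : ∃ a : ∀ n, Fin (m n) → ZMod 2,
    ∀ ξ, (ξ = 0 ∨ gam (bt F) u ξ ≠ 0) → bt (DT F a) ξ = gam (bt F) u ξ := by
  have hcount : (Function.support (bt F)).Countable := by
    have := (bt_summable F hF).countable_support
    refine this.mono fun x hx => ?_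
    simpa using hx
  haveI := hcount.to_subtype
  have hc : (insert 0 (Set.range fun p : Function.support (bt F) × Function.support (bt F) =>
      (p.1 : YY m) + p.2)).Countable := (Set.countable_range _).insert 0
  obtain ⟨ξ, hξ⟩ := hc.exists_eq_range (Set.insert_nonempty _ _)
  obtain ⟨a, ha⟩ := B2 F hF u ξ
  refine ⟨a, fun ζ hζ => ?_⟩
  have hmem : ζ ∈ Set.range ξ := by
    rw [← hξ]
    rcases hζ with h | h
    · exact Or.inl h
    · exact Or.inr (gam_support _ _ _ h)
  obtain ⟨j, rfl⟩ := hmem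
  exact bt_eq _ _ _ (ha j)

lemma key_finite (hF : ∀ n x, |F n x| ≤ 1) (h : ∀ a, (Function.support (bt (DT F a))).Finite) :
    (Function.support (bt F)).Finite := by
  refine abstract_finite (bt F) (bt_summable F hF) fun u => ?_
  obtain ⟨a, ha⟩ := key2 F hF u
  refine (h a).subset fun ξ hξ => ?_
  rw [Function.mem_support, ha ξ (Or.inr hξ)]
  exact hξ

def Dy (x : ℝ) : Prop := ∃ k : ℕ, IsIntegral ℤ ((2:ℝ) ^ k * x)

lemma two_int : IsIntegral ℤ (2:ℝ) := by
  have := isIntegral_algebraMap (R := ℤ) (A := ℝ) (x := 2)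
  simpa using this

lemma Dy_lift {x : ℝ} {k : ℕ} (h : IsIntegral ℤ ((2:ℝ) ^ k * x)) (l : ℕ) :
    IsIntegral ℤ ((2:ℝ) ^ (k + l) * x) := by
  have := (two_int.pow l).mul h
  rwa [← mul_assoc, ← pow_add, add_comm l k] at this

lemma Dy_add {x y : ℝ} (hx : Dy x) (hy : Dy y) : Dy (x + y) := by
  obtain ⟨k, hk⟩ := hx
  obtain ⟨l, hl⟩ := hy
  refine ⟨k + l, ?_⟩
  rw [mul_add]
  refine (Dy_lift hk l).add ?_
  rw [add_comm k l]
  exact Dy_lift hl k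

lemma Dy_int {x : ℝ} (hx : IsIntegral ℤ x) : Dy x := ⟨0, by simpa using hx⟩

lemma Dy_neg {x : ℝ} (hx : Dy x) : Dy (-x) := by
  obtain ⟨k, hk⟩ := hx
  exact ⟨k, by rw [mul_neg]; exact hk.neg⟩

lemma Dy_sg_mul {x : ℝ} (hx : Dy x) (z : ZMod 2) : Dy (sg z * x) := by
  rcases zcases z with rfl | rfl
  · rw [sg_zero, one_mul]; exact hx
  · rw [sg_one, neg_one_mul]; exact Dy_neg hx

lemma Dy_sum {ι : Type*} (s : Finset ι) (f : ι → ℝ) (h : ∀ i ∈ s, Dy (f i)) :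
    Dy (∑ i ∈ s, f i) :=
  Finset.sum_induction f Dy (fun _ _ => Dy_add) (Dy_int isIntegral_zero) h

lemma Dy_of_two_pow {x : ℝ} (l : ℕ) (h : Dy ((2:ℝ) ^ l * x)) : Dy x := by
  obtain ⟨k, hk⟩ := h
  exact ⟨k + l, by rwa [pow_add, mul_assoc]⟩

lemma Dy_of_sq {x : ℝ} (h : Dy (x ^ 2)) : Dy x := by
  obtain ⟨k, hk⟩ := h
  refine ⟨k, IsIntegral.of_pow (n := 2) two_pos ?_⟩
  have := Dy_lift hk k
  convert this using 1
  ring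

lemma not_Dy : ¬ Dy (1 / 3) := by
  rintro ⟨k, hk⟩
  have h1 : IsIntegral ℤ ((2:ℚ) ^ k * (1 / 3)) := by
    rw [← isIntegral_algebraMap_iff (algebraMap ℚ ℝ).injective]
    simpa using hk
  obtain ⟨z, hz⟩ := IsIntegrallyClosed.isIntegral_iff.1 h1
  have h2 : (3 * z : ℤ) = 2 ^ k := by
    have : (3 * z : ℚ) = 2 ^ k := by
      have hz' : (z:ℚ) = 2 ^ k * (1 / 3) := by simpa using hz
      rw [hz']; ring
    exact_mod_cast this
  have h3 : (3:ℤ) ∣ 2 ^ k := ⟨z, h2.symm⟩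
  have h4 : (3:ℤ) ∣ 2 := Int.prime_three.dvd_of_dvd_pow h3
  omega

lemma key_dy (hF : ∀ n x, |F n x| ≤ 1) (hfin : (Function.support (bt F)).Finite) (h : ∀ a, Dy (bt (DT F a) 0)) (ζ : YY m) :
    Dy (bt F ζ) := by
  classical
  have hg : ∀ u : YY m →ₗ[ZMod 2] ZMod 2, Dy (∑ η ∈ hfin.toFinset, bt F η ^ 2 * sg (u η)) := by
    intro u
    obtain ⟨a, ha⟩ := key2 F hF u
    have h1 := h a
    rw [ha 0 (Or.inl rfl), gam, tsum_eq_sum (s := hfin.toFinset)] at h1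
    · convert h1 using 2 with η
      rw [add_zero, sq]
    · intro η hη
      have : bt F η = 0 := by simpa using hη
      simp [this]
  obtain ⟨S, hS, -, hS2⟩ := exists_sep (⊥ : Submodule (ZMod 2) (YY m))
    (hfin.toFinset.image (· + ζ))
  haveI := Fintype.ofFinite S
  have h1 : ∑ s : S, sg ((s : YY m →ₗ[ZMod 2] ZMod 2) ζ) *
      ∑ η ∈ hfin.toFinset, bt F η ^ 2 * sg ((s : YY m →ₗ[ZMod 2] ZMod 2) η)
      = Fintype.card S * bt F ζ ^ 2 := by
    have h2 : ∀ s : S, sg ((s : YY m →ₗ[ZMod 2] ZMod 2) ζ) *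
      ∑ η ∈ hfin.toFinset, bt F η ^ 2 * sg ((s : YY m →ₗ[ZMod 2] ZMod 2) η)
      = ∑ η ∈ hfin.toFinset, bt F η ^ 2 * sg ((s : YY m →ₗ[ZMod 2] ZMod 2) (η + ζ)) := by
      intro s
      rw [Finset.mul_sum]
      refine Finset.sum_congr rfl fun η _ => ?_
      rw [map_add, sg_add]; ring
    simp only [h2]
    rw [Finset.sum_comm]
    simp only [← Finset.mul_sum]
    rw [Finset.sum_eq_single ζ]
    · rw [sum_sg_zero _ _ (fun s _ => by rw [vadd_self, map_zero])]
      ring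
    · intro η hη hne
      rw [sum_sg _ _ (hS2 _ (Finset.mem_image_of_mem _ hη) (by
        rw [Submodule.mem_bot, add_eq_zero_iff']; exact hne)), mul_zero]
    · intro hn
      have : bt F ζ = 0 := by simpa using hn
      simp [this]
  have h2 : Dy (Fintype.card S * bt F ζ ^ 2) := by
    rw [← h1]
    exact Dy_sum _ _ fun s _ => Dy_sg_mul (hg s) _
  have h3 : Fintype.card S = 2 ^ Module.finrank (ZMod 2) S := by
    have := Module.card_eq_pow_finrank (K := ZMod 2) (V := S)
    rwa [ZMod.card] at this
  rw [h3] at h2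
  push_cast at h2
  exact Dy_of_sq (Dy_of_two_pow _ h2)

end limits

section degs
variable {m : ℕ}

def Dg : ℕ → ((Fin m → ZMod 2) → ZMod 2) → Prop
  | 0, P => ∀ a x, P (x + a) = P x
  | d + 1, P => ∀ a, Dg d (fun x => P x + P (x + a))

lemma z2 (a : ZMod 2) : a + a = 0 := vadd_self a

lemma Dg_const (d : ℕ) (c : ZMod 2) : Dg d (fun _ : Fin m → ZMod 2 => c) := by
  induction d generalizing c with
  | zero => intro a x; rfl
  | succ d ih => intro a; exact ih _

lemma Dg_succ (d : ℕ) (P : (Fin m → ZMod 2) → ZMod 2) (h : Dg d P) : Dg (d + 1) P := by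
  induction d generalizing P with
  | zero =>
    intro a
    have : (fun x => P x + P (x + a)) = fun _ => 0 := by
      funext x; rw [h a x, z2]
    rw [this]; exact Dg_const _ _
  | succ d ih => intro a; exact ih _ (h a)

lemma Dg_mono {d e : ℕ} (hde : d ≤ e) (P : (Fin m → ZMod 2) → ZMod 2) (h : Dg d P) : Dg e P := by
  induction hde with
  | refl => exact h
  | step _ ih => exact Dg_succ _ _ ih

lemma Dg_add (d : ℕ) (P Q : (Fin m → ZMod 2) → ZMod 2) (h : Dg d P) (h' : Dg d Q) :
    Dg d (fun x => P x + Q x) := by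
  induction d generalizing P Q with
  | zero => intro a x; simp only [h a x, h' a x]
  | succ d ih =>
    intro a
    have := ih _ _ (h a) (h' a)
    convert this using 2 with x
    ring

lemma Dg_trans (d : ℕ) (P : (Fin m → ZMod 2) → ZMod 2) (b : Fin m → ZMod 2) (h : Dg d P) :
    Dg d (fun x => P (x + b)) := by
  induction d generalizing P with
  | zero => intro a x; simp only [h b]; exact h a x
  | succ d ih =>
    intro a
    have := ih _ (h a)
    convert this using 4 with x
    abel

lemma Dg_const_mul (d : ℕ) (P : (Fin m → ZMod 2) → ZMod 2) (c : ZMod 2) (h : Dg d P) :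
    Dg d (fun x => c * P x) := by
  rcases zcases c with rfl | rfl
  · simp only [zero_mul]; exact Dg_const _ _
  · simpa only [one_mul] using h

lemma Dg_zero_eq (P : (Fin m → ZMod 2) → ZMod 2) (h : Dg 0 P) : P = fun _ => P 0 := by
  funext x
  have := h x 0
  rwa [zero_add] at this

lemma Dg_mul (n k l : ℕ) (hn : k + l = n) (P Q : (Fin m → ZMod 2) → ZMod 2) (h : Dg k P)
    (h' : Dg l Q) : Dg n (fun x => P x * Q x) := by
  induction n generalizing k l P Q with
  | zero =>
    obtain rfl : k = 0 := by omega
    obtain rfl : l = 0 := by omega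
    intro a x
    simp only [h a x, h' a x]
  | succ n ih =>
    rcases k with _ | k
    · obtain rfl : l = n + 1 := by omega
      rw [Dg_zero_eq P h]
      exact Dg_const_mul _ _ _ h'
    rcases l with _ | l
    · obtain rfl : k = n := by omega
      rw [Dg_zero_eq Q h']
      simp only [mul_comm _ (Q 0)]
      exact Dg_const_mul _ _ _ h
    intro a
    have h1 := ih k (l + 1) (by omega) _ _ (h a) (Dg_trans _ Q a h')
    have h2 := ih (k + 1) l (by omega) _ _ h (h' a)
    convert Dg_add _ _ _ h1 h2 using 2 with x
    have := z2 (P x * Q (x + a))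
    linear_combination -this

lemma Dg_sum {ι : Type*} (s : Finset ι) (d : ℕ) (P : ι → (Fin m → ZMod 2) → ZMod 2)
    (h : ∀ i ∈ s, Dg d (P i)) : Dg d (fun x => ∑ i ∈ s, P i x) := by
  classical
  induction s using Finset.induction_on with
  | empty => simp only [Finset.sum_empty]; exact Dg_const _ _
  | insert i s hi ih =>
    simp only [Finset.sum_insert hi]
    exact Dg_add _ _ _ (h i (by simp)) (ih fun j hj => h j (by simp [hj]))

lemma Dg_prod {ι : Type*} (s : Finset ι) (e : ι → ℕ) (P : ι → (Fin m → ZMod 2) → ZMod 2)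
    (h : ∀ i ∈ s, Dg (e i) (P i)) : Dg (∑ i ∈ s, e i) (fun x => ∏ i ∈ s, P i x) := by
  classical
  induction s using Finset.induction_on with
  | empty => simp only [Finset.prod_empty]; exact Dg_const _ _
  | insert i s hi ih =>
    simp only [Finset.prod_insert hi, Finset.sum_insert hi]
    exact Dg_mul _ _ _ rfl _ _ (h i (by simp)) (ih fun j hj => h j (by simp [hj]))

lemma Dg_coord (i : Fin m) : Dg 1 (fun x : Fin m → ZMod 2 => x i) := by
  intro a b x
  simp only [Pi.add_apply]
  linear_combination z2 (b i)

lemma Dg_pow (i : Fin m) (k : ℕ) : Dg k (fun x : Fin m → ZMod 2 => x i ^ k) := by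
  induction k with
  | zero => simp only [pow_zero]; exact Dg_const _ _
  | succ k ih =>
    simp only [pow_succ]
    exact Dg_mul _ _ _ rfl _ _ ih (Dg_coord i)

lemma Dg_of_DegLE (d : ℕ) (P : (Fin m → ZMod 2) → ZMod 2) (h : DegLE d P) : Dg d P := by
  obtain ⟨p, hp, hpe⟩ := h
  have : P = fun x => MvPolynomial.eval x p := by funext x; exact (hpe x).symm
  rw [this]
  simp only [MvPolynomial.eval_eq]
  refine Dg_sum _ _ _ fun s hs => Dg_const_mul _ _ _ ?_
  refine Dg_mono ((MvPolynomial.le_totalDegree hs).trans hp) _ ?_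
  exact Dg_prod _ _ _ fun i _ => Dg_pow i _

lemma Dg_of_RankLE (d r : ℕ) (P : (Fin m → ZMod 2) → ZMod 2) (h : RankLE d r P) :
    Dg (r * d) P := by
  classical
  obtain ⟨Q, Γ, hQ, hP⟩ := h
  have : P = fun x => ∑ y : Fin r → ZMod 2, Γ y * ∏ j, (Q j x + (y j + 1)) := by
    funext x
    rw [hP, Finset.sum_eq_single (fun j => Q j x)]
    · have : ∀ j, Q j x + (Q j x + 1) = 1 := fun j => by linear_combination z2 (Q j x)
      simp [this]
    · intro y _ hy
      obtain ⟨j, hj⟩ := Function.ne_iff.1 hy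
      rw [Finset.prod_eq_zero (Finset.mem_univ j), mul_zero]
      revert hj
      generalize y j = a
      generalize Q j x = b
      revert a b
      decide
    · simp
  rw [this]
  refine Dg_sum _ _ _ fun y _ => Dg_const_mul _ _ _ ?_
  have := Dg_prod (Finset.univ : Finset (Fin r)) (fun _ => d) (fun j x => Q j x + (y j + 1))
    (fun j _ => Dg_add _ _ _ (Dg_of_DegLE _ _ (hQ j)) (Dg_const _ _))
  simpa using this

end degs

lemma main_T (d : ℕ) : ∀ (m : ℕ → ℕ) (P : ∀ n, (Fin (m n) → ZMod 2) → ZMod 2),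
    (∀ n, Dg d (P n)) → (Function.support (bt (fun n x => sg (P n x)))).Finite ∧
      ∀ ξ, Dy (bt (fun n x => sg (P n x)) ξ) := by
  induction d with
  | zero =>
    intro m P hP
    have hft : ∀ n ξ, ft (fun x => sg (P n x)) ξ = if ξ = 0 then sg (P n 0) else 0 := by
      intro n ξ
      rw [Dg_zero_eq _ (hP n), ft, ← Finset.mul_sum]
      rw [sum_chi]
      split_ifs with h
      · field_simp
      · simp
    have h0 : ∀ ξ : YY m, ξ ≠ 0 → bt (fun n x => sg (P n x)) ξ = 0 := by
      intro ξ hξ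
      apply bt_eq
      refine tendsto_const_nhds.congr' ?_
      filter_upwards [ev_ne ξ hξ] with n hn
      rw [hft, if_neg hn]
    refine ⟨(Set.finite_singleton 0).subset fun ξ hξ => ?_, fun ξ => ?_⟩
    · by_contra h
      exact hξ (h0 ξ h)
    · by_cases h : ξ = 0
      · subst h
        by_cases hu : ∀ᶠ n in (UF : Filter ℕ), P n 0 = 0
        · have : bt (fun n x => sg (P n x)) 0 = 1 := by
            apply bt_eq
            refine tendsto_const_nhds.congr' ?_
            filter_upwards [hu] with n hn
            rw [hft, map_zero, if_pos rfl, hn, sg_zero]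
          rw [this]
          exact Dy_int isIntegral_one
        · rw [← Ultrafilter.eventually_not] at hu
          have : bt (fun n x => sg (P n x)) 0 = -1 := by
            apply bt_eq
            refine tendsto_const_nhds.congr' ?_
            filter_upwards [hu] with n hn
            rw [hft, map_zero, if_pos rfl, (zcases _).resolve_left hn, sg_one]
          rw [this]
          exact Dy_int isIntegral_one.neg
      · rw [h0 ξ h]
        exact Dy_int isIntegral_zero
  | succ d ih =>
    intro m P hP
    have hF : ∀ n x, |(fun n x => sg (P n x) : ∀ n, (Fin (m n) → ZMod 2) → ℝ) n x| ≤ 1 :=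
      fun n x => (sg_abs _).le
    have hDT : ∀ a, DT (fun n x => sg (P n x)) a = fun n x => sg (P n x + P n (x + a n)) := by
      intro a
      funext n x
      rw [sg_add]; rfl
    have hf := key_finite (fun n x => sg (P n x)) hF (fun a => by
      rw [hDT a]; exact (ih m _ fun n => hP n (a n)).1)
    exact ⟨hf, key_dy _ hF hf (fun a => by
      rw [hDT a]; exact (ih m _ fun n => hP n (a n)).2 0)⟩

lemma ft_prOne {m : ℕ} (P : (Fin m → ZMod 2) → ZMod 2) :
    ft (fun x => sg (P x)) 0 = 1 - 2 * prOne P := by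
  have h : ∀ x, sg (P x) = 1 - 2 * (if P x = 1 then 1 else 0) := by
    intro x
    rcases zcases (P x) with h | h <;> rw [h]
    · simp [sg_zero]
    · simp [sg_one]; norm_num
  simp only [ft, chi_zero, mul_one, prOne, distOf]
  simp only [h, Finset.sum_sub_distrib, ← Finset.mul_sum, Finset.sum_boole]
  simp
  field_simp

lemma main_gap (D : ℕ) : ∃ δ > (0:ℝ), ∀ m : ℕ, ∀ P : (Fin m → ZMod 2) → ZMod 2,
    Dg D P → |prOne P - 1 / 3| ≥ δ := by
  by_contra! hcon
  have hch : ∀ n : ℕ, ∃ (m : ℕ) (P : (Fin m → ZMod 2) → ZMod 2), Dg D P ∧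
      |prOne P - 1 / 3| < 1 / ((n:ℝ) + 1) := fun n => hcon _ (by positivity)
  choose m P hP hlt using hch
  have h1 := (main_T D m P hP).2 0
  have h2 : bt (fun n x => sg (P n x)) 0 = 1 / 3 := by
    apply bt_eq
    rw [Metric.tendsto_nhds]
    intro ε hε
    obtain ⟨J, hJ⟩ := exists_nat_one_div_lt (half_pos hε)
    filter_upwards [UF_ge J] with n hn
    rw [map_zero, ft_prOne, Real.dist_eq]
    have h3 := hlt n
    have h4 : 1 / ((n:ℝ) + 1) ≤ 1 / ((J:ℝ) + 1) :=
      one_div_le_one_div_of_le (by positivity) (by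
        have : (J:ℝ) ≤ n := by exact_mod_cast hn
        linarith)
    rw [abs_lt] at h3 ⊢
    constructor <;> linarith [h3.1, h3.2]
  rw [h2] at h1
  exact not_Dy h1

end SPG

/-- a single function of bounded `rank_d` is at constant distance from
`Ber(1/3)`; in particular so is every polynomial of degree at most `d`. -/
theorem single_polynomial_gap :
    (∀ d r : ℕ, 0 < d → 0 < r → ∃ δ > (0:ℝ), ∀ m : ℕ,
      ∀ P : (Fin m → ZMod 2) → ZMod 2, RankLE d r P → |prOne P - 1/3| ≥ δ) ∧
    (∀ d : ℕ, 0 < d → ∃ δ > (0:ℝ), ∀ m : ℕ,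
      ∀ P : (Fin m → ZMod 2) → ZMod 2, DegLE d P → |prOne P - 1/3| ≥ δ) := by
  constructor
  · intro d r _ _
    obtain ⟨δ, hδ, h⟩ := SPG.main_gap (r * d)
    exact ⟨δ, hδ, fun m P hP => h m P (SPG.Dg_of_RankLE d r P hP)⟩
  · intro d _
    obtain ⟨δ, hδ, h⟩ := SPG.main_gap d
    exact ⟨δ, hδ, fun m P hP => h m P (SPG.Dg_of_DegLE d P hP)⟩
end
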